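/- Let G be a group with at least 3 elements. Then there exists a simple group S and an injective group homomorphism φ : G → S such that for every p ∈ {2, 3, 4, ...} ∪ {∞}, there exists an element x ∈ S of order p with S generated by φ(G) ∪ {x}. -/

import Mathlib

universe u

open Cardinal Equiv
open scoped commutatorElement

section Supports

theorem Equiv.Perm.apply_inv_self' {α : Type*} (f : Perm α) (x : α) : f (f⁻¹ x) = x :=
  f.apply_symm_apply x

theorem Equiv.Perm.inv_apply_self' {α : Type*} (f : Perm α) (x : α) : f⁻¹ (f x) = x :=
  f.symm_apply_apply x

variable {Ω : Type u}

/-- The permutations that move only points of `s`. -/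
def supportedIn (s : Set Ω) : Subgroup (Perm Ω) where
  carrier := {σ | ∀ ω ∉ s, σ ω = ω}
  mul_mem' {a b} ha hb ω hω := by rw [Perm.mul_apply, hb ω hω, ha ω hω]
  one_mem' _ _ := rfl
  inv_mem' {a} ha ω hω := by rw [Perm.inv_eq_iff_eq, ha ω hω]

theorem supportedIn_mono {s t : Set Ω} (h : s ⊆ t) : supportedIn s ≤ supportedIn t :=
  fun _ hσ ω hω => hσ ω fun h' => hω (h h')

theorem supportedIn_univ : supportedIn (Set.univ : Set Ω) = ⊤ :=
  eq_top_iff.2 fun _ _ ω hω => (hω (Set.mem_univ ω)).elim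

theorem map_mem_of_mem_supportedIn {s : Set Ω} {σ : Perm Ω} (hσ : σ ∈ supportedIn s) {ω : Ω}
    (hω : ω ∈ s) : σ ω ∈ s := by
  by_contra h
  have := hσ _ h
  rw [σ.injective this] at h
  exact h hω

theorem commute_of_disjoint {s t : Set Ω} (h : Disjoint s t) {σ τ : Perm Ω}
    (hσ : σ ∈ supportedIn s) (hτ : τ ∈ supportedIn t) : Commute σ τ := by
  rw [Set.disjoint_left] at h
  ext ω
  simp only [Perm.mul_apply]
  by_cases hs : ω ∈ s
  · rw [hτ ω (h hs), hτ _ (h (map_mem_of_mem_supportedIn hσ hs))]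
  · rw [hσ ω hs]
    by_cases ht : ω ∈ t
    · rw [hσ _ fun h' => h h' (map_mem_of_mem_supportedIn hτ ht)]
    · rw [hτ ω ht, hσ ω hs]

theorem conj_mem_supportedIn {s : Set Ω} {σ : Perm Ω} (hσ : σ ∈ supportedIn s) (t : Perm Ω) :
    t * σ * t⁻¹ ∈ supportedIn (t '' s) := by
  intro ω hω
  rw [Perm.mul_apply, Perm.mul_apply, hσ, Perm.apply_inv_self']
  intro h
  exact hω ⟨_, h, Perm.apply_inv_self' _ _⟩

/-- A set of the same cardinality as the whole type. -/
def Big (s : Set Ω) : Prop := #Ω ≤ #s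

theorem Big.mono {s t : Set Ω} (hs : Big s) (h : s ⊆ t) : Big t :=
  hs.trans (mk_le_mk_of_subset h)

theorem Big.exists_injective {s : Set Ω} (hs : Big s) {Z : Type u} (hZ : #Z ≤ #Ω) :
    ∃ f : Z → Ω, Function.Injective f ∧ ∀ z, f z ∈ s := by
  obtain ⟨f⟩ := hZ.trans hs
  exact ⟨fun z => f z, fun a b h => f.injective (Subtype.ext h), fun z => (f z).2⟩

theorem big_of_injective {s : Set Ω} {Z : Type u} (hZ : #Ω ≤ #Z) (f : Z → Ω)
    (hf : Function.Injective f) (h : ∀ z, f z ∈ s) : Big s :=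
  hZ.trans (mk_le_of_injective (f := fun z => (⟨f z, h z⟩ : s))
    fun _ _ hab => hf (congrArg Subtype.val hab))

theorem Big.image {s : Set Ω} (hs : Big s) (t : Perm Ω) : Big (t '' s) := by
  unfold Big
  rwa [mk_image_eq t.injective]

theorem Big.of_union [Infinite Ω] {s t : Set Ω} (h : Big (s ∪ t)) : Big s ∨ Big t := by
  by_contra! hn
  simp only [Big, not_le] at hn
  have := (mk_union_le s t).trans_lt (add_lt_of_lt (aleph0_le_mk Ω) hn.1 hn.2)
  exact absurd h this.not_ge

theorem Big.mk_eq {s : Set Ω} (hs : Big s) : #s = #Ω := le_antisymm (mk_set_le s) hs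

theorem mk_prod_countable [Infinite Ω] (Z : Type) [Countable Z] [Nonempty Z] :
    #(Z × Ω) = #Ω := by
  have : Nonempty Ω := inferInstance
  rw [mk_prod, lift_uzero, mul_comm]
  refine mul_eq_left (aleph0_le_mk Ω) ?_ ?_
  · exact (lift_le_aleph0.2 (mk_le_aleph0 (α := Z))).trans (aleph0_le_mk Ω)
  · simp

/-- An injection between subsets of `A` with big complements in `A` extends to a permutation
of `A`. -/
theorem exists_mem_supportedIn_eqOn {A S : Set Ω} {f : Ω → Ω} (hS : S ⊆ A)
    (hf : Set.InjOn f S) (hfA : ∀ z ∈ S, f z ∈ A) (h1 : Big (A \ S)) (h2 : Big (A \ f '' S)) :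
    ∃ u ∈ supportedIn A, ∀ z ∈ S, u z = f z := by
  classical
  let S' : Set A := {z | (z : Ω) ∈ S}
  let F : S' ↪ A := ⟨fun z => ⟨f z, hfA _ z.2⟩, fun a b h => by
    apply Subtype.ext; apply Subtype.ext
    exact hf a.2 b.2 (congrArg Subtype.val h)⟩
  have e1 : (S'ᶜ : Set A) ≃ (A \ S : Set Ω) :=
    { toFun := fun z => ⟨z, z.1.2, z.2⟩
      invFun := fun z => ⟨⟨z, z.2.1⟩, z.2.2⟩
      left_inv := fun _ => rfl
      right_inv := fun _ => rfl }
  have e2 : ((Set.range F)ᶜ : Set A) ≃ (A \ f '' S : Set Ω) :=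
    { toFun := fun z => ⟨z, z.1.2, by
        rintro ⟨y, hy, hyz⟩
        exact z.2 ⟨⟨⟨y, hS hy⟩, hy⟩, Subtype.ext hyz⟩⟩
      invFun := fun z => ⟨⟨z, z.2.1⟩, by
        rintro ⟨y, hy⟩
        exact z.2.2 ⟨y, y.2, congrArg Subtype.val hy⟩⟩
      left_inv := fun _ => rfl
      right_inv := fun _ => rfl }
  obtain ⟨e3⟩ := Cardinal.eq.1 (h1.mk_eq.trans h2.mk_eq.symm)
  obtain ⟨g, hg⟩ := Cardinal.extend_function F ⟨e1.trans (e3.trans e2.symm)⟩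
  refine ⟨Perm.ofSubtype g, fun ω hω => Perm.ofSubtype_apply_of_not_mem g hω, fun z hz => ?_⟩
  rw [Perm.ofSubtype_apply_of_mem g (hS hz)]
  exact congrArg Subtype.val (hg ⟨⟨z, hS hz⟩, hz⟩)

theorem supportedIn_union_le [Infinite Ω] {A B : Set Ω} {P : Subgroup (Perm Ω)}
    (hA : supportedIn A ≤ P) (hB : supportedIn B ≤ P) (hAB : Big (A ∩ B)) :
    supportedIn (A ∪ B) ≤ P := by
  obtain ⟨c, hc, hcAB⟩ := hAB.exists_injective (mk_prod_countable (Fin 3)).le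
  have hcA := fun z => (hcAB z).1
  have hcB := fun z => (hcAB z).2
  have hne : ∀ {i j ω ω'}, i ≠ j → c (i, ω) ≠ c (j, ω') := fun hij h =>
    hij (congrArg Prod.fst (hc h))
  have big3 : ∀ S : Set Ω, (∀ ω, c (2, ω) ∈ S) → Big S := fun S h =>
    big_of_injective le_rfl (fun ω => c (2, ω)) (fun a b h => congrArg Prod.snd (hc h)) h
  classical
  obtain ⟨t, htB, ht⟩ : ∃ t ∈ supportedIn B, ∀ z ∈ (B \ A) ∪ Set.range (fun ω => c (1, ω)),
      t z = if z ∈ A then z else c (0, z) := by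
    apply exists_mem_supportedIn_eqOn
    · rintro z (hz | ⟨ω, rfl⟩)
      exacts [hz.1, hcB _]
    · rintro z (hz | ⟨ω, rfl⟩) z' (hz' | ⟨ω', rfl⟩) h <;> dsimp only at h ⊢
      · rw [if_neg hz.2, if_neg hz'.2] at h
        exact congrArg Prod.snd (hc h)
      · rw [if_neg hz.2, if_pos (hcA _)] at h
        exact (hne (by decide) h).elim
      · rw [if_neg hz'.2, if_pos (hcA _)] at h
        exact (hne (by decide) h).elim
      · rwa [if_pos (hcA _), if_pos (hcA _)] at h
    · intro z hz
      split_ifs with h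
      · rcases hz with hz | ⟨ω, rfl⟩
        exacts [hz.1, hcB _]
      · exact hcB _
    · refine big3 _ fun ω => ⟨hcB _, ?_⟩
      rintro (hz | ⟨ω', h⟩)
      exacts [hz.2 (hcA _), hne (by decide) h]
    · refine big3 _ fun ω => ⟨hcB _, ?_⟩
      rintro ⟨z, hz | ⟨ω', rfl⟩, h⟩ <;> dsimp only at h
      · rw [if_neg hz.2] at h
        exact hne (by decide) h
      · rw [if_pos (hcA _)] at h
        exact hne (by decide) h
  have ht0 : ∀ z ∈ B \ A, t z = c (0, z) := fun z hz => by
    rw [ht z (Or.inl hz), if_neg hz.2]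
  have ht1 : ∀ ω, t (c (1, ω)) = c (1, ω) := fun ω => by
    rw [ht _ (Or.inr ⟨ω, rfl⟩), if_pos (hcA _)]
  have main : ∀ d ∈ supportedIn (A ∪ B), Big (A \ d ⁻¹' (B \ A)) → d ∈ P := by
    intro d hd hbig
    have hT : ∀ z, d z ∈ B \ A → z ∈ A ∪ B := fun z hz => by
      by_contra h
      rw [hd z h] at hz
      exact h (Or.inr hz.1)
    obtain ⟨u1, hu1A, hu1⟩ : ∃ u ∈ supportedIn A, ∀ z ∈ A ∩ d ⁻¹' (B \ A), u z = c (1, z) := by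
      apply exists_mem_supportedIn_eqOn
      · exact Set.inter_subset_left
      · exact fun z _ z' _ h => congrArg Prod.snd (hc h)
      · exact fun z _ => hcA _
      · exact hbig.mono fun z hz => ⟨hz.1, fun h => hz.2 h.2⟩
      · refine big3 _ fun ω => ⟨hcA _, ?_⟩
        rintro ⟨z, -, h⟩
        exact hne (by decide) h
    have htu : ∀ z, d z ∈ B \ A → ∃ i ω, i ≠ 2 ∧ t (u1 z) = c (i, ω) := by
      intro z hz
      by_cases hzA : z ∈ A
      · exact ⟨1, z, by decide, by rw [hu1 z ⟨hzA, hz⟩, ht1]⟩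
      · exact ⟨0, z, by decide, by rw [hu1A z hzA, ht0 z ⟨(hT z hz).resolve_left hzA, hzA⟩]⟩
    obtain ⟨u2, hu2A, hu2⟩ : ∃ u ∈ supportedIn A,
        ∀ z ∈ (t * u1) '' (d ⁻¹' (B \ A)), u z = c (0, d ((t * u1)⁻¹ z)) := by
      apply exists_mem_supportedIn_eqOn
      · rintro _ ⟨z, hz, rfl⟩
        obtain ⟨i, ω, -, h⟩ := htu z hz
        rw [Perm.mul_apply, h]
        exact hcA _
      · exact fun z _ z' _ h =>
          (t * u1)⁻¹.injective (d.injective (congrArg Prod.snd (hc h)))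
      · exact fun z _ => hcA _
      · refine big3 _ fun ω => ⟨hcA _, ?_⟩
        rintro ⟨z, hz, h⟩
        obtain ⟨i, ω', hi, h'⟩ := htu z hz
        rw [Perm.mul_apply, h'] at h
        exact hne hi h
      · refine big3 _ fun ω => ⟨hcA _, ?_⟩
        rintro ⟨z, -, h⟩
        exact hne (by decide) h
    let e := t⁻¹ * u2 * (t * u1)
    have heP : e ∈ P := P.mul_mem (P.mul_mem (P.inv_mem (hB htB)) (hA hu2A))
      (P.mul_mem (hB htB) (hA hu1A))
    have heAB : e ∈ supportedIn (A ∪ B) := by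
      have h1 : supportedIn A ≤ supportedIn (A ∪ B) := supportedIn_mono Set.subset_union_left
      have h2 : supportedIn B ≤ supportedIn (A ∪ B) := supportedIn_mono Set.subset_union_right
      exact mul_mem (mul_mem (inv_mem (h2 htB)) (h1 hu2A)) (mul_mem (h2 htB) (h1 hu1A))
    have hed : ∀ z, d z ∈ B \ A → e z = d z := fun z hz => by
      change t⁻¹ (u2 ((t * u1) z)) = d z
      rw [hu2 _ ⟨z, hz, rfl⟩, Perm.inv_apply_self', Perm.inv_eq_iff_eq, ht0 _ hz]
    have hde : d * e⁻¹ ∈ supportedIn A := by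
      intro ω hω
      rw [Perm.mul_apply]
      by_cases hωB : ω ∈ B
      · have h : d (d⁻¹ ω) ∈ B \ A := by rw [Perm.apply_inv_self']; exact ⟨hωB, hω⟩
        have := hed _ h
        rw [Perm.apply_inv_self'] at this
        rw [Perm.inv_eq_iff_eq.2 this.symm, Perm.apply_inv_self']
      · have h : ω ∉ A ∪ B := fun h => h.elim hω hωB
        rw [(inv_mem heAB) ω h, hd ω h]
    have := P.mul_mem (hA hde) heP
    rwa [inv_mul_cancel_right] at this
  intro d hd
  by_cases hbig : Big (A \ d ⁻¹' (B \ A))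
  · exact main d hd hbig
  have hW : Big ((B \ A) \ d ⁻¹' (B \ A)) := by
    refine Big.of_union (s := A \ d ⁻¹' (B \ A)) ?_ |>.resolve_left hbig
    refine ((hAB.mono Set.inter_subset_left).image d⁻¹).mono ?_
    rintro _ ⟨z, hz, rfl⟩
    have hz' : d⁻¹ z ∈ A ∪ B := map_mem_of_mem_supportedIn (inv_mem hd) (Or.inl hz)
    have hz'' : d⁻¹ z ∉ d ⁻¹' (B \ A) := fun h => by
      rw [Set.mem_preimage, Perm.apply_inv_self'] at h
      exact h.2 hz
    by_cases h : d⁻¹ z ∈ A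
    · exact Or.inl ⟨h, hz''⟩
    · exact Or.inr ⟨⟨hz'.resolve_left h, h⟩, hz''⟩
  have := main (d * t⁻¹) (mul_mem hd (inv_mem (supportedIn_mono Set.subset_union_right htB))) <| by
    refine (hW.image t).mono ?_
    rintro _ ⟨z, hz, rfl⟩
    refine ⟨?_, ?_⟩
    · rw [ht0 z hz.1]; exact hcA _
    · rw [Set.mem_preimage, Perm.mul_apply, Perm.inv_apply_self']
      exact hz.2
  have := P.mul_mem this (hB htB)
  rwa [inv_mul_cancel_right] at this

end Supports

section NormalSubgroups

variable {Ω : Type u}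

theorem viaEmbeddingHom_apply' {Z : Type*} (f : Z ↪ Ω) (σ : Perm Z) (z : Z) :
    Perm.viaEmbeddingHom f σ (f z) = f (σ z) :=
  Perm.viaEmbedding_apply σ f z

theorem viaEmbeddingHom_apply_of_notMem {Z : Type*} (f : Z ↪ Ω) (σ : Perm Z) {ω : Ω}
    (h : ω ∉ Set.range f) : Perm.viaEmbeddingHom f σ ω = ω :=
  Perm.viaEmbedding_apply_of_notMem σ f ω h

theorem viaEmbeddingHom_mem {Z : Type*} (f : Z ↪ Ω) (σ : Perm Z) {s : Set Ω}
    (h : ∀ z, f z ∈ s) : Perm.viaEmbeddingHom f σ ∈ supportedIn s := by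
  refine fun ω hω => viaEmbeddingHom_apply_of_notMem f σ ?_
  rintro ⟨z, rfl⟩
  exact hω (h z)

theorem exists_viaEmbeddingHom_eq {Z : Type*} (f : Z ↪ Ω) {d : Perm Ω}
    (hd : d ∈ supportedIn (Set.range f)) : ∃ σ, Perm.viaEmbeddingHom f σ = d := by
  let e := Equiv.ofInjective f f.injective
  refine ⟨e.symm.permCongr (d.subtypePerm (p := (· ∈ Set.range f)) ?_), ?_⟩
  · intro x
    refine ⟨fun h => ?_, map_mem_of_mem_supportedIn hd⟩
    have := map_mem_of_mem_supportedIn (inv_mem hd) h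
    rwa [Perm.inv_apply_self'] at this
  · ext ω
    by_cases h : ω ∈ Set.range f
    · obtain ⟨z, rfl⟩ := h
      rw [viaEmbeddingHom_apply']
      have h1 : ∀ y, f (e.symm y) = y := fun y => congrArg Subtype.val (e.apply_symm_apply y)
      simp only [permCongr_apply, symm_symm]
      rw [h1]
      rfl
    · rw [viaEmbeddingHom_apply_of_notMem f _ h, hd ω h]

/-- Conjugating a permutation carried by an embedding. -/
theorem conj_viaEmbeddingHom {Z : Type*} {f f' : Z ↪ Ω} {T : Perm Ω} (h : ∀ z, T (f z) = f' z)
    (σ : Perm Z) : T * Perm.viaEmbeddingHom f σ * T⁻¹ = Perm.viaEmbeddingHom f' σ := by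
  rw [mul_inv_eq_iff_eq_mul]
  ext ω
  simp only [Perm.mul_apply]
  by_cases hω : ω ∈ Set.range f
  · obtain ⟨z, rfl⟩ := hω
    rw [viaEmbeddingHom_apply', h, h, viaEmbeddingHom_apply']
  · rw [viaEmbeddingHom_apply_of_notMem f _ hω, viaEmbeddingHom_apply_of_notMem f']
    rintro ⟨z, hz⟩
    rw [← h] at hz
    exact hω ⟨z, T.injective hz⟩

theorem exists_image_eq {s t : Set Ω} (hs : Big s) (hs' : Big sᶜ) (ht : Big t) (ht' : Big tᶜ) :
    ∃ π : Perm Ω, π '' s = t := by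
  classical
  obtain ⟨e1⟩ := Cardinal.eq.1 (hs.mk_eq.trans ht.mk_eq.symm)
  obtain ⟨e2⟩ := Cardinal.eq.1 (hs'.mk_eq.trans ht'.mk_eq.symm)
  let π : Perm Ω := (Equiv.Set.sumCompl s).symm.trans
    ((Equiv.sumCongr e1 e2).trans (Equiv.Set.sumCompl t))
  have h : ∀ z : s, π z = e1 z := fun z => by
    simp only [π, Equiv.trans_apply, Equiv.Set.sumCompl_symm_apply]
    rfl
  refine ⟨π, Set.ext fun ω => ⟨?_, fun hω => ⟨e1.symm ⟨ω, hω⟩, Subtype.prop _, ?_⟩⟩⟩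
  · rintro ⟨z, hz, rfl⟩
    rw [h ⟨z, hz⟩]
    exact Subtype.prop _
  · rw [h, e1.apply_symm_apply]

/-- An infinite swindle: a permutation of one fibre of `ℤ × Z` is a commutator. -/
theorem exists_commutator_eq_fibre {Z : Type*} (σ : Perm Z) : ∃ D S : Perm (ℤ × Z),
    (∀ z, ⁅D, S⁆ (0, z) = (0, σ z)) ∧ ∀ i z, i ≠ 0 → ⁅D, S⁆ (i, z) = (i, z) := by
  let D : Perm (ℤ × Z) := Equiv.prodShear (Equiv.refl ℤ) fun i => if 0 ≤ i then σ else 1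
  let S : Perm (ℤ × Z) := Equiv.prodCongr (Equiv.addRight 1) (Equiv.refl Z)
  have hS : ∀ i z, S⁻¹ (i, z) = (i - 1, z) := fun i z => by
    rw [Perm.inv_eq_iff_eq]
    simp [S]
  have hD : ∀ i z, D⁻¹ (i, z) = (i, (if 0 ≤ i then σ else 1)⁻¹ z) := fun i z => by
    rw [Perm.inv_eq_iff_eq]
    simp only [D, Equiv.prodShear_apply, Equiv.refl_apply, Perm.apply_inv_self']
  have key : ∀ i z, ⁅D, S⁆ (i, z) =
      (i, (if 0 ≤ i then σ else 1) ((if 0 ≤ i - 1 then σ else 1)⁻¹ z)) := fun i z => by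
    rw [commutatorElement_def, Perm.mul_apply, Perm.mul_apply, Perm.mul_apply, hS, hD]
    simp [S, D]
  refine ⟨D, S, fun z => ?_, fun i z hi => ?_⟩
  · rw [key]
    simp
  · rw [key]
    by_cases h : 0 ≤ i
    · rw [if_pos h, if_pos (by lia), Perm.apply_inv_self']
    · rw [if_neg h, if_neg (by lia)]
      rfl

/-- A normal subgroup of the symmetric group containing an element that moves a big set off
itself is everything. -/
theorem eq_top_of_normal [Infinite Ω] {N : Subgroup (Perm Ω)} [hN : N.Normal] {w : Perm Ω}
    (hw : w ∈ N) {C : Set Ω} (hC : Big C) (hwC : ∀ ω ∈ C, w ω ∉ C) : N = ⊤ := by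
  obtain ⟨f, hf, hfC⟩ := hC.exists_injective (mk_prod_countable ℤ).le
  let F : ℤ × Ω ↪ Ω := ⟨f, hf⟩
  let fib : ℤ → Set Ω := fun i => Set.range fun ω => f (i, ω)
  have hbig : ∀ i, Big (fib i) := fun i => big_of_injective le_rfl (fun ω => f (i, ω))
    (fun a b h => congrArg Prod.snd (hf h)) fun ω => ⟨ω, rfl⟩
  have hdisj : ∀ i j, i ≠ j → fib i ⊆ (fib j)ᶜ := by
    rintro i j hij _ ⟨ω, rfl⟩ ⟨ω', h⟩
    exact hij (congrArg Prod.fst (hf h)).symm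
  have hcomm : ∀ a ∈ supportedIn C, ∀ b ∈ supportedIn C, ⁅a, b⁆ ∈ N := by
    intro a ha b hb
    have hd : Disjoint (w '' C) C := by
      rw [Set.disjoint_left]
      rintro _ ⟨ω, hω, rfl⟩
      exact hwC ω hω
    have h1 : Commute (w * a⁻¹ * w⁻¹) b :=
      commute_of_disjoint hd (conj_mem_supportedIn (inv_mem ha) w) hb
    have h2 : ⁅a, b⁆ = (a * w * a⁻¹ * w⁻¹) * (b * (a * w * a⁻¹ * w⁻¹)⁻¹ * b⁻¹) := by
      have : b * (w * a⁻¹ * w⁻¹)⁻¹ = (w * a⁻¹ * w⁻¹)⁻¹ * b := (h1.inv_left.eq).symm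
      calc ⁅a, b⁆ = a * (w * a⁻¹ * w⁻¹) * ((w * a⁻¹ * w⁻¹)⁻¹ * b) * a⁻¹ * b⁻¹ := by
            rw [commutatorElement_def]; group
        _ = _ := by rw [← this]; group
    rw [h2]
    have h3 : a * w * a⁻¹ * w⁻¹ ∈ N := N.mul_mem (hN.conj_mem w hw a) (N.inv_mem hw)
    exact N.mul_mem h3 (hN.conj_mem _ (N.inv_mem h3) b)
  have h0 : supportedIn (fib 0) ≤ N := by
    intro d hd
    obtain ⟨σ, rfl⟩ := exists_viaEmbeddingHom_eq
      (⟨fun ω => f (0, ω), fun a b h => congrArg Prod.snd (hf h)⟩ : Ω ↪ Ω) hd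
    obtain ⟨D, S, h1, h2⟩ := exists_commutator_eq_fibre σ
    have hmem : ∀ τ, Perm.viaEmbeddingHom F τ ∈ supportedIn C := fun τ =>
      viaEmbeddingHom_mem F τ hfC
    convert hcomm _ (hmem D) _ (hmem S) using 1
    rw [← map_commutatorElement]
    ext ω
    by_cases hω : ω ∈ Set.range F
    · obtain ⟨⟨i, z⟩, rfl⟩ := hω
      rw [viaEmbeddingHom_apply']
      by_cases hi : i = 0
      · subst hi
        rw [h1]
        exact viaEmbeddingHom_apply' _ _ _
      · rw [h2 i z hi]
        refine viaEmbeddingHom_apply_of_notMem _ _ ?_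
        rintro ⟨ω', h⟩
        exact hi (congrArg Prod.fst (hf h)).symm
    · rw [viaEmbeddingHom_apply_of_notMem F _ hω, viaEmbeddingHom_apply_of_notMem]
      rintro ⟨ω', h⟩
      exact hω ⟨_, h⟩
  have hcob : ∀ i, i ≠ 0 → supportedIn (fib i)ᶜ ≤ N := by
    intro i hi d hd
    obtain ⟨π, hπ⟩ := exists_image_eq ((hbig 0).mono (hdisj 0 i hi.symm))
      (by rw [compl_compl]; exact hbig i) (hbig 0) ((hbig i).mono (hdisj i 0 hi))
    have := conj_mem_supportedIn hd π
    rw [hπ] at this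
    have := hN.conj_mem _ (h0 this) π⁻¹
    convert this using 1
    group
  rw [eq_top_iff, ← supportedIn_univ]
  have hu : (Set.univ : Set Ω) = (fib 1)ᶜ ∪ (fib 2)ᶜ := by
    rw [eq_comm, Set.eq_univ_iff_forall]
    intro ω
    by_cases h : ω ∈ fib 1
    · exact Or.inr (hdisj 1 2 (by decide) h)
    · exact Or.inl h
  rw [hu]
  exact supportedIn_union_le (hcob 1 (by decide)) (hcob 2 (by decide))
    ((hbig 0).mono fun ω hω => ⟨hdisj 0 1 (by decide) hω, hdisj 0 2 (by decide) hω⟩)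

theorem exists_commutator_pow_moves [Infinite Ω] {K : ℕ} (hK : K ≠ 0) : ∃ a b : Perm Ω, ∃ C : Set Ω,
    Big C ∧ ∀ ω ∈ C, ⁅a ^ K, b ^ K⁆ ω ∉ C := by
  have hc : #((ℤ × ℤ) × Ω) = #Ω := mk_prod_countable (ℤ × ℤ)
  obtain ⟨e⟩ := Cardinal.eq.1 hc
  let a : Perm (ℤ × ℤ) := Equiv.prodCongr (Equiv.addRight 1) (Equiv.refl ℤ)
  let b : Perm (ℤ × ℤ) :=
    Equiv.prodShear (Equiv.refl ℤ) fun i => if i = 0 then Equiv.addRight 1 else 1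
  have ha : ∀ (n : ℕ) i j, (a ^ n) (i, j) = (i + n, j) := by
    intro n
    induction n with
    | zero => simp
    | succ n ih => intro i j; rw [pow_succ', Perm.mul_apply, ih]; simp [a, add_assoc]
  have hb : ∀ (n : ℕ) i j, (b ^ n) (i, j) = (i, if i = 0 then j + n else j) := by
    intro n
    induction n with
    | zero => simp
    | succ n ih =>
      intro i j
      rw [pow_succ', Perm.mul_apply, ih]
      by_cases hi : i = 0 <;> simp [b, hi, add_assoc]
  let ψ : Perm (ℤ × ℤ) →* Perm Ω :=
    { toFun := fun σ => e.permCongr (Equiv.prodCongr σ (Equiv.refl Ω))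
      map_one' := by ext; simp
      map_mul' := fun σ τ => by ext; simp [Prod.map] }
  have hψ : ∀ σ p ω, ψ σ (e (p, ω)) = e (σ p, ω) := fun σ p ω => by
    simp [ψ, Equiv.permCongr_apply]
  refine ⟨ψ a, ψ b, Set.range fun ω => e ((0, 0), ω),
    big_of_injective le_rfl _ ?_ fun ω => ⟨ω, rfl⟩, ?_⟩
  · exact fun _ _ h => congrArg Prod.snd (e.injective h)
  · rintro _ ⟨ω, rfl⟩ ⟨ω', h⟩
    rw [← map_pow, ← map_pow, ← map_commutatorElement, hψ] at h
    have h1 : ⁅a ^ K, b ^ K⁆ (0, 0) = (0, 0) := (congrArg Prod.fst (e.injective h)).symm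
    rw [commutatorElement_def, Perm.mul_apply, Perm.mul_apply, Perm.mul_apply,
      show (b ^ K)⁻¹ (0, 0) = (0, -(K : ℤ)) by rw [Perm.inv_eq_iff_eq, hb]; simp,
      show (a ^ K)⁻¹ (0, -(K : ℤ)) = (-(K : ℤ), -(K : ℤ)) by rw [Perm.inv_eq_iff_eq, ha]; simp,
      hb, ha, if_neg (by simpa using hK)] at h1
    simp [hK] at h1

theorem eq_top_of_commutator_pow_mem [Infinite Ω] {K : ℕ} (hK : K ≠ 0) {P : Subgroup (Perm Ω)}
    (h : ∀ a b : Perm Ω, ⁅a ^ K, b ^ K⁆ ∈ P) : P = ⊤ := by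
  let s : Set (Perm Ω) := {d | ∃ a b : Perm Ω, d = ⁅a ^ K, b ^ K⁆}
  obtain ⟨a, b, C, hC, hab⟩ := exists_commutator_pow_moves (Ω := Ω) hK
  have h1 : Subgroup.normalClosure s = ⊤ :=
    eq_top_of_normal (Subgroup.subset_normalClosure ⟨a, b, rfl⟩) hC hab
  rw [eq_top_iff, ← h1]
  refine (Subgroup.closure_le P).2 fun d hd => ?_
  obtain ⟨_, ⟨a, b, rfl⟩, hd⟩ := Group.mem_conjugatesOfSet_iff.1 hd
  obtain ⟨c, rfl⟩ := isConj_iff.1 hd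
  have := h (c * a * c⁻¹) (c * b * c⁻¹)
  rw [conj_pow, conj_pow] at this
  refine SetLike.mem_coe.2 ?_
  convert this using 1
  simp only [commutatorElement_def]
  group

end NormalSubgroups

section CommutatorOrders

variable {Ω : Type*}

theorem commutator_apply (p q : Perm Ω) (ω : Ω) : ⁅p, q⁆ ω = p (q (p⁻¹ (q⁻¹ ω))) := rfl

theorem inv_apply_eq_self {p : Perm Ω} {ω : Ω} (h : p ω = ω) : p⁻¹ ω = ω :=
  Perm.inv_eq_iff_eq.2 h.symm

/-- A commutator moves only points of `Z ∪ p Z ∪ q Z`, where `Z` is the common support. -/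
theorem commutator_apply_eq_self {p q : Perm Ω} {ω : Ω} (h0 : p ω = ω ∨ q ω = ω)
    (h1 : p (p⁻¹ ω) = p⁻¹ ω ∨ q (p⁻¹ ω) = p⁻¹ ω)
    (h2 : p (q⁻¹ ω) = q⁻¹ ω ∨ q (q⁻¹ ω) = q⁻¹ ω) : ⁅p, q⁆ ω = ω := by
  rw [commutator_apply]
  rw [Perm.apply_inv_self'] at h1 h2
  by_cases hq : q ω = ω
  · rw [inv_apply_eq_self hq]
    rcases h1 with h1 | h1
    · rw [← h1, hq, ← Perm.inv_eq_iff_eq.1 h1.symm]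
    · rw [h1, Perm.apply_inv_self']
  · have hp := h0.resolve_right hq
    have h3 : q⁻¹ ω ≠ ω := fun h => hq (Perm.inv_eq_iff_eq.1 h).symm
    rw [inv_apply_eq_self (h2.resolve_right fun h => h3 h.symm), Perm.apply_inv_self', hp]

theorem commutator_pow_three_eq_one {p q : Perm Ω}
    (h1 : ∀ z, p z ≠ z → q z ≠ z → q (p z) = p z)
    (h2 : ∀ z, p z ≠ z → q z ≠ z → p (q z) = q z) : ⁅p, q⁆ ^ 3 = 1 := by
  have main : ∀ z, p z ≠ z → q z ≠ z →
      ⁅p, q⁆ z = p z ∧ ⁅p, q⁆ (p z) = q z ∧ ⁅p, q⁆ (q z) = z := by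
    intro z hp hq
    have hpi : q (p⁻¹ z) = p⁻¹ z := by
      by_contra h
      have := h1 (p⁻¹ z) (by
        rw [Perm.apply_inv_self']
        exact fun h' => hp (Perm.inv_eq_iff_eq.1 h'.symm).symm) h
      rw [Perm.apply_inv_self'] at this
      exact hq this
    have hqi : p (q⁻¹ z) = q⁻¹ z := by
      by_contra h
      have := h2 (q⁻¹ z) h (by
        rw [Perm.apply_inv_self']
        exact fun h' => hq (Perm.inv_eq_iff_eq.1 h'.symm).symm)
      rw [Perm.apply_inv_self'] at this
      exact hp this
    refine ⟨?_, ?_, ?_⟩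
    · rw [commutator_apply, inv_apply_eq_self hqi, Perm.apply_inv_self']
    · rw [commutator_apply, inv_apply_eq_self (h1 z hp hq), Perm.inv_apply_self', h2 z hp hq]
    · rw [commutator_apply, Perm.inv_apply_self', hpi, Perm.apply_inv_self']
  ext ω
  change ⁅p, q⁆ (⁅p, q⁆ (⁅p, q⁆ ω)) = ω
  by_cases hz : p ω ≠ ω ∧ q ω ≠ ω
  · obtain ⟨e1, e2, e3⟩ := main ω hz.1 hz.2
    rw [e1, e2, e3]
  by_cases hz' : p (p⁻¹ ω) ≠ p⁻¹ ω ∧ q (p⁻¹ ω) ≠ p⁻¹ ω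
  · obtain ⟨e1, e2, e3⟩ := main _ hz'.1 hz'.2
    rw [Perm.apply_inv_self'] at e1 e2
    rw [e2, e3, e1]
  by_cases hz'' : p (q⁻¹ ω) ≠ q⁻¹ ω ∧ q (q⁻¹ ω) ≠ q⁻¹ ω
  · obtain ⟨e1, e2, e3⟩ := main _ hz''.1 hz''.2
    rw [Perm.apply_inv_self'] at e2 e3
    rw [e3, e1, e2]
  have h := commutator_apply_eq_self (p := p) (q := q) (ω := ω) (by tauto) (by tauto) (by tauto)
  rw [h, h, h]

/-- The commutator of two permutations overlapping in the pattern below consists of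
cycles of length `3`, `5` and `7`. -/
theorem commutator_pow_eq_one_of_pattern {p q : Perm Ω} {A A' E E' : Set Ω}
    (hsupp : ∀ z, p z ≠ z → q z ≠ z → z ∈ A ∨ z ∈ A' ∨ z ∈ E ∧ z ∈ E')
    (hpA : ∀ a ∈ A, p a ∈ E) (hpE : ∀ y ∈ E, p⁻¹ y ∈ A)
    (hqA : ∀ a ∈ A', q a ∈ E') (hqE : ∀ y ∈ E', q⁻¹ y ∈ A')
    (hEE : ∀ y ∈ E, y ∉ E' → q y = y) (hEE' : ∀ y ∈ E', y ∉ E → p y = y)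
    (hA : ∀ a ∈ A, p (q a) = q a ∧ p (q⁻¹ a) = q⁻¹ a)
    (hA' : ∀ a ∈ A', q (p a) = p a ∧ q (p⁻¹ a) = p⁻¹ a)
    (hor : (∀ a ∈ A, q (p⁻¹ a) = p⁻¹ a) ∧ (∀ a ∈ A', p (q⁻¹ a) = q⁻¹ a) ∧
        (∀ y ∈ E, y ∈ E' → q (p y) = p y ∧ p (q y) = q y) ∨
      (∀ y ∈ E, p (p y) = y) ∧ (∀ y ∈ E', q (q y) = y)) :
    ⁅p, q⁆ ^ 105 = 1 := by
  set c := ⁅p, q⁆ with hc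
  have ca : ∀ a ∈ A, c a = p a := fun a ha => by
    rw [hc, commutator_apply, inv_apply_eq_self (hA a ha).2, Perm.apply_inv_self']
  have cy : ∀ y ∈ E', c y = q⁻¹ y := fun y hy => by
    rw [hc, commutator_apply, (hA' _ (hqE y hy)).2, Perm.apply_inv_self']
  have cy' : ∀ a ∈ A, p a ∉ E' → c (p a) = q a := fun a ha h => by
    rw [hc, commutator_apply, inv_apply_eq_self (hEE _ (hpA a ha) h), Perm.inv_apply_self',
      (hA a ha).1]
  have cpa' : ∀ a ∈ A', c (p a) = p (q a) := fun a ha => by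
    rw [hc, commutator_apply, inv_apply_eq_self (hA' a ha).1, Perm.inv_apply_self']
  have cqa : ∀ a ∈ A, (p (p (p a)) = p a ∨ q (p⁻¹ a) = p⁻¹ a) → p a ∉ E' → c (q a) = a := by
    intro a ha h h'
    rw [hc, commutator_apply, Perm.inv_apply_self']
    rcases h with h | h
    · rw [show p⁻¹ a = p a from Perm.inv_eq_iff_eq.2 (p.injective h.symm), hEE _ (hpA a ha) h',
        p.injective h]
    · rw [h, Perm.apply_inv_self']
  have fix_iff : ∀ ω, (c ^ 105) (c ω) = c ω ↔ (c ^ 105) ω = ω := fun ω => by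
    rw [← Perm.mul_apply, (Commute.refl c).pow_left 105 |>.eq, Perm.mul_apply, c.injective.eq_iff]
  have pow_fix : ∀ {n m : ℕ} {ω : Ω}, (c ^ n) ω = ω → n * m = 105 → (c ^ 105) ω = ω := by
    rintro n m ω h h'
    rw [← h', pow_mul]
    clear h'
    induction m with
    | zero => rfl
    | succ m ih => rw [pow_succ, Perm.mul_apply, h, ih]
  have ca' : ∀ a ∈ A', (p (q⁻¹ a) = q⁻¹ a) → c a = p a := fun a ha h => by
    rw [hc, commutator_apply, inv_apply_eq_self h, Perm.apply_inv_self']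
  have ca'2 : ∀ a ∈ A', (∀ y ∈ E', q (q y) = y) → q a ∉ E → c a = p a := fun a ha h h' => by
    apply ca' a ha
    rw [show q⁻¹ a = q a from by
      rw [Perm.inv_eq_iff_eq]; exact q.injective (h _ (hqA a ha)).symm]
    exact hEE' _ (hqA a ha) h'
  have both3 : (∀ a ∈ A, q (p⁻¹ a) = p⁻¹ a) → (∀ a ∈ A', p (q⁻¹ a) = q⁻¹ a) →
      (∀ y ∈ E, y ∈ E' → q (p y) = p y ∧ p (q y) = q y) → ∀ a ∈ A, p a ∈ E' →
      c (q⁻¹ (p a)) = p (q⁻¹ (p a)) ∧ c (p (q⁻¹ (p a))) = p (p a) ∧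
      c (p (p a)) = q (p a) ∧ c (q (p a)) = q a ∧ c (q a) = a := by
    intro h1 h2 h3 a ha hy
    obtain ⟨h4, h5⟩ := h3 _ (hpA a ha) hy
    refine ⟨ca' _ (hqE _ hy) (h2 _ (hqE _ hy)), ?_, ?_, ?_, ?_⟩
    · rw [cpa' _ (hqE _ hy), Perm.apply_inv_self']
    · rw [hc, commutator_apply, inv_apply_eq_self h4, Perm.inv_apply_self', h5]
    · rw [hc, commutator_apply, Perm.inv_apply_self', Perm.inv_apply_self', (hA a ha).1]
    · rw [hc, commutator_apply, Perm.inv_apply_self', h1 a ha, Perm.apply_inv_self']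
  have both2 : (∀ y ∈ E, p (p y) = y) → (∀ y ∈ E', q (q y) = y) → ∀ a ∈ A, p a ∈ E' →
      c (q⁻¹ (p a)) = q a ∧ c (q a) = p (q⁻¹ (p a)) ∧ c (p (q⁻¹ (p a))) = a := by
    intro h1 h2 a ha hy
    have h3 : p (p a) = a := p.injective (h1 _ (hpA a ha))
    have h4 : q⁻¹ (p a) = q (p a) := Perm.inv_eq_iff_eq.2 (h2 _ hy).symm
    refine ⟨?_, ?_, ?_⟩
    · rw [hc, commutator_apply, h4, Perm.inv_apply_self', Perm.inv_apply_self', (hA a ha).1]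
    · rw [hc, commutator_apply, Perm.inv_apply_self',
        show p⁻¹ a = p a from Perm.inv_eq_iff_eq.2 h3.symm, h4]
    · rw [cpa' _ (hqE _ hy), Perm.apply_inv_self', h3]
  have hα : ∀ a ∈ A, (c ^ 105) a = a := by
    intro a ha
    by_cases hy : p a ∈ E'
    · rcases hor with ⟨h1, h2, h3⟩ | ⟨h1, h2⟩
      · obtain ⟨e1, e2, e3, e4, e5⟩ := both3 h1 h2 h3 a ha hy
        refine pow_fix (n := 7) (m := 15) ?_ rfl
        change c (c (c (c (c (c (c a)))))) = a
        rw [ca a ha, cy _ hy, e1, e2, e3, e4, e5]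
      · obtain ⟨e1, e2, e3⟩ := both2 h1 h2 a ha hy
        refine pow_fix (n := 5) (m := 21) ?_ rfl
        change c (c (c (c (c a)))) = a
        rw [ca a ha, cy _ hy, e1, e2, e3]
    · refine pow_fix (n := 3) (m := 35) ?_ rfl
      change c (c (c a)) = a
      rw [ca a ha, cy' a ha hy, cqa a ha ?_ hy]
      rcases hor with ⟨h1, -, -⟩ | ⟨h1, -⟩
      exacts [Or.inr (h1 a ha), Or.inl (h1 _ (hpA a ha))]
  have hE : ∀ y ∈ E, (c ^ 105) y = y := fun y hy => by
    have := (fix_iff _).2 (hα _ (hpE y hy))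
    rwa [ca _ (hpE y hy), Perm.apply_inv_self'] at this
  have hca' : ∀ a ∈ A', q a ∉ E → c a = p a := fun a ha h => by
    rcases hor with ⟨-, h1, -⟩ | ⟨-, h1⟩
    exacts [ca' a ha (h1 a ha), ca'2 a ha h1 h]
  have hβ : ∀ a ∈ A', (c ^ 105) a = a := by
    intro a ha
    by_cases hy : q a ∈ E
    · have := (fix_iff _).2 (hE _ hy)
      rwa [cy _ (hqA a ha), Perm.inv_apply_self'] at this
    · refine pow_fix (n := 3) (m := 35) ?_ rfl
      change c (c (c a)) = a
      rw [hca' a ha hy, cpa' a ha, hEE' _ (hqA a ha) hy, cy _ (hqA a ha), Perm.inv_apply_self']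
  have hE' : ∀ y ∈ E', (c ^ 105) y = y := fun y hy => by
    have := hβ _ (hqE y hy)
    rwa [← cy y hy, fix_iff] at this
  have hpA' : ∀ a ∈ A', (c ^ 105) (p a) = p a := fun a ha => by
    rw [← fix_iff, cpa' a ha]
    by_cases hy : q a ∈ E
    · have hy' := hqA a ha
      rcases hor with ⟨h1, h2, h3⟩ | ⟨h1, h2⟩
      · obtain ⟨-, -, e3, e4, e5⟩ := both3 h1 h2 h3 _ (hpE _ hy) (by rwa [Perm.apply_inv_self'])
        rw [Perm.apply_inv_self'] at e3 e4
        rw [← fix_iff, e3, ← fix_iff, e4, ← fix_iff, e5]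
        exact hα _ (hpE _ hy)
      · rw [show p (q a) = p⁻¹ (q a) from by
          rw [eq_comm, Perm.inv_eq_iff_eq]; exact (h1 _ hy).symm]
        exact hα _ (hpE _ hy)
    · rw [hEE' _ (hqA a ha) hy]
      exact hE' _ (hqA a ha)
  have hqA'' : ∀ a ∈ A, (c ^ 105) (q a) = q a := fun a ha => by
    by_cases hy : p a ∈ E'
    · rcases hor with ⟨h1, h2, h3⟩ | ⟨h1, h2⟩
      · obtain ⟨-, -, -, -, e5⟩ := both3 h1 h2 h3 a ha hy
        rw [← fix_iff, e5]
        exact hα a ha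
      · obtain ⟨e1, -, -⟩ := both2 h1 h2 a ha hy
        rw [← e1, fix_iff]
        exact hβ _ (hqE _ hy)
    · rw [← cy' a ha hy, fix_iff]
      exact hE _ (hpA a ha)
  have hZ : ∀ y ∈ E, y ∈ E' → (c ^ 105) (p y) = p y ∧ (c ^ 105) (q y) = q y := by
    intro y hy hy'
    rcases hor with ⟨h1, h2, h3⟩ | ⟨h1, h2⟩
    · obtain ⟨-, -, e3, e4, e5⟩ := both3 h1 h2 h3 _ (hpE _ hy) (by rwa [Perm.apply_inv_self'])
      rw [Perm.apply_inv_self'] at e3 e4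
      have h6 : (c ^ 105) (q y) = q y := by
        rw [← fix_iff, e4]
        exact hqA'' _ (hpE _ hy)
      refine ⟨?_, h6⟩
      rwa [← fix_iff, e3]
    · rw [show p y = p⁻¹ y from by rw [eq_comm, Perm.inv_eq_iff_eq]; exact (h1 _ hy).symm,
        show q y = q⁻¹ y from by rw [eq_comm, Perm.inv_eq_iff_eq]; exact (h2 _ hy').symm]
      exact ⟨hα _ (hpE _ hy), hβ _ (hqE _ hy')⟩
  ext ω
  change (c ^ 105) ω = ω
  by_cases h : c ω = ω
  · exact pow_fix (n := 1) (m := 105) h rfl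
  by_cases hz : p ω ≠ ω ∧ q ω ≠ ω
  · rcases hsupp ω hz.1 hz.2 with h | h | h
    exacts [hα _ h, hβ _ h, hE _ h.1]
  by_cases hz' : p (p⁻¹ ω) ≠ p⁻¹ ω ∧ q (p⁻¹ ω) ≠ p⁻¹ ω
  · have : (c ^ 105) (p (p⁻¹ ω)) = p (p⁻¹ ω) := by
      rcases hsupp _ hz'.1 hz'.2 with h | h | h
      exacts [hE _ (hpA _ h), hpA' _ h, (hZ _ h.1 h.2).1]
    rwa [Perm.apply_inv_self'] at this
  by_cases hz'' : p (q⁻¹ ω) ≠ q⁻¹ ω ∧ q (q⁻¹ ω) ≠ q⁻¹ ω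
  · have : (c ^ 105) (q (q⁻¹ ω)) = q (q⁻¹ ω) := by
      rcases hsupp _ hz''.1 hz''.2 with h | h | h
      exacts [hqA'' _ h, hE' _ (hqA _ h), (hZ _ h.1 h.2).2]
    rwa [Perm.apply_inv_self'] at this
  exact (h (commutator_apply_eq_self (by tauto) (by tauto) (by tauto))).elim

end CommutatorOrders

section Reduction

/-- A reduction of the embedding theorem to finding a group `H` and an element `k` with
suitable normal closures. -/
theorem exists_simple_of_normalClosure {G H : Type u} [Group G] [Group H] (φ : G →* H) {k : H}
    (x : ℕ → H) (h1 : ∀ g, g ≠ 1 → k ∈ Subgroup.normalClosure {φ g})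
    (h2 : ∀ g, φ g ∈ Subgroup.normalClosure {k}) (hk : k ≠ 1)
    (h3 : ∀ n, n = 0 ∨ 2 ≤ n → Subgroup.closure (Set.range φ ∪ {x n}) = ⊤)
    (h4 : ∀ n, n = 0 ∨ 2 ≤ n → x n ^ n = 1)
    (h5 : ∀ n, n = 0 ∨ 2 ≤ n → ∀ m, ¬ n ∣ m → k ∈ Subgroup.normalClosure {x n ^ m}) :
    ∃ (S : Type u) (_ : Group S),
      IsSimpleGroup S ∧
      ∃ φ : G →* S, Function.Injective φ ∧
        ∀ p : ℕ, (p = 0 ∨ 2 ≤ p) →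
          ∃ x : S, orderOf x = p ∧ Subgroup.closure (Set.range φ ∪ {x}) = ⊤ := by
  obtain ⟨N, -, hN⟩ := zorn_le_nonempty₀ {N : Subgroup H | N.Normal ∧ k ∉ N} (by
    intro c hc hchain y hy
    refine ⟨sSup c, ⟨?_, ?_⟩, fun z hz => le_sSup hz⟩
    · refine ⟨fun n hn g => ?_⟩
      rw [Subgroup.mem_sSup_of_directedOn ⟨y, hy⟩ hchain.directedOn] at hn ⊢
      obtain ⟨M, hM, hnM⟩ := hn
      exact ⟨M, hM, (hc hM).1.conj_mem n hnM g⟩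
    · intro hn
      rw [Subgroup.mem_sSup_of_directedOn ⟨y, hy⟩ hchain.directedOn] at hn
      obtain ⟨M, hM, hnM⟩ := hn
      exact (hc hM).2 hnM) ⊥ ⟨inferInstance, hk⟩
  obtain ⟨⟨hNn, hkN⟩, hmax⟩ := hN
  have nc_le : ∀ {a : H} {M : Subgroup H}, M.Normal → a ∈ M → Subgroup.normalClosure {a} ≤ M :=
    fun _ ha => Subgroup.normalClosure_le_normal (Set.singleton_subset_iff.2 ha)
  have htop : ∀ M : Subgroup H, M.Normal → k ∈ M → M = ⊤ := by
    intro M hM hkM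
    have hφ : ∀ g, φ g ∈ M := fun g => nc_le hM hkM (h2 g)
    have hcl : ∀ n, n = 0 ∨ 2 ≤ n →
        Subgroup.map (QuotientGroup.mk' M) (Subgroup.closure {x n}) = ⊤ := by
      intro n hn
      have := congrArg (Subgroup.map (QuotientGroup.mk' M)) (h3 n hn)
      rw [Subgroup.closure_union, Subgroup.map_sup, Subgroup.map_top_of_surjective _
        (QuotientGroup.mk'_surjective M)] at this
      rw [← this, eq_comm, sup_eq_right, Subgroup.map_le_iff_le_comap, Subgroup.closure_le]
      rintro _ ⟨g, rfl⟩
      refine (Subgroup.mem_comap).2 ?_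
      rw [show QuotientGroup.mk' M (φ g) = 1 from (QuotientGroup.eq_one_iff _).2 (hφ g)]
      exact one_mem _
    have hz : ∀ n, n = 0 ∨ 2 ≤ n → ∀ y : H ⧸ M, y ^ n = 1 := by
      intro n hn y
      have hy : y ∈ (⊤ : Subgroup (H ⧸ M)) := trivial
      rw [← hcl n hn, ← Subgroup.zpowers_eq_closure] at hy
      obtain ⟨_, ⟨i, rfl⟩, rfl⟩ := hy
      rw [← map_pow]
      dsimp only
      rw [← zpow_natCast, ← zpow_mul, mul_comm, zpow_mul, zpow_natCast, h4 n hn, one_zpow, map_one]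
    rw [eq_top_iff]
    intro y _
    rw [← QuotientGroup.eq_one_iff]
    have e2 := hz 2 (Or.inr le_rfl) (y : H ⧸ M)
    have e3 := hz 3 (Or.inr (by lia)) (y : H ⧸ M)
    rwa [pow_succ, e2, one_mul] at e3
  have hker : ∀ a : H, (k ∈ Subgroup.normalClosure {a}) → (a : H ⧸ N) ≠ 1 := fun a ha h =>
    hkN (nc_le hNn ((QuotientGroup.eq_one_iff a).1 h) ha)
  refine ⟨H ⧸ N, inferInstance, ?_, (QuotientGroup.mk' N).comp φ, ?_,
    fun p hp => ⟨(x p : H ⧸ N), ?_, ?_⟩⟩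
  · have : Nontrivial (H ⧸ N) := ⟨(k : H ⧸ N), 1, fun h => hkN ((QuotientGroup.eq_one_iff k).1 h)⟩
    refine ⟨fun M hM => ?_⟩
    by_cases hkM : k ∈ M.comap (QuotientGroup.mk' N)
    · right
      have := htop _ (hM.comap _) hkM
      rw [← Subgroup.map_comap_eq_self_of_surjective (QuotientGroup.mk'_surjective N) M, this,
        Subgroup.map_top_of_surjective _ (QuotientGroup.mk'_surjective N)]
    · left
      have hle : M.comap (QuotientGroup.mk' N) ≤ N :=
        hmax ⟨hM.comap _, hkM⟩ fun a ha => by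
          rw [Subgroup.mem_comap, show QuotientGroup.mk' N a = 1 from
            (QuotientGroup.eq_one_iff a).2 ha]
          exact one_mem _
      rw [eq_bot_iff]
      intro y hy
      obtain ⟨a, rfl⟩ := QuotientGroup.mk'_surjective N y
      exact (QuotientGroup.eq_one_iff a).2 (hle hy)
  · rw [injective_iff_map_eq_one]
    intro g hg
    by_contra hne
    exact hker _ (h1 g hne) hg
  · refine Nat.dvd_antisymm (orderOf_dvd_of_pow_eq_one ?_) ?_
    · rw [← QuotientGroup.mk_pow, h4 p hp, QuotientGroup.mk_one]
    · by_contra hne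
      refine hker _ (h5 p hp _ hne) ?_
      rw [QuotientGroup.mk_pow, pow_orderOf_eq_one]
  · have := congrArg (Subgroup.map (QuotientGroup.mk' N)) (h3 p hp)
    rw [Subgroup.map_top_of_surjective _ (QuotientGroup.mk'_surjective N), MonoidHom.map_closure,
      Set.image_union, Set.image_singleton, ← Set.range_comp] at this
    exact this

end Reduction

section Space

/-- Labels of the blocks in a row of the permuted space. -/
inductive Label : Type
  | strip (i j : ℕ)
  | priv (j : ℕ)
  | line (i : ℤ)
  | anchor
  | spare
  | test
  | off (i : ℕ)

instance : Countable Label :=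
  Function.Injective.countable (f := fun
    | .strip i j => ((0, i, j) : ℕ × ℤ × ℤ)
    | .priv j => (1, j, 0)
    | .line i => (2, i, 0)
    | .anchor => (3, 0, 0)
    | .spare => (4, 0, 0)
    | .test => (5, 0, 0)
    | .off i => (6, i, 0)) fun a b h => by cases a <;> cases b <;> simp_all

/-- The labels on which the group acts. -/
def Label.active : Label → Bool
  | .off _ => false
  | _ => true

/-- The permuted space: rows, labels, and a coordinate inside each block. -/
abbrev Space (R Y : Type u) : Type u := R × Label × Y

/-- Coordinates on the part of the space moved by the element under construction. -/
inductive Chart (Y : Type u) : Type u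
  | l0 (i : ℤ) (y : Y)
  | l1 (i : ℤ) (y : Y)
  | l2 (i : ℤ) (y : Y)
  | z (y : Y)
  | u (y : Y)

variable {G R Y : Type u} [Group G] [MulAction G R]

/-- The group acts on rows, on active labels only. -/
def rho (R Y : Type u) [MulAction G R] : G →* Perm (Space R Y) where
  toFun g :=
    { toFun := fun ω => (if ω.2.1.active then g • ω.1 else ω.1, ω.2)
      invFun := fun ω => (if ω.2.1.active then g⁻¹ • ω.1 else ω.1, ω.2)
      left_inv := fun ω => by by_cases h : ω.2.1.active <;> simp [h]
      right_inv := fun ω => by by_cases h : ω.2.1.active <;> simp [h] }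
  map_one' := by ext ω : 1; simp
  map_mul' g g' := by ext ω : 1; by_cases h : ω.2.1.active <;> simp [h, mul_smul]

theorem rho_apply (g : G) (ω : Space R Y) :
    rho R Y g ω = (if ω.2.1.active then g • ω.1 else ω.1, ω.2) := rfl

variable (G R) in
/-- A finite group of rows, simply transitively permuted by elements of `G`, with some chosen
elements. -/
structure RowSystem where
  Q : Type u
  [group : Group Q]
  [finite : Finite Q]
  row : Q → R
  row_injective : Function.Injective row
  lift : Q → G
  lift_one : lift 1 = 1
  lift_smul_row : ∀ t t', lift t • row t' = row (t * t')
  free : R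
  smul_free_ne : ∀ g : G, g ≠ 1 → g • free ≠ free
  g : Q
  h : Q
  a : Q
  b : Q
  g_ne : g ≠ 1
  h_ne : h ≠ 1
  h_ne_inv : h ≠ g⁻¹
  a_ne : a ≠ 1
  b_ne : b ≠ 1
  a_ne_b : a ≠ b
  cases : (g ^ 3 = 1 ∧ h = g) ∨ (h ≠ g ∧ g * h ≠ g⁻¹)

attribute [instance] RowSystem.group RowSystem.finite

namespace RowSystem

variable (D : RowSystem G R)

/-- The permutation by which an element of the group of rows acts. -/
def act (Y : Type u) (t : D.Q) : Perm (Space R Y) := rho R Y (D.lift t)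

theorem act_one : D.act Y 1 = 1 := by rw [act, lift_one, map_one]

theorem act_row (t t' : D.Q) {l : Label} (hl : l.active) (y : Y) :
    D.act Y t (D.row t', l, y) = (D.row (t * t'), l, y) := by
  simp [act, rho_apply, hl, lift_smul_row]

theorem act_inv_row (t t' : D.Q) {l : Label} (hl : l.active) (y : Y) :
    (D.act Y t)⁻¹ (D.row t', l, y) = (D.row (t⁻¹ * t'), l, y) := by
  rw [Perm.inv_eq_iff_eq, act_row _ _ _ hl, mul_inv_cancel_left]

theorem act_off (t : D.Q) (r : R) (i : ℕ) (y : Y) :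
    D.act Y t (r, .off i, y) = (r, .off i, y) := by
  simp [act, rho_apply, Label.active]

/-- The labels used by the strips and the private blocks. -/
def coreLabel (s l : ℕ) : Set Label :=
  {x | (∃ i j, i < s ∧ j < s ∧ x = .strip i j) ∨ ∃ j, 2 ≤ j ∧ j < l ∧ x = .priv j}

theorem active_of_mem_coreLabel {s l : ℕ} {x : Label} (h : x ∈ coreLabel s l) : x.active := by
  rcases h with ⟨i, j, -, -, rfl⟩ | ⟨j, -, -, rfl⟩ <;> rfl

variable (Y) in
/-- The blocks of the rows in the row system carrying a strip or a private label. -/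
def core (s l : ℕ) : Set (Space R Y) := {ω | (∃ t, ω.1 = D.row t) ∧ ω.2.1 ∈ coreLabel s l}

theorem act_mem_core {s l : ℕ} (t : D.Q) (ω : Space R Y) :
    D.act Y t ω ∈ D.core Y s l ↔ ω ∈ D.core Y s l := by
  have key : ∀ ω, ω ∈ D.core Y s l → D.act Y t ω ∈ D.core Y s l ∧
      (D.act Y t)⁻¹ ω ∈ D.core Y s l := by
    rintro ⟨r, x, y⟩ ⟨⟨t', h : r = _⟩, hx : x ∈ _⟩
    subst h
    rw [act_row _ _ _ (active_of_mem_coreLabel hx), act_inv_row _ _ _ (active_of_mem_coreLabel hx)]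
    exact ⟨⟨⟨_, rfl⟩, hx⟩, ⟨_, rfl⟩, hx⟩
  refine ⟨fun h => ?_, fun h => (key ω h).1⟩
  have := (key _ h).2
  rwa [Perm.inv_apply_self'] at this

variable (Y) in
/-- The part of the complement of the core outside the anchor block. -/
def outer (s l : ℕ) : Set (Space R Y) :=
  {ω | ω ∉ D.core Y s l ∧ ¬ (ω.1 = D.row 1 ∧ ω.2.1 = .anchor)}

variable (Y) in
/-- The part of `outer` away from three rows of lines and the spare block. -/
def rest (s l : ℕ) : Set (Space R Y) :=
  {ω | ω ∈ D.outer Y s l ∧ ¬ (ω.1 = D.row 1 ∧ ω.2.1 = .spare) ∧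
    ∀ i, ω.2.1 = .line i → ω.1 ≠ D.row 1 ∧ ω.1 ≠ D.row D.a ∧ ω.1 ≠ D.row D.b}

end RowSystem

variable (Y) in
/-- The parameters of one of the elements under construction. -/
structure Frame (D : RowSystem G R) where
  s : ℕ
  l : ℕ
  two_le_s : 2 ≤ s
  two_le_l : 2 ≤ l
  twist : Perm Y
  twist_eq : l = 2 → twist = 1
  emb : Y ↪ Space R Y
  range_emb : Set.range emb = D.rest Y s l

namespace Frame

variable {D : RowSystem G R} (F : Frame Y D)

instance : NeZero F.s := ⟨by have := F.two_le_s; lia⟩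
instance : NeZero F.l := ⟨by have := F.two_le_l; lia⟩
instance : Fact (1 < F.s) := ⟨F.two_le_s⟩
instance : Fact (1 < F.l) := ⟨F.two_le_l⟩

/-- The part of the space described by the chart. -/
def chartFun : Chart Y → Space R Y
  | .l0 i y => (D.row 1, .line i, y)
  | .l1 i y => (D.row D.a, .line i, y)
  | .l2 i y => (D.row D.b, .line i, y)
  | .z y => (D.row 1, .spare, y)
  | .u y => F.emb y

theorem emb_mem (y : Y) : F.emb y ∈ D.rest Y F.s F.l := F.range_emb ▸ ⟨y, rfl⟩

theorem chartFun_injective : Function.Injective F.chartFun := by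
  have h1 : D.row D.a ≠ D.row 1 := fun h => D.a_ne (D.row_injective h)
  have h2 : D.row D.b ≠ D.row 1 := fun h => D.b_ne (D.row_injective h)
  have h3 : D.row D.a ≠ D.row D.b := fun h => D.a_ne_b (D.row_injective h)
  have key : ∀ y c, c ∈ Set.range (fun y => Chart.u y) ∨ F.emb y ≠ F.chartFun c := by
    rintro y (⟨i, y'⟩ | ⟨i, y'⟩ | ⟨i, y'⟩ | y' | y')
    · exact Or.inr fun h => ((h ▸ F.emb_mem y : F.chartFun _ ∈ D.rest Y F.s F.l).2.2 _ rfl).1 rfl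
    · exact Or.inr fun h => ((h ▸ F.emb_mem y : F.chartFun _ ∈ D.rest Y F.s F.l).2.2 _ rfl).2.1 rfl
    · exact Or.inr fun h => ((h ▸ F.emb_mem y : F.chartFun _ ∈ D.rest Y F.s F.l).2.2 _ rfl).2.2 rfl
    · exact Or.inr fun h => (h ▸ F.emb_mem y : F.chartFun _ ∈ D.rest Y F.s F.l).2.1 ⟨rfl, rfl⟩
    · exact Or.inl ⟨_, rfl⟩
  rintro c c' h
  rcases c with ⟨i, y⟩ | ⟨i, y⟩ | ⟨i, y⟩ | y | y
  on_goal 5 =>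
    rcases key y c' with ⟨y', rfl⟩ | h'
    · exact congrArg _ (F.emb.injective h)
    · exact absurd h h'
  all_goals
    rcases c' with ⟨i', y'⟩ | ⟨i', y'⟩ | ⟨i', y'⟩ | y' | y'
    on_goal 5 =>
      exact absurd h.symm ((key y' _).resolve_left (by simp))
    all_goals simp [chartFun, h1, h2, h3, h1.symm, h2.symm, h3.symm] at h ⊢
    all_goals exact h

/-- The part of the space moved by the element under construction, with its coordinates. -/
def chart : Chart Y ↪ Space R Y := ⟨F.chartFun, F.chartFun_injective⟩

theorem notMem_core {r : R} {x : Label} {y : Y} (h : x ∉ RowSystem.coreLabel F.s F.l) :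
    (r, x, y) ∉ D.core Y F.s F.l := fun h' => h h'.2

theorem range_chart : Set.range F.chart = D.outer Y F.s F.l := by
  ext ω
  constructor
  · rintro ⟨⟨i, y⟩ | ⟨i, y⟩ | ⟨i, y⟩ | y | y, rfl⟩
    iterate 4 exact ⟨F.notMem_core (by simp [RowSystem.coreLabel]), by simp [chart, chartFun]⟩
    exact (F.emb_mem y).1
  · intro h
    by_cases hr : ω ∈ D.rest Y F.s F.l
    · rw [← F.range_emb] at hr
      obtain ⟨y, rfl⟩ := hr
      exact ⟨.u y, rfl⟩
    · obtain ⟨r, x, y⟩ := ω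
      have hr' : ¬ (¬ (r = D.row 1 ∧ x = .spare) ∧
        ∀ i, x = .line i → r ≠ D.row 1 ∧ r ≠ D.row D.a ∧ r ≠ D.row D.b) := fun h' => hr ⟨h, h'⟩
      by_cases h1 : r = D.row 1 ∧ x = .spare
      · obtain ⟨rfl, rfl⟩ := h1
        exact ⟨.z y, rfl⟩
      · by_contra hn
        refine hr' ⟨h1, ?_⟩
        rintro i rfl
        refine ⟨?_, ?_, ?_⟩ <;> rintro rfl
        exacts [hn ⟨.l0 i y, rfl⟩, hn ⟨.l1 i y, rfl⟩, hn ⟨.l2 i y, rfl⟩]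

/-- The square of strip blocks in a row. -/
def strip (t : D.Q) : (ZMod F.s × ZMod F.s) × Y ↪ Space R Y where
  toFun p := (D.row t, .strip p.1.1.val p.1.2.val, p.2)
  inj' := by
    rintro ⟨⟨i, j⟩, y⟩ ⟨⟨i', j'⟩, y'⟩ h
    simp only [Prod.mk.injEq, Label.strip.injEq] at h
    rw [ZMod.val_injective _ h.2.1.1, ZMod.val_injective _ h.2.1.2, h.2.2]

/-- The blocks cyclically permuted by the last factor of the element under construction. -/
def slot (θ : Y ≃ Chart Y) : ZMod F.l × Y ↪ Space R Y where
  toFun p := if p.1 = 0 then (D.row D.h, .strip 1 1, p.2) else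
    if p.1 = 1 then F.chart (θ p.2) else (D.row 1, .priv p.1.val, p.2)
  inj' := by
    have hc : ∀ y, F.chart y ∉ D.core Y F.s F.l := fun y =>
      (F.range_chart ▸ ⟨y, rfl⟩ : F.chart y ∈ D.outer Y F.s F.l).1
    have h11 : ∀ t y, (D.row t, Label.strip 1 1, y) ∈ D.core Y F.s F.l := fun t y =>
      ⟨⟨t, rfl⟩, Or.inl ⟨1, 1, F.two_le_s, F.two_le_s, rfl⟩⟩
    have hpr : ∀ j : ZMod F.l, j ≠ 0 → j ≠ 1 → ∀ t y,
        (D.row t, Label.priv j.val, y) ∈ D.core Y F.s F.l := by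
      intro j h0 h1 t y
      refine ⟨⟨t, rfl⟩, Or.inr ⟨j.val, ?_, j.val_lt, rfl⟩⟩
      have h2 : j.val ≠ 0 := fun h => h0 ((ZMod.val_eq_zero j).1 h)
      have h3 : j.val ≠ 1 := fun h => h1 (by
        rw [← ZMod.natCast_zmod_val j, h, Nat.cast_one])
      lia
    rintro ⟨j, y⟩ ⟨j', y'⟩ h
    dsimp only at h
    split_ifs at h with h1 h2 h3 h4 h5 h6 h7 h8
    · simp only [Prod.mk.injEq, true_and] at h
      rw [h1, h2, h]
    · exact (hc _ (h ▸ h11 _ _)).elim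
    · simp at h
    · exact (hc _ (h ▸ h11 _ _)).elim
    · rw [h4, h6, θ.injective (F.chart.injective h)]
    · exact (hc _ (h ▸ hpr _ ‹_› ‹_› _ _)).elim
    · simp at h
    · exact (hc _ (h ▸ hpr _ ‹_› ‹_› _ _)).elim
    · simp only [Prod.mk.injEq, Label.priv.injEq, true_and] at h
      rw [ZMod.val_injective _ h.1, h.2]

end Frame

end Space

section Algebra

theorem commutator_mul_mul_of_commute {H : Type*} [Group H] {a b p q : H} (hap : Commute a p)
    (haq : Commute a q) (hbp : Commute b p) (hbq : Commute b q) :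
    ⁅a * p, b * q⁆ = ⁅a, b⁆ * ⁅p, q⁆ := by
  have h1 : p * b = b * p := hbp.eq.symm
  have h2 : p * q * p⁻¹ * a⁻¹ = a⁻¹ * (p * q * p⁻¹) :=
    ((hap.mul_right haq).mul_right hap.inv_right).inv_left.eq.symm
  have h3 : p * q * p⁻¹ * q⁻¹ * b⁻¹ = b⁻¹ * (p * q * p⁻¹ * q⁻¹) :=
    (((hbp.mul_right hbq).mul_right hbp.inv_right).mul_right hbq.inv_right).inv_left.eq.symm
  calc ⁅a * p, b * q⁆ = a * (p * b) * q * p⁻¹ * a⁻¹ * q⁻¹ * b⁻¹ := by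
        simp only [commutatorElement_def]; group
    _ = a * b * (p * q * p⁻¹ * a⁻¹) * q⁻¹ * b⁻¹ := by rw [h1]; group
    _ = a * b * a⁻¹ * (p * q * p⁻¹ * q⁻¹ * b⁻¹) := by rw [h2]; group
    _ = ⁅a, b⁆ * ⁅p, q⁆ := by rw [h3]; simp only [commutatorElement_def]; group

theorem commute_commutator {H : Type*} [Group H] {a p q : H} (hp : Commute a p)
    (hq : Commute a q) : Commute a ⁅p, q⁆ := by
  rw [commutatorElement_def]
  exact ((hp.mul_right hq).mul_right hp.inv_right).mul_right hq.inv_right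

theorem commutator_commutator_commute {H : Type*} [Group H] {a b p q : H} (hap : Commute a p)
    (haq : Commute a q) (hbp : Commute b p) (hbq : Commute b q) : Commute ⁅a, b⁆ ⁅p, q⁆ :=
  (commute_commutator (commute_commutator hap haq).symm
    (commute_commutator hbp hbq).symm).symm

theorem conj_commutator {H : Type*} [Group H] (a b c : H) :
    c * ⁅a, b⁆ * c⁻¹ = ⁅c * a * c⁻¹, c * b * c⁻¹⁆ := by
  simp only [commutatorElement_def]; group

theorem commutator_mul_left_of_commute {H : Type*} [Group H] {d r x : H} (h : Commute r x) :
    ⁅d * r, x⁆ = ⁅d, x⁆ := by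
  have h1 : r * x * r⁻¹ = x := by rw [h.eq, mul_inv_cancel_right]
  calc ⁅d * r, x⁆ = d * (r * x * r⁻¹) * d⁻¹ * x⁻¹ := by simp only [commutatorElement_def]; group
    _ = ⁅d, x⁆ := by rw [h1]; simp only [commutatorElement_def]

theorem commutator_mul_right_of_commute {H : Type*} [Group H] {d y e : H} (hd : Commute d y)
    (he : Commute e y) : ⁅d, y * e⁆ = ⁅d, e⁆ := by
  have h1 : ⁅d, y * e⁆ = y * ⁅d, e⁆ * y⁻¹ := by
    calc ⁅d, y * e⁆ = (d * y) * e * d⁻¹ * e⁻¹ * y⁻¹ := by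
          simp only [commutatorElement_def]; group
      _ = _ := by rw [hd.eq]; simp only [commutatorElement_def]; group
  rw [h1, (commute_commutator hd.symm he.symm).eq, mul_inv_cancel_right]

end Algebra

section Fibre

variable {C Y : Type*}

/-- A family of permutations, acting fibrewise. -/
def fibreHom : (C → Perm Y) →* Perm (C × Y) where
  toFun f := Equiv.prodShear (Equiv.refl C) f
  map_one' := rfl
  map_mul' _ _ := rfl

/-- A permutation of the base, acting on a product. -/
def baseHom : Perm C →* Perm (C × Y) where
  toFun π := Equiv.prodCongr π (Equiv.refl Y)
  map_one' := rfl
  map_mul' _ _ := rfl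

theorem fibreHom_apply (f : C → Perm Y) (c : C) (y : Y) : fibreHom f (c, y) = (c, f c y) := rfl

theorem baseHom_apply (π : Perm C) (c : C) (y : Y) : baseHom π (c, y) = (π c, y) := rfl

theorem conj_fibreHom (π : Perm C) (f : C → Perm Y) :
    baseHom π * fibreHom f * (baseHom π)⁻¹ = fibreHom fun c => f (π⁻¹ c) := by
  rw [mul_inv_eq_iff_eq_mul]
  ext ⟨c, y⟩ : 1
  simp only [Perm.mul_apply, fibreHom_apply, baseHom_apply, Perm.inv_apply_self']

theorem conj_fibreHom_mulSingle [DecidableEq C] (π : Perm C) (c : C) (σ : Perm Y) :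
    baseHom π * fibreHom (Pi.mulSingle c σ) * (baseHom π)⁻¹ = fibreHom (Pi.mulSingle (π c) σ) := by
  rw [conj_fibreHom]
  congr 1
  ext1 c'
  by_cases h : c' = π c
  · subst h
    rw [Perm.inv_apply_self', Pi.mulSingle_eq_same, Pi.mulSingle_eq_same]
  · rw [Pi.mulSingle_eq_of_ne h, Pi.mulSingle_eq_of_ne fun h' => h (Perm.inv_eq_iff_eq.1 h')]

theorem fibreHom_eq_mul [DecidableEq C] (f : C → Perm Y) (c : C) :
    fibreHom f = fibreHom (Pi.mulSingle c (f c)) * fibreHom (Function.update f c 1) := by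
  rw [← map_mul]
  congr 1
  ext1 c'
  by_cases h : c' = c
  · subst h; simp
  · simp [h]

theorem viaEmbeddingHom_fibreHom_mulSingle [DecidableEq C] {Ω : Type*} (f : C × Y ↪ Ω)
    (f' : Y ↪ Ω) {c : C} (h : ∀ y, f (c, y) = f' y) (σ : Perm Y) :
    Perm.viaEmbeddingHom f (fibreHom (Pi.mulSingle c σ)) = Perm.viaEmbeddingHom f' σ := by
  ext ω
  by_cases h1 : ω ∈ Set.range f
  · obtain ⟨⟨c', y⟩, rfl⟩ := h1
    rw [viaEmbeddingHom_apply', fibreHom_apply]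
    by_cases hc : c' = c
    · subst hc
      rw [Pi.mulSingle_eq_same, h, h, viaEmbeddingHom_apply']
    · rw [Pi.mulSingle_eq_of_ne hc, Perm.one_apply, viaEmbeddingHom_apply_of_notMem]
      rintro ⟨y', h'⟩
      rw [← h] at h'
      exact hc (congrArg Prod.fst (f.injective h')).symm
  · rw [viaEmbeddingHom_apply_of_notMem _ _ h1, viaEmbeddingHom_apply_of_notMem]
    rintro ⟨y, rfl⟩
    exact h1 ⟨_, h y⟩

end Fibre

section Machine

variable {G R Y : Type u} [Group G] [MulAction G R]

/-- A block of the permuted space. -/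
def block (r : R) (x : Label) : Y ↪ Space R Y := ⟨fun y => (r, x, y), fun a b h => by simpa using h⟩

theorem block_apply (r : R) (x : Label) (y : Y) : block r x y = (r, x, y) := rfl

namespace Frame

variable {D : RowSystem G R} (F : Frame Y D) (θ : Y ≃ Chart Y) (η : Perm Y)

/-- Permutations of the square of strip blocks in a row. -/
noncomputable def stripHom (t : D.Q) : Perm ((ZMod F.s × ZMod F.s) × Y) →* Perm (Space R Y) :=
  Perm.viaEmbeddingHom (F.strip t)

/-- The horizontal shift of the square of strips. -/
def shiftFst : Perm ((ZMod F.s × ZMod F.s) × Y) := baseHom (Equiv.addRight (1, 0))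

/-- The vertical shift of the square of strips. -/
def shiftSnd : Perm ((ZMod F.s × ZMod F.s) × Y) := baseHom (Equiv.addRight (0, 1))

/-- The permutation of the corner of the square of strips. -/
def corner : Perm ((ZMod F.s × ZMod F.s) × Y) := fibreHom (Pi.mulSingle (0, 0) η)

/-- The rotation of the slots. -/
def rot : Perm (ZMod F.l × Y) :=
  baseHom (Equiv.addRight 1) * fibreHom (Pi.mulSingle (-1) F.twist)

/-- The factor of the element under construction that rotates the slots. -/
noncomputable def rotor : Perm (Space R Y) := Perm.viaEmbeddingHom (F.slot θ) F.rot

/-- The untwisted form of the element under construction. -/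
noncomputable def plain : Perm (Space R Y) :=
  F.stripHom 1 F.shiftFst * F.stripHom D.g⁻¹ F.shiftSnd * F.rotor θ

/-- The element under construction. -/
noncomputable def elt : Perm (Space R Y) :=
  F.stripHom 1 ((F.corner η)⁻¹ * F.shiftFst * F.corner η) * F.stripHom D.g⁻¹ F.shiftSnd * F.rotor θ

theorem strip_range_subset_core (t : D.Q) (p) :
    F.strip t p ∈ D.core Y F.s F.l :=
  ⟨⟨t, rfl⟩, Or.inl ⟨_, _, ZMod.val_lt _, ZMod.val_lt _, rfl⟩⟩

theorem act_strip (t t' : D.Q) (p) : D.act Y t (F.strip t' p) = F.strip (t * t') p :=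
  D.act_row t t' rfl _

theorem conj_stripHom (t t' : D.Q) (σ) :
    D.act Y t * F.stripHom t' σ * (D.act Y t)⁻¹ = F.stripHom (t * t') σ :=
  conj_viaEmbeddingHom (F.act_strip t t') σ

theorem commute_stripHom {t t' : D.Q} (h : t ≠ t') (σ τ) :
    Commute (F.stripHom t σ) (F.stripHom t' τ) := by
  refine commute_of_disjoint (s := Set.range (F.strip t)) (t := Set.range (F.strip t')) ?_
    (viaEmbeddingHom_mem _ _ fun z => ⟨z, rfl⟩) (viaEmbeddingHom_mem _ _ fun z => ⟨z, rfl⟩)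
  rw [Set.disjoint_left]
  rintro _ ⟨p, rfl⟩ ⟨q, hq⟩
  exact h (D.row_injective (congrArg Prod.fst hq).symm)

/-- A set containing all points moved by a translate of the rotor. -/
def rotorSet (t : D.Q) : Set (Space R Y) :=
  {ω | (ω.1 = D.row (t * D.h) ∧ ω.2.1 = .strip 1 1) ∨ (ω.1 = D.row t ∧ ∃ j, ω.2.1 = .priv j) ∨
    ω ∉ D.core Y F.s F.l}

theorem strip_one_mem_core (t : D.Q) (y : Y) : (D.row t, .strip 1 1, y) ∈ D.core Y F.s F.l :=
  ⟨⟨t, rfl⟩, Or.inl ⟨1, 1, F.two_le_s, F.two_le_s, rfl⟩⟩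

theorem chart_notMem_core (c : Chart Y) : F.chart c ∉ D.core Y F.s F.l :=
  (F.range_chart ▸ ⟨c, rfl⟩ : F.chart c ∈ D.outer Y F.s F.l).1

theorem slot_zero (y : Y) : F.slot θ (0, y) = (D.row D.h, .strip 1 1, y) :=
  if_pos rfl

theorem slot_one (y : Y) : F.slot θ (1, y) = F.chart (θ y) :=
  (if_neg one_ne_zero).trans (if_pos rfl)

theorem slot_of_ne {j : ZMod F.l} (h0 : j ≠ 0) (h1 : j ≠ 1) (y : Y) :
    F.slot θ (j, y) = (D.row 1, .priv j.val, y) :=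
  (if_neg h0).trans (if_neg h1)

theorem slot_mem (p) : F.slot θ p ∈ F.rotorSet 1 := by
  obtain ⟨j, y⟩ := p
  by_cases h0 : j = 0
  · subst h0
    rw [slot_zero]
    exact Or.inl ⟨by rw [one_mul], rfl⟩
  by_cases h1 : j = 1
  · subst h1
    rw [slot_one]
    exact Or.inr (Or.inr (F.chart_notMem_core _))
  · rw [F.slot_of_ne θ h0 h1]
    exact Or.inr (Or.inl ⟨rfl, _, rfl⟩)

theorem rotor_mem : F.rotor θ ∈ supportedIn (F.rotorSet 1) :=
  viaEmbeddingHom_mem _ _ (F.slot_mem θ)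

theorem conj_rotor_mem (t : D.Q) :
    D.act Y t * F.rotor θ * (D.act Y t)⁻¹ ∈ supportedIn (F.rotorSet t) := by
  refine supportedIn_mono ?_ (conj_mem_supportedIn (F.rotor_mem θ) _)
  rintro _ ⟨⟨r, x, y⟩, (⟨h, h'⟩ | ⟨h, j, h'⟩ | h), rfl⟩
  · simp only at h h'
    subst h h'
    rw [D.act_row _ _ rfl]
    exact Or.inl ⟨by rw [one_mul], rfl⟩
  · simp only at h h'
    subst h h'
    rw [D.act_row _ _ rfl]
    exact Or.inr (Or.inl ⟨by rw [mul_one], j, rfl⟩)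
  · exact Or.inr (Or.inr fun h' => h ((D.act_mem_core t _).1 h'))

theorem strip_notMem_rotorSet {t t' : D.Q} {p} (h : t' ≠ t * D.h ∨ p.1 ≠ (1, 1)) :
    F.strip t' p ∉ F.rotorSet t := by
  rintro (⟨h1, h2⟩ | ⟨-, j, h2⟩ | h')
  · rcases h with h | h
    · exact h (D.row_injective h1)
    · obtain ⟨⟨i, j⟩, y⟩ := p
      replace h2 := Label.strip.inj h2
      refine h (Prod.ext ?_ ?_)
      · exact ZMod.val_injective _ (h2.1.trans (ZMod.val_one _).symm)
      · exact ZMod.val_injective _ (h2.2.trans (ZMod.val_one _).symm)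
  · simp [strip] at h2
  · exact h' (F.strip_range_subset_core _ _)

theorem commute_stripHom_rotor {t t' : D.Q} (h : t' ≠ t * D.h) (σ) :
    Commute (F.stripHom t' σ) (D.act Y t * F.rotor θ * (D.act Y t)⁻¹) := by
  refine commute_of_disjoint (s := Set.range (F.strip t')) ?_
    (viaEmbeddingHom_mem _ _ fun z => ⟨z, rfl⟩) (F.conj_rotor_mem θ t)
  rw [Set.disjoint_left]
  rintro _ ⟨p, rfl⟩
  exact F.strip_notMem_rotorSet (Or.inl h)

/-- A translate of the rotor. -/
noncomputable def rotorAt (t : D.Q) : Perm (Space R Y) :=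
  D.act Y t * F.rotor θ * (D.act Y t)⁻¹

/-- A translate of the slots. -/
noncomputable def slotAt (t : D.Q) (j : ZMod F.l) (y : Y) : Space R Y := D.act Y t (F.slot θ (j, y))

theorem rot_apply (j : ZMod F.l) (y : Y) :
    F.rot (j, y) = (j + 1, if j = -1 then F.twist y else y) := by
  rw [rot, Perm.mul_apply, fibreHom_apply, baseHom_apply]
  by_cases h : j = -1
  · subst h; simp
  · simp [h]

theorem rotorAt_slotAt (t : D.Q) (j : ZMod F.l) (y : Y) :
    F.rotorAt θ t (F.slotAt θ t j y) =
      F.slotAt θ t (j + 1) (if j = -1 then F.twist y else y) := by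
  rw [rotorAt, slotAt, Perm.mul_apply, Perm.mul_apply, Perm.inv_apply_self', rotor,
    viaEmbeddingHom_apply', rot_apply, slotAt]

theorem rotorAt_slotAt_zero (t : D.Q) (y : Y) :
    F.rotorAt θ t (F.slotAt θ t 0 y) = F.slotAt θ t 1 y := by
  rw [rotorAt_slotAt, if_neg (by simp), zero_add]

theorem rotorAt_inv_slotAt_zero (t : D.Q) (y : Y) :
    (F.rotorAt θ t)⁻¹ (F.slotAt θ t 0 y) = F.slotAt θ t (-1) (F.twist⁻¹ y) := by
  rw [Perm.inv_eq_iff_eq, rotorAt_slotAt, if_pos rfl, Perm.apply_inv_self', neg_add_cancel]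

theorem slotAt_mem (t : D.Q) (j : ZMod F.l) (y : Y) : F.slotAt θ t j y ∈ F.rotorSet t := by
  by_cases h0 : j = 0
  · subst h0
    rw [slotAt, slot_zero, D.act_row _ _ rfl]
    exact Or.inl ⟨rfl, rfl⟩
  by_cases h1 : j = 1
  · subst h1
    rw [slotAt, slot_one]
    exact Or.inr (Or.inr fun h => F.chart_notMem_core _ ((D.act_mem_core t _).1 h))
  · rw [slotAt, F.slot_of_ne θ h0 h1, D.act_row _ _ rfl]
    exact Or.inr (Or.inl ⟨by rw [mul_one], _, rfl⟩)

theorem slotAt_zero (t : D.Q) (y : Y) :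
    F.slotAt θ t 0 y = F.strip (t * D.h) ((1, 1), y) := by
  rw [slotAt, slot_zero, D.act_row _ _ rfl]
  change _ = (D.row _, Label.strip (ZMod.val (1 : ZMod F.s)) (ZMod.val (1 : ZMod F.s)), y)
  rw [ZMod.val_one]

theorem slotAt_mem_core {t : D.Q} {j : ZMod F.l} (h : j ≠ 1) (y : Y) :
    F.slotAt θ t j y ∈ D.core Y F.s F.l := by
  by_cases h0 : j = 0
  · subst h0
    rw [slotAt_zero]
    exact F.strip_range_subset_core _ _
  · rw [slotAt, F.slot_of_ne θ h0 h, D.act_row _ _ rfl]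
    refine ⟨⟨_, rfl⟩, Or.inr ⟨j.val, ?_, j.val_lt, rfl⟩⟩
    have h2 : j.val ≠ 0 := fun h => h0 ((ZMod.val_eq_zero j).1 h)
    have h3 : j.val ≠ 1 := fun h' => h (by rw [← ZMod.natCast_zmod_val j, h', Nat.cast_one])
    lia

theorem slotAt_one_notMem_core (t : D.Q) (y : Y) : F.slotAt θ t 1 y ∉ D.core Y F.s F.l := by
  rw [slotAt, slot_one]
  exact fun h => F.chart_notMem_core _ ((D.act_mem_core t _).1 h)

theorem rotorAt_eq_self {t : D.Q} {ω : Space R Y} (h : ∀ j y, ω ≠ F.slotAt θ t j y) :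
    F.rotorAt θ t ω = ω := by
  rw [rotorAt, Perm.mul_apply, Perm.mul_apply, rotor, viaEmbeddingHom_apply_of_notMem,
    Perm.apply_inv_self']
  rintro ⟨⟨j, y⟩, h'⟩
  refine h j y ?_
  rw [slotAt, h', Perm.apply_inv_self']

theorem rotorAt_mem (t : D.Q) : F.rotorAt θ t ∈ supportedIn (F.rotorSet t) :=
  F.conj_rotor_mem θ t

theorem rotorAt_eq_self_of_notMem_core {t : D.Q} {ω : Space R Y} (hω : ω ∉ D.core Y F.s F.l)
    (h : ∀ y, ω ≠ F.slotAt θ t 1 y) : F.rotorAt θ t ω = ω := by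
  refine F.rotorAt_eq_self θ fun j y h' => ?_
  by_cases hj : j = 1
  · exact h y (hj ▸ h')
  · exact hω (h' ▸ F.slotAt_mem_core θ hj y)

theorem rotorSet_inj {t t' : D.Q} {ω : Space R Y} (h : ω ∈ D.core Y F.s F.l)
    (h1 : ω ∈ F.rotorSet t) (h2 : ω ∈ F.rotorSet t') : t = t' := by
  rcases h1 with ⟨h1, h1'⟩ | ⟨h1, j, h1'⟩ | h1
  · rcases h2 with ⟨h2, -⟩ | ⟨-, j, h2'⟩ | h2
    · exact mul_right_cancel (D.row_injective (h1.symm.trans h2))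
    · rw [h1'] at h2'; cases h2'
    · exact (h2 h).elim
  · rcases h2 with ⟨-, h2'⟩ | ⟨h2, -⟩ | h2
    · rw [h1'] at h2'; cases h2'
    · exact D.row_injective (h1.symm.trans h2)
    · exact (h2 h).elim
  · exact (h1 h).elim

theorem rotorAt_slotAt_of_ne {t t' : D.Q} (h : t ≠ t') {j : ZMod F.l} (hj : j ≠ 1) (y : Y) :
    F.rotorAt θ t' (F.slotAt θ t j y) = F.slotAt θ t j y :=
  F.rotorAt_mem θ t' _ fun h' =>
    h (F.rotorSet_inj (F.slotAt_mem_core θ hj y) (F.slotAt_mem θ t j y) h')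

theorem rotorAt_rotorAt {t t' : D.Q} (h : t ≠ t') {ω : Space R Y} (h1 : F.rotorAt θ t ω ≠ ω)
    (h2 : F.rotorAt θ t' ω ≠ ω) : F.rotorAt θ t' (F.rotorAt θ t ω) = F.rotorAt θ t ω := by
  have hω : ω ∉ D.core Y F.s F.l := fun hc =>
    h (F.rotorSet_inj hc (by_contra fun h' => h1 (F.rotorAt_mem θ t _ h'))
      (by_contra fun h' => h2 (F.rotorAt_mem θ t' _ h')))
  obtain ⟨y, rfl⟩ : ∃ y, ω = F.slotAt θ t 1 y := by
    by_contra! h'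
    exact h1 (F.rotorAt_eq_self_of_notMem_core θ hω h')
  rw [rotorAt_slotAt]
  exact F.rotorAt_slotAt_of_ne θ h (by simp) _

theorem commutator_rotorAt_pow {t t' : D.Q} (h : t ≠ t') :
    ⁅F.rotorAt θ t, F.rotorAt θ t'⁆ ^ 3 = 1 :=
  commutator_pow_three_eq_one (fun _ h1 h2 => F.rotorAt_rotorAt θ h h1 h2)
    fun _ h1 h2 => F.rotorAt_rotorAt θ h.symm h2 h1

theorem stripHom_strip (t : D.Q) (σ) (p) : F.stripHom t σ (F.strip t p) = F.strip t (σ p) :=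
  viaEmbeddingHom_apply' _ _ _

theorem stripHom_strip_of_ne {t t' : D.Q} (h : t ≠ t') (σ) (p) :
    F.stripHom t σ (F.strip t' p) = F.strip t' p := by
  refine viaEmbeddingHom_apply_of_notMem _ _ ?_
  rintro ⟨q, hq⟩
  exact h (D.row_injective (congrArg Prod.fst hq))

theorem stripHom_of_notMem_core (t : D.Q) (σ) {ω} (h : ω ∉ D.core Y F.s F.l) :
    F.stripHom t σ ω = ω := by
  refine viaEmbeddingHom_apply_of_notMem _ _ ?_
  rintro ⟨q, rfl⟩
  exact h (F.strip_range_subset_core _ _)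

theorem stripHom_slotAt_of_ne (t t' : D.Q) (σ) {j : ZMod F.l} (hj : j ≠ 0) (y : Y) :
    F.stripHom t σ (F.slotAt θ t' j y) = F.slotAt θ t' j y := by
  by_cases h1 : j = 1
  · subst h1
    exact F.stripHom_of_notMem_core _ _ (F.slotAt_one_notMem_core _ _ _)
  · refine viaEmbeddingHom_apply_of_notMem _ _ ?_
    rintro ⟨q, hq⟩
    rw [slotAt, F.slot_of_ne θ hj h1, D.act_row _ _ rfl] at hq
    cases congrArg (fun ω => ω.2.1) hq

theorem rotorAt_strip {t t' : D.Q} {p} (h : t' ≠ t * D.h ∨ p.1 ≠ (1, 1)) :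
    F.rotorAt θ t (F.strip t' p) = F.strip t' p :=
  F.rotorAt_mem θ t _ (F.strip_notMem_rotorSet h)

section Pattern

variable {t t' : D.Q}

/-- A product of a permutation of strips and a translate of the rotor. -/
noncomputable def mixed (t t' : D.Q) (σ : Perm ((ZMod F.s × ZMod F.s) × Y)) : Perm (Space R Y) :=
  F.stripHom (t' * D.h) σ * F.rotorAt θ t

theorem commute_mixed (h : t ≠ t') (σ : Perm ((ZMod F.s × ZMod F.s) × Y)) :
    Commute (F.stripHom (t' * D.h) σ) (F.rotorAt θ t) :=
  F.commute_stripHom_rotor θ (fun h' => h (mul_right_cancel h').symm) σ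

theorem mixed_slotAt_zero (σ : Perm ((ZMod F.s × ZMod F.s) × Y)) (y : Y) :
    F.mixed θ t t' σ (F.slotAt θ t 0 y) = F.slotAt θ t 1 y := by
  rw [mixed, Perm.mul_apply, rotorAt_slotAt_zero,
    F.stripHom_slotAt_of_ne _ _ _ _ one_ne_zero]

theorem mixed_inv_slotAt_one (σ : Perm ((ZMod F.s × ZMod F.s) × Y)) (y : Y) :
    (F.mixed θ t t' σ)⁻¹ (F.slotAt θ t 1 y) = F.slotAt θ t 0 y :=
  Perm.inv_eq_iff_eq.2 (F.mixed_slotAt_zero θ σ y).symm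

theorem mixed_inv_slotAt_zero (h : t ≠ t') (σ : Perm ((ZMod F.s × ZMod F.s) × Y)) (y : Y) :
    (F.mixed θ t t' σ)⁻¹ (F.slotAt θ t 0 y) = F.slotAt θ t (-1) (F.twist⁻¹ y) := by
  rw [mixed, mul_inv_rev, Perm.mul_apply, ← map_inv, slotAt_zero,
    F.stripHom_strip_of_ne (fun h' => h (mul_right_cancel h').symm), ← slotAt_zero,
    rotorAt_inv_slotAt_zero]

theorem mixed_slotAt_one (h : t ≠ t') (σ : Perm ((ZMod F.s × ZMod F.s) × Y)) (y : Y) :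
    F.mixed θ t t' σ (F.slotAt θ t 1 y) =
      F.slotAt θ t (1 + 1) (if (1 : ZMod F.l) = -1 then F.twist y else y) := by
  rw [mixed, (F.commute_mixed θ h σ).eq, Perm.mul_apply,
    F.stripHom_slotAt_of_ne _ _ _ _ one_ne_zero, rotorAt_slotAt]

theorem mixed_slotAt_of_ne (h : t ≠ t') (σ : Perm ((ZMod F.s × ZMod F.s) × Y))
    {j : ZMod F.l} (h0 : j ≠ 0) (h1 : j ≠ 1) (y : Y) (t'' : D.Q) :
    F.mixed θ t' t'' σ (F.slotAt θ t j y) = F.slotAt θ t j y := by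
  rw [mixed, Perm.mul_apply, F.rotorAt_slotAt_of_ne θ h h1, F.stripHom_slotAt_of_ne _ _ _ _ h0]

theorem mixed_strip (h : t ≠ t') (σ : Perm ((ZMod F.s × ZMod F.s) × Y)) {p} (hp : p.1 ≠ (1, 1)) :
    F.mixed θ t t' σ (F.strip (t * D.h) p) = F.strip (t * D.h) p := by
  rw [mixed, Perm.mul_apply, F.rotorAt_strip θ (Or.inr hp),
    F.stripHom_strip_of_ne fun h' => h (mul_right_cancel h').symm]

theorem mixed_slotAt_of_strip (h : t ≠ t') (σ : Perm ((ZMod F.s × ZMod F.s) × Y)) (y : Y) :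
    F.mixed θ t' t σ (F.slotAt θ t 0 y) = F.strip (t * D.h) (σ ((1, 1), y)) := by
  rw [mixed, Perm.mul_apply, F.rotorAt_slotAt_of_ne θ h zero_ne_one, slotAt_zero, stripHom_strip]

theorem mixed_inv_slotAt_of_strip (h : t ≠ t') (σ : Perm ((ZMod F.s × ZMod F.s) × Y)) (y : Y) :
    (F.mixed θ t' t σ)⁻¹ (F.slotAt θ t 0 y) = F.strip (t * D.h) (σ⁻¹ ((1, 1), y)) := by
  rw [mixed, (F.commute_mixed θ h.symm σ).eq, mul_inv_rev, Perm.mul_apply,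
    inv_apply_eq_self (F.rotorAt_slotAt_of_ne θ h zero_ne_one _), ← map_inv,
    slotAt_zero, stripHom_strip]

theorem mixed_eq_self_of_notMem_core (σ : Perm ((ZMod F.s × ZMod F.s) × Y))
    {ω} (hω : ω ∉ D.core Y F.s F.l)
    (hω' : ω ∉ Set.range (F.slotAt θ t 1)) : F.mixed θ t t' σ ω = ω := by
  rw [mixed, Perm.mul_apply, F.rotorAt_eq_self_of_notMem_core θ hω (fun y h' => hω' ⟨y, h'.symm⟩),
    F.stripHom_of_notMem_core _ _ hω]

theorem moved_of_mixed (σ : Perm ((ZMod F.s × ZMod F.s) × Y)) {ω} (hω : F.mixed θ t t' σ ω ≠ ω) :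
    ω ∈ F.rotorSet t ∨ ∃ p, ω = F.strip (t' * D.h) p := by
  by_contra! hn
  refine hω ?_
  rw [mixed, Perm.mul_apply, F.rotorAt_mem θ t _ hn.1]
  refine viaEmbeddingHom_apply_of_notMem _ _ ?_
  rintro ⟨q, rfl⟩
  exact hn.2 q rfl

theorem commutator_mixed_pow (h : t ≠ t') (σ : Perm ((ZMod F.s × ZMod F.s) × Y))
    (τ : Perm ((ZMod F.s × ZMod F.s) × Y))
    (hσ : ∀ y, (σ ((1, 1), y)).1 ≠ (1, 1) ∧ (σ⁻¹ ((1, 1), y)).1 ≠ (1, 1))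
    (hτ : ∀ y, (τ ((1, 1), y)).1 ≠ (1, 1) ∧ (τ⁻¹ ((1, 1), y)).1 ≠ (1, 1)) :
    ⁅F.mixed θ t t' σ, F.mixed θ t' t τ⁆ ^ 105 = 1 := by
  refine commutator_pow_eq_one_of_pattern (A := Set.range (F.slotAt θ t 0))
    (A' := Set.range (F.slotAt θ t' 0)) (E := Set.range (F.slotAt θ t 1))
    (E' := Set.range (F.slotAt θ t' 1)) ?_ ?_ ?_ ?_ ?_ ?_ ?_ ?_ ?_ ?_
  · intro z hp hq
    by_cases hz : z ∈ D.core Y F.s F.l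
    · rcases F.moved_of_mixed θ σ hp with h1 | ⟨p, rfl⟩
      · rcases F.moved_of_mixed θ τ hq with h2 | ⟨p, rfl⟩
        · exact (h (F.rotorSet_inj hz h1 h2)).elim
        · left
          have : p.1 = (1, 1) := by
            by_contra hn
            exact F.strip_notMem_rotorSet (Or.inr hn) h1
          exact ⟨p.2, by rw [slotAt_zero, ← this]⟩
      · right; left
        have : p.1 = (1, 1) := by
          by_contra hn
          exact hq (F.mixed_strip θ h.symm τ hn)
        exact ⟨p.2, by rw [slotAt_zero, ← this]⟩
    · right; right
      constructor
      · by_contra hn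
        exact hp (F.mixed_eq_self_of_notMem_core θ σ hz hn)
      · by_contra hn
        exact hq (F.mixed_eq_self_of_notMem_core θ τ hz hn)
  · rintro _ ⟨y, rfl⟩
    exact ⟨y, (F.mixed_slotAt_zero θ σ y).symm⟩
  · rintro _ ⟨y, rfl⟩
    exact ⟨y, (F.mixed_inv_slotAt_one θ σ y).symm⟩
  · rintro _ ⟨y, rfl⟩
    exact ⟨y, (F.mixed_slotAt_zero θ τ y).symm⟩
  · rintro _ ⟨y, rfl⟩
    exact ⟨y, (F.mixed_inv_slotAt_one θ τ y).symm⟩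
  · rintro _ ⟨y, rfl⟩ hn
    exact F.mixed_eq_self_of_notMem_core θ τ (F.slotAt_one_notMem_core _ _ _) hn
  · rintro _ ⟨y, rfl⟩ hn
    exact F.mixed_eq_self_of_notMem_core θ σ (F.slotAt_one_notMem_core _ _ _) hn
  · rintro _ ⟨y, rfl⟩
    rw [F.mixed_slotAt_of_strip θ h, F.mixed_inv_slotAt_of_strip θ h,
      F.mixed_strip θ h σ (hτ y).1, F.mixed_strip θ h σ (hτ y).2]
    exact ⟨rfl, rfl⟩
  · rintro _ ⟨y, rfl⟩
    rw [F.mixed_slotAt_of_strip θ h.symm, F.mixed_inv_slotAt_of_strip θ h.symm,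
      F.mixed_strip θ h.symm τ (hσ y).1, F.mixed_strip θ h.symm τ (hσ y).2]
    exact ⟨rfl, rfl⟩
  · by_cases h2 : (1 : ZMod F.l) + 1 = 0
    · right
      have hl : F.l = 2 := by
        have : ((2 : ℕ) : ZMod F.l) = 0 := by push_cast; rw [← h2]; norm_num
        have h3 := Nat.le_of_dvd two_pos ((ZMod.natCast_eq_zero_iff _ _).1 this)
        have := F.two_le_l
        lia
      have ht := F.twist_eq hl
      constructor
      · rintro _ ⟨y, rfl⟩
        rw [F.mixed_slotAt_one θ h, h2, F.mixed_slotAt_zero θ, ht]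
        simp
      · rintro _ ⟨y, rfl⟩
        rw [F.mixed_slotAt_one θ h.symm, h2, F.mixed_slotAt_zero θ, ht]
        simp
    · left
      have h3 : (1 : ZMod F.l) + 1 ≠ 1 := by simp
      have h4 : (-1 : ZMod F.l) ≠ 0 := by simp
      have h5 : (-1 : ZMod F.l) ≠ 1 := fun h' => h2 (by nth_rw 1 [← h']; simp)
      refine ⟨?_, ?_, ?_⟩
      · rintro _ ⟨y, rfl⟩
        rw [F.mixed_inv_slotAt_zero θ h, F.mixed_slotAt_of_ne θ h _ h4 h5]
      · rintro _ ⟨y, rfl⟩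
        rw [F.mixed_inv_slotAt_zero θ h.symm, F.mixed_slotAt_of_ne θ h.symm _ h4 h5]
      · rintro _ ⟨y, rfl⟩ ⟨y', hy'⟩
        rw [F.mixed_slotAt_one θ h, F.mixed_slotAt_of_ne θ h _ h2 h3, ← hy',
          F.mixed_slotAt_one θ h.symm, F.mixed_slotAt_of_ne θ h.symm _ h2 h3]
        exact ⟨rfl, rfl⟩

end Pattern

theorem rotorAt_one : F.rotorAt θ 1 = F.rotor θ := by
  rw [rotorAt, D.act_one, one_mul, inv_one, mul_one]

/-- The twisted horizontal shift. -/
def twistedShift : Perm ((ZMod F.s × ZMod F.s) × Y) :=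
  (F.corner η)⁻¹ * F.shiftFst * F.corner η

theorem elt_eq : F.elt θ η =
    F.stripHom 1 (F.twistedShift η) * (F.stripHom D.g⁻¹ F.shiftSnd * F.rotorAt θ 1) := by
  rw [rotorAt_one, ← mul_assoc]
  rfl

theorem commute_stripHom_rotorAt {t t' : D.Q} (h : t' ≠ t * D.h) (σ) :
    Commute (F.stripHom t' σ) (F.rotorAt θ t) :=
  F.commute_stripHom_rotor θ h σ

theorem commute_stripHom_rotorAt_of_fix (t t' : D.Q) {σ : Perm ((ZMod F.s × ZMod F.s) × Y)}
    (h : ∀ y, σ ((1, 1), y) = ((1, 1), y)) : Commute (F.stripHom t' σ) (F.rotorAt θ t) := by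
  refine commute_of_disjoint (s := F.strip t' '' {p | p.1 ≠ (1, 1)}) (t := F.rotorSet t) ?_ ?_
    (F.rotorAt_mem θ t)
  · rw [Set.disjoint_left]
    rintro _ ⟨p, hp, rfl⟩
    exact F.strip_notMem_rotorSet (Or.inr hp)
  · intro ω hω
    by_cases h' : ω ∈ Set.range (F.strip t')
    · obtain ⟨⟨c, y⟩, rfl⟩ := h'
      have : c = (1, 1) := by
        by_contra hc
        exact hω ⟨_, hc, rfl⟩
      rw [stripHom_strip, this, h]
    · exact viaEmbeddingHom_apply_of_notMem _ _ h'

theorem g_h_ne_one : D.g * D.h ≠ 1 := fun h => D.h_ne_inv (eq_inv_of_mul_eq_one_right h)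

theorem corner_apply_one (y : Y) : F.corner η ((1, 1), y) = ((1, 1), y) := by
  rw [corner, fibreHom_apply, Pi.mulSingle_eq_of_ne (by simp), Perm.one_apply]

/-- The commutator of the twisted horizontal shift with the vertical shift acts fibrewise. -/
theorem commutator_twistedShift : ∃ f : ZMod F.s × ZMod F.s → Perm Y,
    ⁅F.twistedShift η, F.shiftSnd⁆ = fibreHom f ∧ f (1, 1) = η⁻¹ := by
  let c1 : Perm (ZMod F.s × ZMod F.s) := Equiv.addRight (1, 0)
  let c2 : Perm (ZMod F.s × ZMod F.s) := Equiv.addRight (0, 1)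
  let k : (ZMod F.s × ZMod F.s) → Perm Y := Pi.mulSingle (0, 0) η
  have hc : (baseHom c1 : Perm (_ × Y)) * baseHom c2 = baseHom c2 * baseHom c1 := by
    rw [← map_mul, ← map_mul]
    congr 1
    ext p : 1
    simp only [c1, c2, Perm.mul_apply, Equiv.coe_addRight]
    abel
  refine ⟨(Pi.mulSingle (0, 0) η)⁻¹ * Pi.mulSingle (1, 0) η * (Pi.mulSingle (1, 1) η)⁻¹ *
    Pi.mulSingle (0, 1) η, ?_, ?_⟩
  · have h1 : (fibreHom (Pi.mulSingle (1, 0) η) : Perm (_ × Y)) =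
        baseHom c1 * fibreHom k * (baseHom c1)⁻¹ := by
      rw [conj_fibreHom_mulSingle]; simp [c1]
    have h2 : (fibreHom (Pi.mulSingle (0, 1) η) : Perm (_ × Y)) =
        baseHom c2 * fibreHom k * (baseHom c2)⁻¹ := by
      rw [conj_fibreHom_mulSingle]; simp [c2]
    have h3 : (fibreHom (Pi.mulSingle (1, 1) η) : Perm (_ × Y)) =
        baseHom c1 * (baseHom c2 * fibreHom k * (baseHom c2)⁻¹) * (baseHom c1)⁻¹ := by
      rw [← h2, conj_fibreHom_mulSingle]; simp [c1]
    have h4 : (baseHom c1 : Perm (_ × Y))⁻¹ * baseHom c2 = baseHom c2 * (baseHom c1)⁻¹ := by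
      rw [inv_mul_eq_iff_eq_mul, ← mul_assoc, hc, mul_inv_cancel_right]
    rw [map_mul, map_mul, map_mul, map_inv, map_inv, h1, h2, h3, twistedShift]
    change ⁅(fibreHom k)⁻¹ * baseHom c1 * fibreHom k, baseHom c2⁆ = _
    change _ = (fibreHom k)⁻¹ * _ * _ * _
    calc ⁅(fibreHom k)⁻¹ * baseHom c1 * fibreHom k, baseHom c2⁆
        = (fibreHom k)⁻¹ * baseHom c1 * fibreHom k * (baseHom c2 * (fibreHom k)⁻¹ *
          (baseHom c1)⁻¹ * fibreHom k * (baseHom c2)⁻¹) := by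
            simp only [commutatorElement_def]; group
      _ = (fibreHom k)⁻¹ * baseHom c1 * fibreHom k * ((baseHom c1)⁻¹ * baseHom c1) *
          (baseHom c2 * (fibreHom k)⁻¹ * (baseHom c2)⁻¹ * (baseHom c2 *
          (baseHom c1)⁻¹) * fibreHom k * (baseHom c2)⁻¹) := by group
      _ = _ := by rw [← h4]; group
  · have e1 : ((1 : ZMod F.s), (1 : ZMod F.s)) ≠ (0, 0) := by simp
    have e2 : ((1 : ZMod F.s), (1 : ZMod F.s)) ≠ (1, 0) := by simp
    have e3 : ((1 : ZMod F.s), (1 : ZMod F.s)) ≠ (0, 1) := by simp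
    simp only [Pi.mul_apply, Pi.inv_apply, Pi.mulSingle_eq_of_ne e1, Pi.mulSingle_eq_of_ne e2,
      Pi.mulSingle_eq_of_ne e3, Pi.mulSingle_eq_same, inv_one, one_mul, mul_one]

/-- The part of the commutator of two translates that is killed, or made harmless, by a power. -/
noncomputable def residue : Perm (Space R Y) :=
  ⁅F.stripHom D.g⁻¹ F.shiftSnd * F.rotorAt θ 1,
    F.stripHom D.g (F.twistedShift η) * F.rotorAt θ D.g⁆

theorem act_commutator_elt :
    ⁅F.elt θ η, D.act Y D.g * F.elt θ η * (D.act Y D.g)⁻¹⁆ =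
      F.stripHom 1 ⁅F.twistedShift η, F.shiftSnd⁆ * F.residue θ η ∧
    Commute (F.stripHom 1 ⁅F.twistedShift η, F.shiftSnd⁆) (F.residue θ η) := by
  have e : D.act Y D.g * F.elt θ η * (D.act Y D.g)⁻¹ =
      F.stripHom 1 F.shiftSnd * (F.stripHom D.g (F.twistedShift η) * F.rotorAt θ D.g) := by
    rw [elt_eq, rotorAt_one]
    calc _ = D.act Y D.g * F.stripHom 1 (F.twistedShift η) * (D.act Y D.g)⁻¹ *
          (D.act Y D.g * F.stripHom D.g⁻¹ F.shiftSnd * (D.act Y D.g)⁻¹ *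
          (D.act Y D.g * F.rotor θ * (D.act Y D.g)⁻¹)) := by group
      _ = _ := by
        rw [conj_stripHom, conj_stripHom, mul_one, mul_inv_cancel, ← mul_assoc,
          (F.commute_stripHom D.g_ne _ _).eq, mul_assoc]
        rfl
  have hg : (1 : D.Q) ≠ D.g⁻¹ := fun h => D.g_ne (inv_eq_one.1 h.symm)
  have h1 : ∀ σ τ τ', Commute (F.stripHom 1 σ) (F.stripHom D.g⁻¹ τ * F.rotorAt θ 1) ∧
      Commute (F.stripHom 1 σ) (F.stripHom D.g τ' * F.rotorAt θ D.g) := fun σ τ τ' =>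
    ⟨(F.commute_stripHom hg _ _).mul_right
      (F.commute_stripHom_rotorAt θ (by rw [one_mul]; exact D.h_ne.symm) _),
    (F.commute_stripHom D.g_ne.symm _ _).mul_right
      (F.commute_stripHom_rotorAt θ g_h_ne_one.symm _)⟩
  rw [e, elt_eq, commutator_mul_mul_of_commute (h1 _ _ 1).1 (h1 _ 1 _).2 (h1 _ _ 1).1 (h1 _ 1 _).2,
    ← map_commutatorElement]
  exact ⟨rfl, commute_commutator (h1 _ _ 1).1 (h1 _ 1 _).2⟩

theorem commute_residue :
    Commute (D.act Y D.h * F.residue θ η ^ 105 * (D.act Y D.h)⁻¹) (F.elt θ η) := by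
  rcases D.cases with ⟨h3, hh⟩ | ⟨hhg, hgh⟩
  · suffices F.residue θ η ^ 105 = 1 by
      rw [this, mul_one, mul_inv_cancel]
      exact Commute.one_left _
    have hgi : D.g⁻¹ = D.g * D.h := by
      rw [hh, inv_eq_iff_mul_eq_one, ← h3, pow_three]
    have hne : D.g ≠ D.g⁻¹ := by
      rw [hgi]
      intro h
      exact D.h_ne (mul_eq_left.1 h.symm)
    set k := F.stripHom D.g (F.corner η) with hk
    have e1 : Commute k (F.stripHom D.g⁻¹ F.shiftSnd * F.rotorAt θ 1) :=
      (F.commute_stripHom hne _ _).mul_right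
        (F.commute_stripHom_rotorAt_of_fix θ _ _ (F.corner_apply_one η))
    have e2 : Commute k (F.rotorAt θ D.g) :=
      F.commute_stripHom_rotorAt_of_fix θ _ _ (F.corner_apply_one η)
    have e3 : F.residue θ η = k⁻¹ * ⁅F.mixed θ 1 D.g F.shiftSnd, F.mixed θ D.g 1 F.shiftFst⁆ *
        k⁻¹⁻¹ := by
      rw [conj_commutator, mixed, mixed, ← hgi, one_mul, hh, residue, twistedShift]
      congr 1
      · rw [e1.inv_left.eq, mul_inv_cancel_right]
      · rw [map_mul, map_mul, map_inv, ← hk, inv_inv, mul_assoc _ k, e2.eq]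
        group
    rw [e3, conj_pow, F.commutator_mixed_pow θ D.g_ne.symm, mul_one, mul_inv_cancel]
    · intro y
      constructor <;> simp [shiftSnd, baseHom_apply, ← map_inv]
    · intro y
      constructor <;> simp [shiftFst, baseHom_apply, ← map_inv]
  · have hs2 : Commute (F.stripHom D.g⁻¹ F.shiftSnd) (F.rotorAt θ D.g) :=
      F.commute_stripHom_rotorAt θ hgh.symm _
    have hs1 : Commute (F.stripHom D.g (F.twistedShift η)) (F.rotorAt θ 1) :=
      F.commute_stripHom_rotorAt θ (by rw [one_mul]; exact hhg.symm) _
    have hs2' : Commute (F.stripHom D.g⁻¹ F.shiftSnd) (F.rotorAt θ 1) :=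
      F.commute_stripHom_rotorAt θ (by rw [one_mul]; exact D.h_ne_inv.symm) _
    have hs1' : Commute (F.stripHom D.g (F.twistedShift η)) (F.rotorAt θ D.g) :=
      F.commute_stripHom_rotorAt θ (fun h => D.h_ne (mul_eq_left.1 h.symm)) _
    have e : F.residue θ η ^ 105 =
        ⁅F.stripHom D.g⁻¹ F.shiftSnd, F.stripHom D.g (F.twistedShift η)⁆ ^ 105 := by
      rw [residue, commutator_mul_mul_of_commute hs2' hs2 hs1 hs1',
        (commutator_commutator_commute hs2' hs2 hs1 hs1').mul_pow,
        show 105 = 3 * 35 from rfl, pow_mul ⁅F.rotorAt θ 1, _⁆,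
        F.commutator_rotorAt_pow θ D.g_ne.symm, one_pow, mul_one]
    rw [e]
    by_cases hg : D.g⁻¹ = D.g
    · rw [hg, ← map_commutatorElement, ← map_pow, conj_stripHom, elt_eq]
      have n1 : D.h * D.g ≠ 1 := fun h => D.h_ne_inv (eq_inv_of_mul_eq_one_left h)
      have n2 : D.h * D.g ≠ D.g⁻¹ := fun h => D.h_ne (mul_eq_right.1 (h.trans hg))
      have n3 : D.h * D.g ≠ 1 * D.h := fun h => D.g_ne (by simpa using h)
      exact (F.commute_stripHom n1 _ _).mul_right ((F.commute_stripHom n2 _ _).mul_right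
        (F.commute_stripHom_rotorAt θ n3 _))
    · rw [commutatorElement_eq_one_iff_commute.2 (F.commute_stripHom hg _ _), one_pow, mul_one,
        mul_inv_cancel]
      exact Commute.one_left _

/-- A commutator in the group generated by the translations and the element under construction,
acting on the chart. -/
noncomputable def probe : Perm (Space R Y) :=
  ⁅D.act Y D.h * ⁅F.elt θ η, D.act Y D.g * F.elt θ η * (D.act Y D.g)⁻¹⁆ ^ 105 * (D.act Y D.h)⁻¹,
    F.elt θ η⁆

theorem probe_eq : F.probe θ η =
    Perm.viaEmbeddingHom (block (D.row D.h) (.strip 1 1)) (η ^ 105)⁻¹ *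
      Perm.viaEmbeddingHom (θ.toEmbedding.trans F.chart) (η ^ 105) := by
  obtain ⟨f, hf, hf1⟩ := F.commutator_twistedShift η
  rw [probe, (F.act_commutator_elt θ η).1, (F.act_commutator_elt θ η).2.mul_pow, hf, ← map_pow,
    ← map_pow]
  have e1 : ∀ p q : Perm (Space R Y), D.act Y D.h * (p * q) * (D.act Y D.h)⁻¹ =
    D.act Y D.h * p * (D.act Y D.h)⁻¹ * (D.act Y D.h * q * (D.act Y D.h)⁻¹) := by
      intros; group
  rw [e1, commutator_mul_left_of_commute (F.commute_residue θ η), conj_stripHom, mul_one, elt_eq,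
    ← mul_assoc, commutator_mul_right_of_commute]
  rotate_left
  · exact (F.commute_stripHom D.h_ne _ _).mul_right (F.commute_stripHom D.h_ne_inv _ _)
  · exact ((F.commute_stripHom_rotorAt θ (by rw [one_mul]; exact D.h_ne.symm) _).symm.mul_right
      (F.commute_stripHom_rotorAt θ (by rw [one_mul]; exact D.h_ne_inv.symm) _).symm)
  rw [fibreHom_eq_mul _ (1, 1), map_mul, commutator_mul_left_of_commute, Pi.pow_apply, hf1, inv_pow]
  rotate_left
  · refine F.commute_stripHom_rotorAt_of_fix θ _ _ fun y => ?_
    rw [fibreHom_apply, Function.update_self, Perm.one_apply]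
  have e2 : F.stripHom D.h (fibreHom (Pi.mulSingle (1, 1) (η ^ 105)⁻¹)) =
      Perm.viaEmbeddingHom (block (D.row D.h) (.strip 1 1)) (η ^ 105)⁻¹ := by
    refine viaEmbeddingHom_fibreHom_mulSingle _ _ (fun y => ?_) _
    change (D.row D.h, Label.strip (ZMod.val (1 : ZMod F.s)) (ZMod.val (1 : ZMod F.s)), y) = _
    rw [ZMod.val_one]
    rfl
  have e3 : ∀ σ, Perm.viaEmbeddingHom (F.slot θ) (fibreHom (Pi.mulSingle 0 σ)) =
      Perm.viaEmbeddingHom (block (D.row D.h) (.strip 1 1)) σ :=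
    viaEmbeddingHom_fibreHom_mulSingle _ _ (F.slot_zero θ)
  have e4 : ∀ σ, Perm.viaEmbeddingHom (F.slot θ) (fibreHom (Pi.mulSingle 1 σ)) =
      Perm.viaEmbeddingHom (θ.toEmbedding.trans F.chart) σ :=
    viaEmbeddingHom_fibreHom_mulSingle _ _ (F.slot_one θ)
  have e5 : ∀ σ : Perm Y, F.rot * fibreHom (Pi.mulSingle 0 σ) * F.rot⁻¹ =
      fibreHom (Pi.mulSingle 1 σ) := by
    intro σ
    let A : Perm (ZMod F.l × Y) := baseHom (Equiv.addRight 1)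
    let B : Perm (ZMod F.l × Y) := fibreHom (Pi.mulSingle (-1) F.twist)
    let E : Perm (ZMod F.l × Y) := fibreHom (Pi.mulSingle 0 σ)
    have hc : B * E = E * B := by
      simp only [B, E]
      rw [← map_mul, ← map_mul, (Pi.mulSingle_commute (by simp : (-1 : ZMod F.l) ≠ 0) _ _).eq]
    calc A * B * E * (A * B)⁻¹ = A * (B * E) * B⁻¹ * A⁻¹ := by group
      _ = A * E * A⁻¹ := by rw [hc]; group
      _ = _ := by
        simp only [A, E]
        rw [conj_fibreHom_mulSingle]; simp
  rw [e2, ← e3, rotorAt_one, rotor, ← map_commutatorElement, ← e4, ← map_mul]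
  congr 1
  have := e5 (η ^ 105)
  rw [← this, commutatorElement_def, Pi.mulSingle_inv, map_inv]
  group

theorem elt_eq_mul_plain : F.elt θ η =
    Perm.viaEmbeddingHom (block (D.row 1) (.strip 0 0)) η⁻¹ *
      Perm.viaEmbeddingHom (block (D.row 1) (.strip 1 0)) η * F.plain θ := by
  have e1 : F.stripHom 1 (fibreHom (Pi.mulSingle (0, 0) η⁻¹)) =
      Perm.viaEmbeddingHom (block (D.row 1) (.strip 0 0)) η⁻¹ := by
    refine viaEmbeddingHom_fibreHom_mulSingle _ _ (fun y => ?_) _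
    change (D.row 1, Label.strip (ZMod.val (0 : ZMod F.s)) (ZMod.val (0 : ZMod F.s)), y) = _
    rw [ZMod.val_zero]
    rfl
  have e2 : F.stripHom 1 (fibreHom (Pi.mulSingle (1, 0) η)) =
      Perm.viaEmbeddingHom (block (D.row 1) (.strip 1 0)) η := by
    refine viaEmbeddingHom_fibreHom_mulSingle _ _ (fun y => ?_) _
    change (D.row 1, Label.strip (ZMod.val (1 : ZMod F.s)) (ZMod.val (0 : ZMod F.s)), y) = _
    rw [ZMod.val_one, ZMod.val_zero]
    rfl
  have e3 : F.shiftFst * F.corner η * F.shiftFst⁻¹ = fibreHom (Pi.mulSingle (1, 0) η) := by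
    rw [shiftFst, corner, conj_fibreHom_mulSingle]; simp
  rw [← e1, ← e2, ← e3, plain, elt, Pi.mulSingle_inv, map_inv fibreHom, ← mul_assoc, ← mul_assoc,
    ← map_mul, ← map_mul]
  congr 3
  rw [corner]
  group

end Frame

end Machine

section Forced

variable {Ω Y : Type u}

/-- The sequence contains the components of `p` at two different positions. -/
def Realizes (δ : ℕ → Perm Y) (p : Perm Y × Perm Y) : Prop :=
  ∃ n m, n ≠ m ∧ δ n = p.1 ∧ δ m = p.2

/-- The permutations lying in all groups of the family, as soon as the parameter realizes finitely
many pairs. -/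
def forced (H : (ℕ → Perm Y) → Subgroup (Perm Ω)) : Subgroup (Perm Ω) where
  carrier := {d | ∃ Ψ : Set (Perm Y × Perm Y), Ψ.Finite ∧
    ∀ δ, (∀ p ∈ Ψ, Realizes δ p) → d ∈ H δ}
  one_mem' := ⟨∅, Set.finite_empty, fun δ _ => one_mem _⟩
  mul_mem' := by
    rintro d d' ⟨Ψ, hΨ, h⟩ ⟨Ψ', hΨ', h'⟩
    exact ⟨Ψ ∪ Ψ', hΨ.union hΨ', fun δ hδ => mul_mem (h δ fun p hp => hδ p (Or.inl hp))
      (h' δ fun p hp => hδ p (Or.inr hp))⟩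
  inv_mem' := by
    rintro d ⟨Ψ, hΨ, h⟩
    exact ⟨Ψ, hΨ, fun δ hδ => inv_mem (h δ hδ)⟩

variable {H : (ℕ → Perm Y) → Subgroup (Perm Ω)}

theorem supportedIn_le_forced_of_conj {V V' : Set Ω} (hV : supportedIn V ≤ forced H)
    {t : (ℕ → Perm Y) → Perm Ω} (ht : ∀ δ, t δ ∈ H δ)
    (h : ∀ ω' ∈ V', ∃ ω ∈ V, ∀ δ, t δ ω = ω') : supportedIn V' ≤ forced H := by
  intro d hd
  let δ₀ : ℕ → Perm Y := 1
  have key : ∀ ω, t δ₀ ω ∈ V' → ω ∈ V ∧ ∀ δ, t δ ω = t δ₀ ω := by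
    intro ω hω
    obtain ⟨ω₁, h1, h2⟩ := h _ hω
    obtain rfl := (t δ₀).injective (h2 δ₀)
    exact ⟨h1, h2⟩
  have key' : ∀ δ ω, t δ ω ∈ V' → t δ ω = t δ₀ ω := by
    intro δ ω hω
    obtain ⟨ω₁, h1, h2⟩ := h _ hω
    obtain rfl := (t δ).injective (h2 δ)
    exact (h2 δ₀).symm
  have hd₀ : (t δ₀)⁻¹ * d * t δ₀ ∈ supportedIn V := by
    intro ω hω
    rw [Perm.mul_apply, Perm.mul_apply, hd _ fun h' => hω (key ω h').1, Perm.inv_apply_self']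
  obtain ⟨Ψ, hΨ, hH⟩ := hV hd₀
  refine ⟨Ψ, hΨ, fun δ hδ => ?_⟩
  have hd' : d = t δ * ((t δ₀)⁻¹ * d * t δ₀) * (t δ)⁻¹ := by
    rw [eq_mul_inv_iff_mul_eq]
    ext ω
    simp only [Perm.mul_apply]
    by_cases h1 : t δ₀ ω ∈ V'
    · have h2 := map_mem_of_mem_supportedIn hd h1
      have h3 := (key ((t δ₀)⁻¹ (d (t δ₀ ω))) (by rwa [Perm.apply_inv_self'])).2 δ
      rw [h3, Perm.apply_inv_self', (key ω h1).2]
    · rw [hd _ h1, Perm.inv_apply_self', hd]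
      exact fun h2 => h1 (key' δ ω h2 ▸ h2)
  rw [hd']
  exact mul_mem (mul_mem (ht δ) (hH δ hδ)) (inv_mem (ht δ))

theorem supportedIn_union_le_forced_of_conj [Infinite Ω] {V S B S' : Set Ω}
    (hV : supportedIn (V ∪ S) ≤ forced H) (hB : Big B) (hBV : B ⊆ V)
    {t : (ℕ → Perm Y) → Perm Ω} (ht : ∀ δ, t δ ∈ H δ) (hfix : ∀ δ, ∀ ω ∈ B, t δ ω = ω)
    (h : ∀ ω' ∈ S', ∃ ω ∈ V ∪ S, ∀ δ, t δ ω = ω') : supportedIn (V ∪ S') ≤ forced H := by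
  have h1 : supportedIn (B ∪ S') ≤ forced H := by
    refine supportedIn_le_forced_of_conj hV ht ?_
    rintro ω' (hω | hω)
    · exact ⟨ω', Or.inl (hBV hω), fun δ => hfix δ _ hω⟩
    · exact h _ hω
  have h2 := supportedIn_union_le ((supportedIn_mono Set.subset_union_left).trans hV) h1
    (hB.mono fun ω hω => ⟨hBV hω, Or.inl hω⟩)
  exact (supportedIn_mono fun ω hω => hω.imp id Or.inr).trans h2

theorem supportedIn_union_iUnion_le [Infinite Ω] {V : Set Ω} (hV : Big V) {P : Subgroup (Perm Ω)}
    {ι : Type*} [Finite ι] {S : ι → Set Ω} (h0 : supportedIn V ≤ P)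
    (h : ∀ i, supportedIn (V ∪ S i) ≤ P) : supportedIn (V ∪ ⋃ i, S i) ≤ P := by
  have key : ∀ s : Set ι, s.Finite → supportedIn (V ∪ ⋃ i ∈ s, S i) ≤ P := by
    intro s hs
    induction s, hs using Set.Finite.induction_on with
    | empty => simpa using h0
    | @insert a s _ _ ih =>
      rw [Set.biUnion_insert]
      refine (supportedIn_mono ?_).trans (supportedIn_union_le (h a) ih
        (hV.mono fun ω hω => ⟨Or.inl hω, Or.inl hω⟩))
      rintro ω (h | h | h)
      exacts [Or.inl (Or.inl h), Or.inl (Or.inr h), Or.inr (Or.inr h)]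
  simpa using key Set.univ Set.finite_univ

end Forced

section Data

variable {Y : Type u}

/-- The lines of the third kind carrying data. -/
def dataIndex (n : ℕ) : ℤ := 4 ^ (n + 1)

theorem dataIndex_pos (n : ℕ) : 0 < dataIndex n := by unfold dataIndex; positivity

theorem dataIndex_strictMono : StrictMono dataIndex := by
  intro n m h
  exact pow_lt_pow_right₀ (by norm_num) (by lia)

theorem dataIndex_sub_eq {n m p q : ℕ} (hnm : n ≠ m)
    (h : dataIndex p - dataIndex n = dataIndex q - dataIndex m) : p = n := by
  have hs : ∀ {i j : ℕ}, i < j → 4 * dataIndex i ≤ dataIndex j := by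
    intro i j hij
    have : dataIndex (i + 1) ≤ dataIndex j := dataIndex_strictMono.monotone hij
    have h2 : dataIndex (i + 1) = 4 * dataIndex i := by unfold dataIndex; ring
    lia
  have key : ∀ {i j k : ℕ} (l : ℕ), j < i → k < i →
      dataIndex i + dataIndex l ≠ dataIndex j + dataIndex k := by
    intro i j k l hj hk
    have := hs hj
    have := hs hk
    have := dataIndex_pos l
    have := dataIndex_pos i
    lia
  by_contra hpn
  have hpq : p ≠ q := by
    rintro rfl
    exact hnm (dataIndex_strictMono.injective (by lia))
  have hmq : m ≠ q := by
    rintro rfl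
    exact hpn (dataIndex_strictMono.injective (by lia))
  have k1 := @key p q n m
  have k2 := @key m q n p
  have k3 := @key q p m n
  have k4 := @key n p m q
  by_cases a : q < p ∧ n < p
  · exact k1 a.1 a.2 (by lia)
  by_cases b : q < m ∧ n < m
  · exact k2 b.1 b.2 (by lia)
  by_cases c : p < q ∧ m < q
  · exact k3 c.1 c.2 (by lia)
  exact k4 (by lia) (by lia) (by lia)

/-- The lines of the third kind that are neither central nor carry data. -/
abbrev FreeIndex : Type := {i : ℤ // i ≠ 0 ∧ ∀ n, i ≠ dataIndex n}

end Data

section Mover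

variable {Y : Type u} (β : FreeIndex × Y ≃ Y)

open Classical in
/-- The part of the data-free permutation of the chart, as a function. -/
noncomputable def moverFun : Chart Y → Chart Y
  | .l0 i y => .l0 (1 - i) y
  | .l1 i y => .l1 (-i) y
  | .l2 i y => if h0 : i = 0 then .u y else
      if hd : ∀ n, i ≠ dataIndex n then .z (β (⟨i, h0, hd⟩, y)) else .l2 i y
  | .z y => .l2 (β.symm y).1 (β.symm y).2
  | .u y => .l2 0 y

theorem moverFun_zero (y : Y) : moverFun β (.l2 0 y) = .u y := by
  rw [moverFun, dif_pos rfl]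

theorem moverFun_free (i : FreeIndex) (y : Y) : moverFun β (.l2 i y) = .z (β (i, y)) := by
  rw [moverFun, dif_neg i.2.1, dif_pos i.2.2]

theorem moverFun_data (n : ℕ) (y : Y) :
    moverFun β (.l2 (dataIndex n) y) = .l2 (dataIndex n) y := by
  rw [moverFun, dif_neg (dataIndex_pos n).ne', dif_neg fun h => h n rfl]

theorem line_cases (i : ℤ) : i = 0 ∨ (∃ n, i = dataIndex n) ∨ ∃ j : FreeIndex, i = j := by
  by_cases h0 : i = 0
  · exact Or.inl h0
  by_cases hd : ∃ n, i = dataIndex n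
  · exact Or.inr (Or.inl hd)
  · exact Or.inr (Or.inr ⟨⟨i, h0, not_exists.1 hd⟩, rfl⟩)

theorem moverFun_involutive : Function.Involutive (moverFun β) := by
  rintro (⟨i, y⟩ | ⟨i, y⟩ | ⟨i, y⟩ | y | y)
  · simp [moverFun]
  · simp [moverFun]
  · rcases line_cases i with rfl | ⟨n, rfl⟩ | ⟨j, rfl⟩
    · rw [moverFun_zero]; rfl
    · rw [moverFun_data, moverFun_data]
    · rw [moverFun_free, moverFun, Equiv.symm_apply_apply]
  · change moverFun β (.l2 _ _) = _
    rw [moverFun_free]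
    exact congrArg _ (β.apply_symm_apply y)
  · exact moverFun_zero β y

/-- The data-free permutation of the chart. -/
noncomputable def mover : Perm (Chart Y) := (moverFun_involutive β).toPerm

theorem mover_apply (c : Chart Y) : mover β c = moverFun β c := rfl

theorem mover_pow_two : mover β ^ 2 = 1 := by
  ext c : 1
  exact moverFun_involutive β c

/-- Permutations acting along the lines of the third kind. -/
def dat : (ℤ → Perm Y) →* Perm (Chart Y) where
  toFun f :=
    { toFun := fun c => match c with
        | .l2 i y => .l2 i (f i y)
        | c => c
      invFun := fun c => match c with
        | .l2 i y => .l2 i ((f i)⁻¹ y)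
        | c => c
      left_inv := by rintro (_ | _ | _ | _ | _) <;> simp
      right_inv := by rintro (_ | _ | _ | _ | _) <;> simp }
  map_one' := by ext (_ | _ | _ | _ | _) : 1 <;> rfl
  map_mul' f g := by ext (_ | _ | _ | _ | _) : 1 <;> rfl

theorem dat_l2 (f : ℤ → Perm Y) (i : ℤ) (y : Y) : dat f (.l2 i y) = .l2 i (f i y) := rfl

/-- The sequence `δ` placed at the data indices. -/
noncomputable def spread (δ : ℕ → Perm Y) : ℤ → Perm Y := Function.extend dataIndex δ 1

theorem spread_dataIndex (δ : ℕ → Perm Y) (n : ℕ) : spread δ (dataIndex n) = δ n :=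
  dataIndex_strictMono.injective.extend_apply _ _ _

theorem spread_of_ne (δ : ℕ → Perm Y) {i : ℤ} (h : ∀ n, i ≠ dataIndex n) : spread δ i = 1 :=
  Function.extend_apply' _ _ _ fun ⟨n, hn⟩ => h n hn.symm

theorem commute_mover_dat (δ : ℕ → Perm Y) : Commute (mover β) (dat (spread δ)) := by
  have h0 : spread δ 0 = 1 := spread_of_ne δ fun n => (dataIndex_pos n).ne
  have hf : ∀ j : FreeIndex, spread δ j = 1 := fun j => spread_of_ne δ j.2.2
  ext c : 1
  simp only [Perm.mul_apply, mover_apply]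
  rcases c with ⟨i, y⟩ | ⟨i, y⟩ | ⟨i, y⟩ | y | y
  · rfl
  · rfl
  · rw [dat_l2]
    rcases line_cases i with rfl | ⟨n, rfl⟩ | ⟨j, rfl⟩
    · rw [h0, Perm.one_apply, moverFun_zero]; rfl
    · rw [moverFun_data, moverFun_data, dat_l2]
    · rw [hf, Perm.one_apply, moverFun_free]; rfl
  · change moverFun β (.z y) = dat _ (.l2 _ _)
    rw [dat_l2, hf]
    rfl
  · change moverFun β (.u y) = dat _ (.l2 _ _)
    rw [dat_l2, h0]
    rfl

/-- The permutation of the chart encoding the sequence `δ`. -/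
noncomputable def code (δ : ℕ → Perm Y) : Perm (Chart Y) := mover β * dat (spread δ)

theorem code_pow (δ : ℕ → Perm Y) : code β δ ^ 105 = mover β * dat (spread δ ^ 105) := by
  rw [code, (commute_mover_dat β δ).mul_pow, map_pow, show 105 = 2 * 52 + 1 from rfl, pow_succ,
    pow_mul, mover_pow_two, one_pow, one_mul]

theorem code_pow_pow (δ : ℕ → Perm Y) : (code β δ ^ 105) ^ 2 = dat (spread δ ^ 210) := by
  rw [← pow_mul, code, (commute_mover_dat β δ).mul_pow, map_pow, pow_mul', mover_pow_two, one_pow,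
    one_mul]

theorem code_pow_apply (δ : ℕ → Perm Y) {c : Chart Y} (hc : ∀ i y, c ≠ .l2 i y) :
    (code β δ ^ 105) c = moverFun β c := by
  rw [code_pow, Perm.mul_apply, mover_apply]
  rcases c with ⟨i, y⟩ | ⟨i, y⟩ | ⟨i, y⟩ | y | y
  on_goal 3 => exact absurd rfl (hc i y)
  all_goals rfl

end Mover

section Family

variable {G R Y : Type u} [Group G] [MulAction G R]

/-- The lines in a row. -/
def lines (r : R) : ℤ × Y ↪ Space R Y := ⟨fun p => (r, .line p.1, p.2), fun a b h => by
  simp only [Prod.mk.injEq, true_and, Label.line.injEq] at h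
  exact Prod.ext h.1 h.2⟩

theorem lines_apply (r : R) (i : ℤ) (y : Y) : lines r (i, y) = (r, .line i, y) := rfl

theorem conj_viaEmbeddingHom_of_perm {Ω Z : Type*} {f : Z ↪ Ω} {T : Perm Ω} {π : Perm Z}
    (h : ∀ z, T (f z) = f (π z)) (σ : Perm Z) :
    T * Perm.viaEmbeddingHom f σ * T⁻¹ = Perm.viaEmbeddingHom f (π * σ * π⁻¹) := by
  rw [mul_inv_eq_iff_eq_mul]
  ext ω
  simp only [Perm.mul_apply]
  by_cases hω : ω ∈ Set.range f
  · obtain ⟨z, rfl⟩ := hω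
    rw [Perm.viaEmbeddingHom_apply, Perm.viaEmbeddingHom_apply, Perm.viaEmbedding_apply, h, h,
      Perm.viaEmbedding_apply]
    simp
  · rw [Perm.viaEmbeddingHom_apply, Perm.viaEmbeddingHom_apply,
      Perm.viaEmbedding_apply_of_notMem _ _ _ hω, Perm.viaEmbedding_apply_of_notMem]
    rintro ⟨z, hz⟩
    refine hω ⟨π⁻¹ z, T.injective ?_⟩
    rw [h, Perm.apply_inv_self', hz]

theorem viaEmbeddingHom_trans {Ω Z X : Type*} (e : X ≃ Z) (f : Z ↪ Ω) (σ : Perm X) :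
    Perm.viaEmbeddingHom (e.toEmbedding.trans f) σ = Perm.viaEmbeddingHom f (e.permCongrHom σ) := by
  ext ω
  by_cases hω : ω ∈ Set.range f
  · obtain ⟨z, rfl⟩ := hω
    obtain ⟨x, rfl⟩ := e.surjective z
    have : f (e x) = (e.toEmbedding.trans f) x := rfl
    rw [Perm.viaEmbeddingHom_apply, Perm.viaEmbeddingHom_apply, Perm.viaEmbedding_apply, this,
      Perm.viaEmbedding_apply]
    simp [Equiv.permCongrHom]
  · rw [Perm.viaEmbeddingHom_apply, Perm.viaEmbeddingHom_apply,
      Perm.viaEmbedding_apply_of_notMem _ _ _ hω, Perm.viaEmbedding_apply_of_notMem]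
    rintro ⟨z, hz⟩
    exact hω ⟨_, hz⟩

namespace Frame

variable {D : RowSystem G R} (F : Frame Y D) (θ : Y ≃ Chart Y) (β : FreeIndex × Y ≃ Y)
  (δ : ℕ → Perm Y)

/-- The element of the family with the given data. -/
noncomputable def gen : Perm (Space R Y) := F.elt θ (θ.symm.permCongrHom (code β δ))

/-- The group generated by the acting group and one element of the family. -/
noncomputable def genGroup : Subgroup (Perm (Space R Y)) :=
  Subgroup.closure (Set.range (rho R Y : G →* _) ∪ {F.gen θ β δ})

theorem gen_mem : F.gen θ β δ ∈ F.genGroup θ β δ := Subgroup.subset_closure (Or.inr rfl)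

theorem rho_mem (g : G) : rho R Y g ∈ F.genGroup θ β δ := Subgroup.subset_closure (Or.inl ⟨g, rfl⟩)

theorem act_mem (t : D.Q) : D.act Y t ∈ F.genGroup θ β δ := F.rho_mem θ β δ _

/-- The probe of an element of the family. -/
noncomputable def scan : Perm (Space R Y) := F.probe θ (θ.symm.permCongrHom (code β δ))

theorem scan_mem : F.scan θ β δ ∈ F.genGroup θ β δ := by
  have h := F.gen_mem θ β δ
  have hg := F.act_mem θ β δ D.g
  have hh := F.act_mem θ β δ D.h
  have hc : ∀ {p q}, p ∈ F.genGroup θ β δ → q ∈ F.genGroup θ β δ → ⁅p, q⁆ ∈ F.genGroup θ β δ :=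
    fun hp hq => mul_mem (mul_mem (mul_mem hp hq) (inv_mem hp)) (inv_mem hq)
  exact hc (mul_mem (mul_mem hh (pow_mem (hc h (mul_mem (mul_mem hg h) (inv_mem hg))) _))
    (inv_mem hh)) h

theorem scan_eq : ∃ σ, F.scan θ β δ =
    Perm.viaEmbeddingHom (block (D.row D.h) (.strip 1 1)) σ *
      Perm.viaEmbeddingHom F.chart (code β δ ^ 105) := by
  refine ⟨(θ.symm.permCongrHom (code β δ) ^ 105)⁻¹, (F.probe_eq θ _).trans ?_⟩
  have h : ∀ τ : Perm (Chart Y), θ.permCongrHom (θ.symm.permCongrHom τ) = τ :=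
    θ.permCongrHom.apply_symm_apply
  rw [viaEmbeddingHom_trans, map_pow θ.permCongrHom, h]

theorem block_notMem_chart (t : D.Q) (y : Y) :
    block (D.row t) (.strip 1 1) y ∉ Set.range F.chart := by
  rintro ⟨c, hc⟩
  exact F.chart_notMem_core c (hc ▸ F.strip_one_mem_core t y)

theorem scan_chart (c : Chart Y) :
    F.scan θ β δ (F.chart c) = F.chart ((code β δ ^ 105) c) := by
  obtain ⟨σ, hσ⟩ := F.scan_eq θ β δ
  rw [hσ, Perm.mul_apply, viaEmbeddingHom_apply', viaEmbeddingHom_apply_of_notMem]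
  rintro ⟨y, hy⟩
  exact F.block_notMem_chart D.h y ⟨_, hy.symm⟩

theorem scan_apply_of_notMem {ω : Space R Y} (h1 : ω ∉ Set.range F.chart)
    (h2 : ω ∉ Set.range (block (D.row D.h) (.strip 1 1) : Y ↪ Space R Y)) :
    F.scan θ β δ ω = ω := by
  obtain ⟨σ, hσ⟩ := F.scan_eq θ β δ
  rw [hσ, Perm.mul_apply, viaEmbeddingHom_apply_of_notMem _ _ h1,
    viaEmbeddingHom_apply_of_notMem _ _ h2]

theorem scan_block {t : D.Q} (h : t ≠ D.h) (y : Y) :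
    F.scan θ β δ (block (D.row t) (.strip 1 1) y) = block (D.row t) (.strip 1 1) y := by
  refine F.scan_apply_of_notMem θ β δ (F.block_notMem_chart t y) ?_
  rintro ⟨y', hy'⟩
  exact h (D.row_injective (congrArg Prod.fst hy').symm)

theorem viaEmbeddingHom_chart_dat (f : ℤ → Perm Y) :
    Perm.viaEmbeddingHom F.chart (dat f) =
      Perm.viaEmbeddingHom (lines (D.row D.b)) (fibreHom f) := by
  ext ω : 1
  by_cases h1 : ω ∈ Set.range F.chart
  · obtain ⟨c, rfl⟩ := h1
    rw [viaEmbeddingHom_apply']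
    by_cases h2 : ∃ i y, c = .l2 i y
    · obtain ⟨i, y, rfl⟩ := h2
      exact (viaEmbeddingHom_apply' (lines (D.row D.b)) (fibreHom f) (i, y)).symm
    · rw [viaEmbeddingHom_apply_of_notMem]
      · congr 1
        rcases c with ⟨i, y⟩ | ⟨i, y⟩ | ⟨i, y⟩ | y | y
        on_goal 3 => exact absurd ⟨i, y, rfl⟩ h2
        all_goals rfl
      · rintro ⟨⟨i, y⟩, h⟩
        exact h2 ⟨i, y, F.chart.injective h.symm⟩
  · rw [viaEmbeddingHom_apply_of_notMem _ _ h1, viaEmbeddingHom_apply_of_notMem]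
    rintro ⟨⟨i, y⟩, h⟩
    exact h1 ⟨.l2 i y, h⟩

/-- The translation of the lines in the first row. -/
noncomputable def slide : Perm (Space R Y) :=
  F.scan θ β δ * ((D.act Y D.a)⁻¹ * F.scan θ β δ * D.act Y D.a)

theorem slide_mem : F.slide θ β δ ∈ F.genGroup θ β δ := by
  have h := F.scan_mem θ β δ
  have ha := F.act_mem θ β δ D.a
  exact mul_mem h (mul_mem (mul_mem (inv_mem ha) h) ha)

theorem slide_lines (p : ℤ × Y) : F.slide θ β δ (lines (D.row 1) p) =
    lines (D.row 1) (baseHom (Equiv.addRight 1) p) := by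
  obtain ⟨i, y⟩ := p
  rw [baseHom_apply, slide, Perm.mul_apply, Perm.mul_apply, Perm.mul_apply, lines_apply,
    D.act_row _ _ rfl, mul_one]
  have e1 : (D.row D.a, Label.line i, y) = F.chart (.l1 i y) := rfl
  rw [e1, scan_chart, code_pow_apply _ _ (by simp)]
  have e2 : F.chart (moverFun β (.l1 i y)) = (D.row D.a, Label.line (-i), y) := rfl
  rw [e2, D.act_inv_row _ _ rfl, inv_mul_cancel]
  have e3 : (D.row 1, Label.line (-i), y) = F.chart (.l0 (-i) y) := rfl
  rw [e3, scan_chart, code_pow_apply _ _ (by simp)]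
  change (D.row 1, Label.line (1 - -i), y) = (D.row 1, Label.line (i + 1), y)
  rw [sub_neg_eq_add, add_comm]

theorem slide_block (y : Y) :
    F.slide θ β δ (block (D.row (D.b⁻¹ * D.h)) (.strip 1 1) y) =
      block (D.row (D.b⁻¹ * D.h)) (.strip 1 1) y := by
  have e : (D.act Y D.a) (block (D.row (D.b⁻¹ * D.h)) (.strip 1 1) y) =
      block (D.row (D.a * (D.b⁻¹ * D.h))) (.strip 1 1) y := D.act_row _ _ rfl _
  rw [slide, Perm.mul_apply, Perm.mul_apply, Perm.mul_apply, e, scan_block, ← e,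
    Perm.inv_apply_self', scan_block]
  · rw [Ne, _root_.mul_eq_right, inv_eq_one]
    exact D.b_ne
  · rw [← mul_assoc, Ne, _root_.mul_eq_right, mul_inv_eq_one]
    exact D.a_ne_b

/-- The square of the probe, transported to the first row. -/
noncomputable def tape : Perm (Space R Y) := (D.act Y D.b)⁻¹ * F.scan θ β δ ^ 2 * D.act Y D.b

theorem tape_mem : F.tape θ β δ ∈ F.genGroup θ β δ := by
  have hb := F.act_mem θ β δ D.b
  exact mul_mem (mul_mem (inv_mem hb) (pow_mem (F.scan_mem θ β δ) _)) hb

theorem tape_eq : ∃ σ, F.tape θ β δ =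
    Perm.viaEmbeddingHom (block (D.row (D.b⁻¹ * D.h)) (.strip 1 1)) σ *
      Perm.viaEmbeddingHom (lines (D.row 1)) (fibreHom (spread δ ^ 210)) := by
  obtain ⟨σ, hσ⟩ := F.scan_eq θ β δ
  refine ⟨σ ^ 2, ?_⟩
  have hc : Commute (Perm.viaEmbeddingHom (block (D.row D.h) (.strip 1 1)) σ)
      (Perm.viaEmbeddingHom F.chart (code β δ ^ 105)) := by
    refine commute_of_disjoint (s := (Set.range F.chart)ᶜ) (t := Set.range F.chart)
      disjoint_compl_left (viaEmbeddingHom_mem _ _ (F.block_notMem_chart _))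
      (viaEmbeddingHom_mem _ _ fun z => ⟨z, rfl⟩)
  have e0 : ∀ p q : Perm (Space R Y), (D.act Y D.b)⁻¹ * (p * q) * D.act Y D.b =
      (D.act Y D.b)⁻¹ * p * (D.act Y D.b)⁻¹⁻¹ * ((D.act Y D.b)⁻¹ * q * (D.act Y D.b)⁻¹⁻¹) := by
    intro p q; group
  rw [tape, hσ, hc.mul_pow, ← map_pow, ← map_pow, code_pow_pow, viaEmbeddingHom_chart_dat, e0]
  congr 1
  · exact conj_viaEmbeddingHom (fun y => D.act_inv_row _ _ rfl y) _
  · refine conj_viaEmbeddingHom (fun p => ?_) _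
    rw [← inv_mul_cancel D.b]
    exact D.act_inv_row _ _ rfl _

theorem slide_pow_lines (N : ℕ) (p : ℤ × Y) : (F.slide θ β δ ^ N)⁻¹ (lines (D.row 1) p) =
    lines (D.row 1) (baseHom (Equiv.addRight (-(N : ℤ))) p) := by
  rw [Perm.inv_eq_iff_eq]
  induction N generalizing p with
  | zero =>
    simp
  | succ N ih =>
    rw [pow_succ, Perm.mul_apply, slide_lines, ih (p := p)]
    congr 2
    obtain ⟨i, y⟩ := p
    rw [baseHom_apply, baseHom_apply, baseHom_apply]
    simp only [Equiv.coe_addRight, Nat.cast_add, Nat.cast_one]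
    congr 1
    ring

theorem slide_pow_block (N : ℕ) (y : Y) :
    (F.slide θ β δ ^ N)⁻¹ (block (D.row (D.b⁻¹ * D.h)) (.strip 1 1) y) =
      block (D.row (D.b⁻¹ * D.h)) (.strip 1 1) y := by
  refine inv_apply_eq_self ?_
  induction N with
  | zero => rfl
  | succ N ih => rw [pow_succ, Perm.mul_apply, slide_block, ih]

theorem line_commutator_mem {n m : ℕ} (hnm : n ≠ m) :
    Perm.viaEmbeddingHom (block (D.row 1) (.line 0)) ⁅δ n ^ 210, δ m ^ 210⁆ ∈ F.genGroup θ β δ := by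
  obtain ⟨σ, hσ⟩ := F.tape_eq θ β δ
  let T : ℕ → Perm (Space R Y) := fun N =>
    (F.slide θ β δ ^ N)⁻¹ * F.tape θ β δ * (F.slide θ β δ ^ N)⁻¹⁻¹
  have hT : ∀ N, T N ∈ F.genGroup θ β δ := fun N =>
    mul_mem (mul_mem (inv_mem (pow_mem (F.slide_mem θ β δ) _)) (F.tape_mem θ β δ))
      (inv_mem (inv_mem (pow_mem (F.slide_mem θ β δ) _)))
  let P := Perm.viaEmbeddingHom (block (D.row (D.b⁻¹ * D.h)) (.strip 1 1)) σ
  let f : ℕ → ℤ → Perm Y := fun N i => spread δ (i + N) ^ 210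
  have hTN : ∀ N, T N = P * Perm.viaEmbeddingHom (lines (D.row 1)) (fibreHom (f N)) := by
    intro N
    have e0 : ∀ c p q : Perm (Space R Y), c * (p * q) * c⁻¹ = c * p * c⁻¹ * (c * q * c⁻¹) := by
      intro c p q; group
    simp only [T]
    rw [hσ, e0, conj_viaEmbeddingHom (F.slide_pow_block θ β δ N),
      conj_viaEmbeddingHom_of_perm (F.slide_pow_lines θ β δ N), conj_fibreHom]
    congr 3
    ext i : 1
    simp only [f, Pi.pow_apply]
    congr 2
    rw [Perm.inv_eq_iff_eq]
    simp
  have hP : ∀ τ, Commute P (Perm.viaEmbeddingHom (lines (D.row 1)) τ) := by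
    intro τ
    refine commute_of_disjoint (s := {ω | ω.2.1 = .strip 1 1}) (t := {ω | ω.2.1 ≠ .strip 1 1})
      ?_ (viaEmbeddingHom_mem _ _ fun _ => Set.mem_ofPred.2 rfl)
      (viaEmbeddingHom_mem _ _ fun p => ?_)
    · rw [Set.disjoint_left]
      exact fun ω h h' => h' h
    · obtain ⟨i, y⟩ := p
      rw [lines_apply]
      simp
  have e1 : ∀ a b : Perm (Space R Y), Commute P a → Commute P b → ⁅P * a, P * b⁆ = ⁅a, b⁆ := by
    intro a b ha hb
    rw [commutator_mul_mul_of_commute ha hb ha hb, commutatorElement_self, one_mul]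
  have key : ∀ N M, ⁅T N, T M⁆ =
      Perm.viaEmbeddingHom (lines (D.row 1)) (fibreHom ⁅f N, f M⁆) := by
    intro N M
    rw [hTN, hTN, e1 _ _ (hP _) (hP _), map_commutatorElement,
      map_commutatorElement]
  have hf : ⁅f (dataIndex n).toNat, f (dataIndex m).toNat⁆ =
      Pi.mulSingle 0 ⁅δ n ^ 210, δ m ^ 210⁆ := by
    have hto : ∀ n, ((dataIndex n).toNat : ℤ) = dataIndex n := fun n =>
      Int.toNat_of_nonneg (dataIndex_pos n).le
    ext i : 1
    change ⁅f _ i, f _ i⁆ = _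
    simp only [f, hto]
    by_cases h0 : i = 0
    · subst h0
      rw [Pi.mulSingle_eq_same, zero_add, zero_add, spread_dataIndex, spread_dataIndex]
    · rw [Pi.mulSingle_eq_of_ne h0]
      by_cases h1 : ∃ p, i + dataIndex n = dataIndex p
      · by_cases h2 : ∃ q, i + dataIndex m = dataIndex q
        · obtain ⟨p, hp⟩ := h1
          obtain ⟨q, hq⟩ := h2
          have := dataIndex_sub_eq hnm (p := p) (q := q) (by lia)
          subst this
          exact absurd (by lia) h0
        · rw [spread_of_ne δ (not_exists.1 h2), one_pow, commutatorElement_one_right]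
      · rw [spread_of_ne δ (not_exists.1 h1), one_pow, commutatorElement_one_left]
  have := key (dataIndex n).toNat (dataIndex m).toNat
  rw [hf, viaEmbeddingHom_fibreHom_mulSingle _ (block (D.row 1) (.line 0)) fun y => rfl] at this
  rw [← this]
  have h1 := hT (dataIndex n).toNat
  have h2 := hT (dataIndex m).toNat
  exact mul_mem (mul_mem (mul_mem h1 h2) (inv_mem h1)) (inv_mem h2)

theorem supportedIn_line_le_forced [Infinite Y] :
    supportedIn (Set.range (block (D.row 1) (.line 0) : Y ↪ Space R Y)) ≤
      forced (F.genGroup θ β) := by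
  have h : (forced (F.genGroup θ β)).comap
      (Perm.viaEmbeddingHom (block (D.row 1) (.line 0))) = ⊤ := by
    refine eq_top_of_commutator_pow_mem (K := 210) (by norm_num) fun a b => ?_
    refine ⟨{(a, b)}, Set.finite_singleton _, fun δ hδ => ?_⟩
    obtain ⟨n, m, hnm, rfl, rfl⟩ := hδ _ rfl
    exact F.line_commutator_mem θ β δ hnm
  intro d hd
  obtain ⟨σ, rfl⟩ := exists_viaEmbeddingHom_eq _ hd
  exact Subgroup.mem_comap.1 (h ▸ Subgroup.mem_top σ)

end Frame

end Family

section Coverage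

variable {G R Y : Type u} [Group G] [MulAction G R]

theorem big_block (hY : #(Space R Y) ≤ #Y) (r : R) (x : Label) :
    Big (Set.range (block r x : Y ↪ Space R Y)) :=
  big_of_injective hY (block r x) (block r x).injective fun y => ⟨y, rfl⟩

namespace Frame

variable {D : RowSystem G R} (F : Frame Y D) (θ : Y ≃ Chart Y) (β : FreeIndex × Y ≃ Y)

theorem slotAt_one_eq (j : ZMod F.l) (y : Y) : F.slotAt θ 1 j y = F.slot θ (j, y) := by
  rw [slotAt, D.act_one, Perm.one_apply]

theorem elt_anchor (η : Perm Y) (y : Y) :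
    F.elt θ η (block (D.row 1) .anchor y) = block (D.row 1) .anchor y := by
  have h : block (D.row 1) .anchor y ∉ D.core Y F.s F.l :=
    F.notMem_core (by simp [RowSystem.coreLabel])
  rw [elt_eq, Perm.mul_apply, Perm.mul_apply, F.rotorAt_eq_self_of_notMem_core θ h,
    F.stripHom_of_notMem_core _ _ h, F.stripHom_of_notMem_core _ _ h]
  intro y' h'
  rw [slotAt_one_eq, slot_one] at h'
  exact (F.range_chart ▸ ⟨_, h'.symm⟩ : block (D.row 1) .anchor y ∈ D.outer Y F.s F.l).2 ⟨rfl, rfl⟩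

theorem elt_slotAt (η : Perm Y) (j : ZMod F.l) (y : Y) : F.elt θ η (F.slotAt θ 1 j y) =
    F.slotAt θ 1 (j + 1) (if j = -1 then F.twist y else y) := by
  rw [elt_eq, Perm.mul_apply, Perm.mul_apply, rotorAt_slotAt]
  have h : ∀ t, t ≠ D.h → ∀ σ j y, F.stripHom t σ (F.slotAt θ 1 j y) = F.slotAt θ 1 j y := by
    intro t ht σ j y
    by_cases h0 : j = 0
    · subst h0
      rw [slotAt_zero, F.stripHom_strip_of_ne (by rwa [one_mul])]
    · exact F.stripHom_slotAt_of_ne θ _ _ _ h0 _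
  rw [h _ D.h_ne_inv.symm, h _ D.h_ne.symm]

theorem elt_strip_inv (η : Perm Y) (i j : ZMod F.s) (y : Y) :
    F.elt θ η (F.strip D.g⁻¹ ((i, j), y)) = F.strip D.g⁻¹ ((i, j + 1), y) := by
  rw [elt_eq, Perm.mul_apply, Perm.mul_apply,
    F.rotorAt_strip θ (Or.inl (by rw [one_mul]; exact D.h_ne_inv.symm)), stripHom_strip,
    F.stripHom_strip_of_ne (inv_ne_one.2 D.g_ne).symm, shiftSnd, baseHom_apply]
  congr 3
  simp

theorem elt_strip_one (η : Perm Y) (i : ZMod F.s) {j : ZMod F.s} (hj : j ≠ 0) (y : Y) :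
    F.elt θ η (F.strip 1 ((i, j), y)) = F.strip 1 ((i + 1, j), y) := by
  have hc : ∀ i, F.corner η ((i, j), y) = ((i, j), y) := fun i => by
    rw [corner, fibreHom_apply, Pi.mulSingle_eq_of_ne (by simp [hj]), Perm.one_apply]
  rw [elt_eq, Perm.mul_apply, Perm.mul_apply,
    F.rotorAt_strip θ (Or.inl (by rw [one_mul]; exact D.h_ne.symm)),
    F.stripHom_strip_of_ne (inv_ne_one.2 D.g_ne), stripHom_strip, twistedShift, Perm.mul_apply,
    Perm.mul_apply, hc, shiftFst, baseHom_apply]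
  congr 1
  rw [Perm.inv_eq_iff_eq]
  refine Eq.trans ?_ (hc (i + 1)).symm
  simp

theorem scan_anchor (δ : ℕ → Perm Y) (y : Y) :
    F.scan θ β δ (block (D.row 1) .anchor y) = block (D.row 1) .anchor y := by
  refine F.scan_apply_of_notMem θ β δ ?_ ?_
  · rw [F.range_chart]
    exact fun h => h.2 ⟨rfl, rfl⟩
  · rintro ⟨y', h⟩
    exact absurd (congrArg (fun ω : Space R Y => ω.2.1) h) (by simp [block_apply])

theorem supportedIn_rest_le_forced [Infinite Y] :
    supportedIn (D.rest Y F.s F.l) ≤ forced (F.genGroup θ β) := by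
  refine supportedIn_le_forced_of_conj (F.supportedIn_line_le_forced θ β)
    (t := fun δ => F.scan θ β δ * D.act Y D.b)
    (fun δ => mul_mem (F.scan_mem θ β δ) (F.act_mem θ β δ _)) fun ω' hω => ?_
  rw [← F.range_emb] at hω
  obtain ⟨y, rfl⟩ := hω
  refine ⟨_, ⟨y, rfl⟩, fun δ => ?_⟩
  have e : (D.row D.b, Label.line 0, y) = F.chart (.l2 0 y) := rfl
  rw [Perm.mul_apply, block_apply, D.act_row _ _ rfl, mul_one, e, scan_chart, code_pow,
    Perm.mul_apply, dat_l2, Pi.pow_apply, spread_of_ne δ fun n => (dataIndex_pos n).ne, one_pow,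
    mover_apply, Perm.one_apply, moverFun_zero]
  rfl

/-- The points of the rows in the row system with the label of a line. -/
def lineSet (D : RowSystem G R) (Y : Type u) : Set (Space R Y) :=
  {ω | ∃ t i, ω.1 = D.row t ∧ ω.2.1 = .line i}

theorem supportedIn_compl_le_forced [Infinite Y] (hY : #(Space R Y) ≤ #Y) :
    supportedIn (D.core Y F.s F.l)ᶜ ≤ forced (F.genGroup θ β) := by
  have : Infinite (Space R Y) := Infinite.of_injective _ (block (D.row 1) .test).injective
  have hact := F.act_mem θ β
  set V : Set (Space R Y) := (D.core Y F.s F.l)ᶜ \ lineSet D Y with hV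
  have hVl : ∀ (r : R) (x : Label), x ∉ RowSystem.coreLabel F.s F.l → (∀ i, x ≠ .line i) →
      Set.range (block r x : Y ↪ Space R Y) ⊆ V := by
    rintro r x hx hx' _ ⟨y, rfl⟩
    exact ⟨F.notMem_core hx, fun ⟨_, i, _, h⟩ => hx' i h⟩
  have hoff : ∀ r, Set.range (block r (.off 0) : Y ↪ Space R Y) ⊆ V := fun r =>
    hVl r _ (by simp [RowSystem.coreLabel]) (by simp)
  have hanc : ∀ r, Set.range (block r .anchor : Y ↪ Space R Y) ⊆ V := fun r =>
    hVl r _ (by simp [RowSystem.coreLabel]) (by simp)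
  have h0 : supportedIn V ≤ forced (F.genGroup θ β) := by
    have h := supportedIn_union_le_forced_of_conj (V := D.rest Y F.s F.l) (S := ∅)
      (S' := {ω | ω.1 = D.row 1 ∧ (ω.2.1 = .anchor ∨ ω.2.1 = .spare)})
      (by rw [Set.union_empty]; exact F.supportedIn_rest_le_forced θ β)
      (big_block hY (D.row 1) (.off 0)) ?_ (t := fun _ => D.act Y D.g) (fun δ => hact δ _) ?_ ?_
    · refine (supportedIn_mono fun ω hω => ?_).trans h
      by_cases h1 : ω.1 = D.row 1 ∧ (ω.2.1 = .anchor ∨ ω.2.1 = .spare)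
      · exact Or.inr h1
      · refine Or.inl ⟨⟨hω.1, fun h2 => h1 ⟨h2.1, Or.inl h2.2⟩⟩,
          fun h2 => h1 ⟨h2.1, Or.inr h2.2⟩, fun i hi => ⟨?_, ?_, ?_⟩⟩ <;>
        exact fun h3 => hω.2 ⟨_, i, h3, hi⟩
    · rintro _ ⟨y, rfl⟩
      exact ⟨⟨F.notMem_core (by simp [RowSystem.coreLabel]), by simp [block]⟩, by simp [block],
        by simp [block]⟩
    · rintro _ _ ⟨y, rfl⟩
      exact D.act_off _ _ _ _
    · have hg : D.row D.g⁻¹ ≠ D.row 1 := fun h => inv_ne_one.2 D.g_ne (D.row_injective h)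
      rintro ⟨r, x, y⟩ ⟨hr, hx⟩
      simp only at hr hx
      subst hr
      refine ⟨(D.row D.g⁻¹, x, y), Or.inl ?_, fun _ => ?_⟩
      · rcases hx with rfl | rfl <;>
        exact ⟨⟨F.notMem_core (by simp [RowSystem.coreLabel]), by simp [hg]⟩, by simp [hg],
          by simp⟩
      · rw [D.act_row, mul_inv_cancel]
        rcases hx with rfl | rfl <;> rfl
  have h1 : supportedIn (V ∪ {ω | ω.1 = D.row 1 ∧ ∃ j : FreeIndex, ω.2.1 = .line j}) ≤
      forced (F.genGroup θ β) := by
    refine supportedIn_union_le_forced_of_conj (S := ∅) (by rwa [Set.union_empty])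
      (big_block hY (D.row D.b⁻¹) .anchor) (hanc _)
      (t := fun δ => (D.act Y D.b)⁻¹ * F.scan θ β δ * D.act Y D.b)
      (fun δ => mul_mem (mul_mem (inv_mem (hact δ _)) (F.scan_mem θ β δ)) (hact δ _)) ?_ ?_
    · rintro δ _ ⟨y, rfl⟩
      have e : D.act Y D.b (block (D.row D.b⁻¹) .anchor y) = block (D.row 1) .anchor y := by
        rw [← mul_inv_cancel D.b]
        exact D.act_row _ _ rfl _
      rw [Perm.mul_apply, Perm.mul_apply, e, scan_anchor, ← e, Perm.inv_apply_self']
    · rintro ⟨r, x, y⟩ ⟨hr, j, hx⟩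
      simp only at hr hx
      subst hr hx
      obtain ⟨y', hy'⟩ : ∃ y', β.symm y' = (j, y) := β.symm.surjective _
      refine ⟨block (D.row D.b⁻¹) .spare y', Or.inl (hVl _ _ (by simp [RowSystem.coreLabel])
        (by simp) ⟨y', rfl⟩), fun δ => ?_⟩
      have e : (D.row 1, Label.spare, y') = F.chart (.z y') := rfl
      rw [Perm.mul_apply, Perm.mul_apply, block_apply, D.act_row _ _ rfl, mul_inv_cancel, e,
        scan_chart, code_pow_apply _ _ (by simp), Perm.inv_eq_iff_eq, D.act_row _ _ rfl, mul_one,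
        moverFun, hy']
      rfl
  have h2 : supportedIn (V ∪ {ω | ω.1 = D.row 1 ∧ ∃ i, ω.2.1 = .line i}) ≤
      forced (F.genGroup θ β) := by
    have h := supportedIn_union_le_forced_of_conj h1 (big_block hY (D.row 1) .anchor) (hanc _)
      (S' := {ω | ω.1 = D.row 1 ∧ ∃ j : FreeIndex, ω.2.1 = .line (1 - j)})
      (t := F.scan θ β) (F.scan_mem θ β) ?_ ?_
    · refine (supportedIn_mono ?_).trans (supportedIn_union_le h1 h
        ((big_block hY (D.row 1) .anchor).mono fun ω hω =>
          ⟨Or.inl (hanc _ hω), Or.inl (hanc _ hω)⟩))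
      rintro ω (hω | ⟨hr, i, hi⟩)
      · exact Or.inl (Or.inl hω)
      have hi' : (i ≠ 0 ∧ ∀ n, i ≠ dataIndex n) ∨ (1 - i ≠ 0 ∧ ∀ n, 1 - i ≠ dataIndex n) := by
        rcases line_cases i with rfl | ⟨n, rfl⟩ | ⟨j, rfl⟩
        · refine Or.inr ⟨by norm_num, fun n h => ?_⟩
          have : dataIndex n = 4 * 4 ^ n := by unfold dataIndex; ring
          lia
        · have := dataIndex_pos n
          refine Or.inr ⟨fun h => ?_, fun m h => ?_⟩
          · have : dataIndex n = 4 * 4 ^ n := by unfold dataIndex; ring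
            lia
          · have := dataIndex_pos m
            lia
        · exact Or.inl j.2
      rcases hi' with hj | hj
      · exact Or.inl (Or.inr ⟨hr, ⟨i, hj⟩, hi⟩)
      · exact Or.inr (Or.inr ⟨hr, ⟨1 - i, hj⟩, by rw [hi, sub_sub_cancel]⟩)
    · rintro δ _ ⟨y, rfl⟩
      exact F.scan_anchor θ β δ y
    · rintro ⟨r, x, y⟩ ⟨hr, j, hx⟩
      simp only at hr hx
      subst hr hx
      refine ⟨(D.row 1, .line j, y), Or.inr ⟨rfl, j, rfl⟩, fun δ => ?_⟩
      have e : (D.row 1, Label.line j, y) = F.chart (.l0 j y) := rfl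
      rw [e, scan_chart, code_pow_apply _ _ (by simp)]
      rfl
  have h3 : supportedIn (V ∪ ⋃ t : D.Q, {ω | ω.1 = D.row t ∧ ∃ i, ω.2.1 = .line i}) ≤
      forced (F.genGroup θ β) := by
    refine supportedIn_union_iUnion_le ((big_block hY (D.row 1) .anchor).mono (hanc _)) h0
      fun t => ?_
    refine supportedIn_union_le_forced_of_conj h2 (big_block hY (D.row 1) (.off 0)) (hoff _)
      (t := fun _ => D.act Y t) (fun δ => hact δ _) ?_ ?_
    · rintro _ _ ⟨y, rfl⟩
      exact D.act_off _ _ _ _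
    · rintro ⟨r, x, y⟩ ⟨hr, i, hx⟩
      simp only at hr hx
      subst hr hx
      refine ⟨(D.row 1, .line i, y), Or.inr ⟨rfl, i, rfl⟩, fun _ => ?_⟩
      rw [D.act_row _ _ rfl, mul_one]
  refine (supportedIn_mono fun ω hω => ?_).trans h3
  by_cases h : ω ∈ lineSet D Y
  · obtain ⟨t, i, h⟩ := h
    exact Or.inr (Set.mem_iUnion.2 ⟨t, h.1, i, h.2⟩)
  · exact Or.inl ⟨hω, h⟩

/-- All permutations supported in the given set and the complement of the core are forced. -/
def Good (S : Set (Space R Y)) : Prop :=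
  supportedIn ((D.core Y F.s F.l)ᶜ ∪ S) ≤ forced (F.genGroup θ β)

variable {F θ β} {S S' : Set (Space R Y)}

theorem Good.act [Infinite Y] (hY : #(Space R Y) ≤ #Y) (hS : F.Good θ β S) (t : D.Q)
    (h : ∀ ω' ∈ S', ∃ ω ∈ S, D.act Y t ω = ω') : F.Good θ β S' := by
  have : Infinite (Space R Y) := Infinite.of_injective _ (block (D.row 1) .test).injective
  refine supportedIn_union_le_forced_of_conj hS (big_block hY (D.row 1) (.off 0)) ?_
    (t := fun _ => D.act Y t) (fun δ => F.act_mem θ β δ t) ?_ fun ω' hω => ?_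
  · rintro _ ⟨y, rfl⟩
    exact F.notMem_core (by simp [RowSystem.coreLabel])
  · rintro _ _ ⟨y, rfl⟩
    exact D.act_off _ _ _ _
  · obtain ⟨ω, h1, h2⟩ := h ω' hω
    exact ⟨ω, Or.inr h1, fun _ => h2⟩

theorem Good.gen [Infinite Y] (hY : #(Space R Y) ≤ #Y) (hS : F.Good θ β S)
    (h : ∀ ω' ∈ S', ∃ ω ∈ S, ∀ η, F.elt θ η ω = ω') : F.Good θ β S' := by
  have : Infinite (Space R Y) := Infinite.of_injective _ (block (D.row 1) .test).injective
  refine supportedIn_union_le_forced_of_conj hS (big_block hY (D.row 1) .anchor) ?_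
    (F.gen_mem θ β) ?_ fun ω' hω => ?_
  · rintro _ ⟨y, rfl⟩
    exact F.notMem_core (by simp [RowSystem.coreLabel])
  · rintro _ _ ⟨y, rfl⟩
    exact F.elt_anchor θ _ y
  · obtain ⟨ω, h1, h2⟩ := h ω' hω
    exact ⟨ω, Or.inr h1, fun _ => h2 _⟩

theorem Good.gen_inv [Infinite Y] (hY : #(Space R Y) ≤ #Y) (hS : F.Good θ β S)
    (h : ∀ ω' ∈ S', ∃ ω ∈ S, ∀ η, F.elt θ η ω' = ω) : F.Good θ β S' := by
  have : Infinite (Space R Y) := Infinite.of_injective _ (block (D.row 1) .test).injective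
  refine supportedIn_union_le_forced_of_conj hS (big_block hY (D.row 1) .anchor) ?_
    (fun δ => inv_mem (F.gen_mem θ β δ)) ?_ fun ω' hω => ?_
  · rintro _ ⟨y, rfl⟩
    exact F.notMem_core (by simp [RowSystem.coreLabel])
  · rintro _ _ ⟨y, rfl⟩
    exact inv_apply_eq_self (F.elt_anchor θ _ y)
  · obtain ⟨ω, h1, h2⟩ := h ω' hω
    exact ⟨ω, Or.inr h1, fun _ => Perm.inv_eq_iff_eq.2 (h2 _).symm⟩

theorem good_slotAt [Infinite Y] (hY : #(Space R Y) ≤ #Y) (t : D.Q) (j : ZMod F.l) :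
    F.Good θ β (Set.range (F.slotAt θ t j)) := by
  have h : ∀ n : ℕ, F.Good θ β (Set.range (F.slotAt θ 1 (1 - n))) := by
    intro n
    induction n with
    | zero =>
      refine (supportedIn_mono ?_).trans (F.supportedIn_compl_le_forced θ β hY)
      rintro ω (h | ⟨y, rfl⟩)
      · exact h
      · rw [Nat.cast_zero, sub_zero]
        exact F.slotAt_one_notMem_core θ 1 y
    | succ n ih =>
      refine ih.gen_inv hY ?_
      rintro _ ⟨y, rfl⟩
      refine ⟨F.slotAt θ 1 (1 - n)
        (if 1 - ((n + 1 : ℕ) : ZMod F.l) = -1 then F.twist y else y), ⟨_, rfl⟩,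
        fun η => (F.elt_slotAt θ η _ y).trans ?_⟩
      congr 1
      push_cast
      ring
  have h1 := h (1 - j).val
  rw [ZMod.natCast_zmod_val, sub_sub_cancel] at h1
  refine h1.act hY t ?_
  rintro _ ⟨y, rfl⟩
  exact ⟨_, ⟨y, rfl⟩, by rw [slotAt_one_eq]; rfl⟩

variable (F) in
/-- One of the strips in a row. -/
def cell (t : D.Q) (c : ZMod F.s × ZMod F.s) : Set (Space R Y) :=
  Set.range fun y => F.strip t (c, y)

theorem good_cell_of_row [Infinite Y] (hY : #(Space R Y) ≤ #Y) {t : D.Q} {c}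
    (h : F.Good θ β (F.cell t c)) (t' : D.Q) : F.Good θ β (F.cell t' c) := by
  refine h.act hY (t' * t⁻¹) ?_
  rintro _ ⟨y, rfl⟩
  exact ⟨_, ⟨y, rfl⟩, by rw [F.act_strip, inv_mul_cancel_right]⟩

theorem good_cell_snd [Infinite Y] (hY : #(Space R Y) ≤ #Y) {i : ZMod F.s}
    (h : ∀ t, F.Good θ β (F.cell t (i, 1))) (t : D.Q) (j) : F.Good θ β (F.cell t (i, j)) := by
  refine good_cell_of_row hY (t := D.g⁻¹) ?_ t
  have h' : ∀ n : ℕ, F.Good θ β (F.cell D.g⁻¹ (i, 1 + n)) := by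
    intro n
    induction n with
    | zero => simpa using h D.g⁻¹
    | succ n ih =>
      refine ih.gen hY ?_
      rintro _ ⟨y, rfl⟩
      refine ⟨_, ⟨y, rfl⟩, fun η => (F.elt_strip_inv θ η _ _ y).trans ?_⟩
      rw [Nat.cast_succ, add_assoc]
  have := h' (j - 1).val
  rwa [ZMod.natCast_zmod_val, add_sub_cancel] at this

theorem good_cell_fst [Infinite Y] (hY : #(Space R Y) ≤ #Y)
    (h : ∀ t, F.Good θ β (F.cell t (1, 1))) (t : D.Q) (i) : F.Good θ β (F.cell t (i, 1)) := by
  refine good_cell_of_row hY (t := 1) ?_ t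
  have h' : ∀ n : ℕ, F.Good θ β (F.cell 1 (1 + n, 1)) := by
    intro n
    induction n with
    | zero => simpa using h 1
    | succ n ih =>
      refine ih.gen hY ?_
      rintro _ ⟨y, rfl⟩
      refine ⟨_, ⟨y, rfl⟩, fun η => (F.elt_strip_one θ η _ one_ne_zero y).trans ?_⟩
      rw [Nat.cast_succ, add_assoc]
  have := h' (i - 1).val
  rwa [ZMod.natCast_zmod_val, add_sub_cancel] at this

theorem good_cell [Infinite Y] (hY : #(Space R Y) ≤ #Y) (t : D.Q) (c) :
    F.Good θ β (F.cell t c) := by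
  refine good_cell_snd hY (fun t => good_cell_fst hY (fun t => ?_) t c.1) t c.2
  have := good_slotAt (F := F) (θ := θ) (β := β) hY (t * D.h⁻¹) 0
  refine (supportedIn_mono ?_).trans this
  rintro ω (h | ⟨y, rfl⟩)
  · exact Or.inl h
  · exact Or.inr ⟨y, by rw [slotAt_zero, inv_mul_cancel_right]⟩

theorem forced_eq_top [Infinite Y] (hY : #(Space R Y) ≤ #Y) :
    forced (F.genGroup θ β) = ⊤ := by
  have : Infinite (Space R Y) := Infinite.of_injective _ (block (D.row 1) .test).injective
  have hbig : Big (D.core Y F.s F.l)ᶜ := by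
    refine (big_block hY (D.row 1) .test).mono ?_
    rintro _ ⟨y, rfl⟩
    exact F.notMem_core (by simp [RowSystem.coreLabel])
  have h := supportedIn_union_iUnion_le hbig (F.supportedIn_compl_le_forced θ β hY)
    (S := fun p : D.Q × ((ZMod F.s × ZMod F.s) ⊕ ZMod F.l) =>
      p.2.elim (F.cell p.1) fun j => Set.range (F.slotAt θ p.1 j)) (by
    rintro ⟨t, c | j⟩
    exacts [good_cell hY t c, good_slotAt hY t j])
  rw [eq_top_iff, ← supportedIn_univ]
  refine (supportedIn_mono ?_).trans h
  rintro ⟨r, x, y⟩ -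
  by_cases hc : (r, x, y) ∈ D.core Y F.s F.l
  · refine Or.inr (Set.mem_iUnion.2 ?_)
    obtain ⟨⟨t, hr⟩, ⟨i, j, hi, hj, hx⟩ | ⟨j, h2, hj, hx⟩⟩ := hc <;> simp only at hr hx <;>
      subst hr hx
    · refine ⟨(t, .inl (i, j)), y, ?_⟩
      change (D.row t, Label.strip (i : ZMod F.s).val (j : ZMod F.s).val, y) = _
      rw [ZMod.val_cast_of_lt hi, ZMod.val_cast_of_lt hj]
    · have hv : (j : ZMod F.l).val = j := ZMod.val_cast_of_lt hj
      refine ⟨(t, .inr j), y, ?_⟩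
      change F.slotAt θ t j y = _
      rw [slotAt, slot_of_ne, D.act_row _ _ rfl, mul_one, hv]
      · intro h0
        rw [h0, ZMod.val_zero] at hv
        lia
      · intro h0
        rw [h0, ZMod.val_one] at hv
        lia
  · exact Or.inl hc

end Frame

end Coverage

section NormalClosures

variable {Ω : Type u}

theorem commutator_mem_of_moves {H : Subgroup (Perm Ω)} {N : Subgroup H} [hN : N.Normal] {a b w : H}
    {C : Set Ω} (ha : (a : Perm Ω) ∈ supportedIn C) (hb : (b : Perm Ω) ∈ supportedIn C)
    (hw : w ∈ N) (hC : ∀ ω ∈ C, (w : Perm Ω) ω ∉ C) : ⁅a, b⁆ ∈ N := by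
  have hd : Disjoint ((w : Perm Ω) '' C) C := by
    rw [Set.disjoint_left]
    rintro _ ⟨ω, hω, rfl⟩
    exact hC ω hω
  have hc : Commute (w * a⁻¹ * w⁻¹) b := by
    have h := commute_of_disjoint hd (conj_mem_supportedIn (inv_mem ha) (w : Perm Ω)) hb
    exact Subtype.ext h.eq
  have h1 : ⁅a, w⁆ = a * (w * a⁻¹ * w⁻¹) := by simp only [commutatorElement_def]; group
  have h2 : ⁅a, w⁆ ∈ N := by
    rw [commutatorElement_def]
    exact mul_mem (hN.conj_mem _ hw a) (inv_mem hw)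
  rw [← commutator_mul_left_of_commute hc, ← h1, commutatorElement_def, mul_assoc, mul_assoc,
    ← mul_assoc b]
  exact mul_mem h2 (hN.conj_mem _ (inv_mem h2) b)

theorem exists_countable_of_mem_normalClosure {k p : Perm Ω} (h : p ∈ Subgroup.normalClosure {k}) :
    ∃ L : Set (Perm Ω), L.Countable ∧ ∀ (H : Subgroup (Perm Ω)) (hk : k ∈ H), L ⊆ H →
      p ∈ (Subgroup.normalClosure {(⟨k, hk⟩ : H)}).map H.subtype := by
  induction h using Subgroup.closure_induction with
  | mem p hp =>
    obtain ⟨k', rfl, hc⟩ := Group.mem_conjugatesOfSet_iff.1 hp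
    obtain ⟨c, rfl⟩ := isConj_iff.1 hc
    refine ⟨{c}, Set.countable_singleton c, fun H hk hL => ?_⟩
    have hc : c ∈ H := hL rfl
    have h : (⟨k', hk⟩ : H) ∈ Subgroup.normalClosure {(⟨k', hk⟩ : H)} :=
      Subgroup.subset_normalClosure rfl
    exact ⟨⟨c, hc⟩ * ⟨k', hk⟩ * ⟨c, hc⟩⁻¹, Subgroup.normalClosure_normal.conj_mem _ h ⟨c, hc⟩, rfl⟩
  | one => exact ⟨∅, Set.countable_empty, fun H hk _ => one_mem _⟩
  | mul p q _ _ hp hq =>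
    obtain ⟨L, hL, h⟩ := hp
    obtain ⟨L', hL', h'⟩ := hq
    exact ⟨L ∪ L', hL.union hL', fun H hk hLH => mul_mem
      (h H hk (Set.subset_union_left.trans hLH)) (h' H hk (Set.subset_union_right.trans hLH))⟩
  | inv p _ hp =>
    obtain ⟨L, hL, h⟩ := hp
    exact ⟨L, hL, fun H hk hLH => inv_mem (h H hk hLH)⟩

end NormalClosures

section Labels

variable {G R Y : Type u} [Group G] [MulAction G R]

/-- Permutations of the labels act on the space. -/
def labelHom (R Y : Type u) : Perm Label →* Perm (Space R Y) where
  toFun π := Equiv.prodCongr (Equiv.refl R) (Equiv.prodCongr π (Equiv.refl Y))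
  map_one' := rfl
  map_mul' _ _ := rfl

theorem labelHom_apply (π : Perm Label) (r : R) (x : Label) (y : Y) :
    labelHom R Y π (r, x, y) = (r, π x, y) := rfl

theorem exists_label_perms : ∃ π π' : Perm Label, ∀ g : G,
    rho R Y g * (labelHom R Y π * rho R Y g * (labelHom R Y π)⁻¹) =
      labelHom R Y π' * rho R Y g * (labelHom R Y π')⁻¹ := by
  have hbig : ∀ (s : Set Label) (f : ℕ → Label), Function.Injective f → (∀ n, f n ∈ s) → Big s := by
    intro s f hf hs
    have : Infinite s := Set.infinite_coe_iff.2 (Set.infinite_of_injective_forall_mem hf hs)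
    exact (mk_le_aleph0 (α := Label)).trans (aleph0_le_mk s)
  let S : Set Label := {x | x.active}
  let T : Set Label := Set.range fun n : ℕ => Label.off (2 * n)
  have hS : Big S := hbig _ Label.priv (fun _ _ h => by simpa using h) fun _ => rfl
  have hO : Big (S ∪ T)ᶜ := hbig _ (fun n => .off (2 * n + 1)) (fun _ _ h => by simpa using h) (by
    rintro n (h | ⟨m, h⟩)
    · simp [S, Label.active] at h
    · simp only [Label.off.injEq] at h
      lia)
  have hT : Big T := hbig _ (fun n => .off (2 * n)) (fun _ _ h => by simpa using h)
    fun n => ⟨n, rfl⟩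
  have hd : ∀ x ∈ T, x ∉ S := by
    rintro _ ⟨n, rfl⟩ h
    simp [S, Label.active] at h
  obtain ⟨π, hπ⟩ := exists_image_eq hS (hO.mono (Set.compl_subset_compl.2 Set.subset_union_left)) hT
    (hO.mono (Set.compl_subset_compl.2 Set.subset_union_right))
  obtain ⟨π', hπ'⟩ := exists_image_eq hS
    (hO.mono (Set.compl_subset_compl.2 Set.subset_union_left)) (hS.mono Set.subset_union_left) hO
  have key : ∀ (σ : Perm Label) (U : Set Label), σ '' S = U → ∀ (g : G) (r : R) (x : Label) (y : Y),
      (x ∈ U → (labelHom R Y σ * rho R Y g * (labelHom R Y σ)⁻¹) (r, x, y) = (g • r, x, y)) ∧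
      (x ∉ U → (labelHom R Y σ * rho R Y g * (labelHom R Y σ)⁻¹) (r, x, y) = (r, x, y)) := by
    rintro σ _ rfl g r x y
    have hmem : (σ⁻¹ x).active ↔ x ∈ σ '' S :=
      ⟨fun h => ⟨_, h, Perm.apply_inv_self' σ x⟩, by
        rintro ⟨z, hz, rfl⟩
        rwa [Perm.inv_apply_self']⟩
    rw [← map_inv, Perm.mul_apply, Perm.mul_apply, labelHom_apply σ⁻¹, rho_apply]
    constructor <;> intro h
    · rw [if_pos (hmem.2 h), labelHom_apply, Perm.apply_inv_self']
    · rw [if_neg (mt hmem.1 h), labelHom_apply, Perm.apply_inv_self']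
  refine ⟨π, π', fun g => ?_⟩
  ext ⟨r, x, y⟩ : 1
  obtain ⟨h1, h2⟩ := key π T hπ g r x y
  obtain ⟨h3, h4⟩ := key π' _ hπ' g r x y
  have h5 : x ∈ S → rho R Y g (r, x, y) = (g • r, x, y) := fun h =>
    congrArg (·, x, y) (if_pos h)
  have h6 : ∀ r, x ∉ S → rho R Y g (r, x, y) = (r, x, y) := fun r h =>
    congrArg (·, x, y) (if_neg h)
  rw [Perm.mul_apply]
  by_cases hxT : x ∈ T
  · rw [h1 hxT, h3 (Or.inr hxT), h6 _ (hd x hxT)]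
  · rw [h2 hxT]
    by_cases hxS : x ∈ S
    · rw [h5 hxS, h3 (Or.inl hxS)]
    · rw [h6 r hxS, h4 fun h => h.elim hxS hxT]

end Labels

section Realization

variable {Ω Y : Type u}

theorem exists_realizes {P : Set (Perm Y × Perm Y)} (hP : P.Countable) :
    ∃ δ : ℕ → Perm Y, ∀ p ∈ P, Realizes δ p := by
  rcases P.eq_empty_or_nonempty with rfl | hne
  · exact ⟨1, fun _ h => h.elim⟩
  obtain ⟨f, rfl⟩ := hP.exists_eq_range hne
  refine ⟨fun n => if n % 2 = 0 then (f (n / 2)).1 else (f (n / 2)).2, ?_⟩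
  rintro _ ⟨n, rfl⟩
  refine ⟨2 * n, 2 * n + 1, by lia, by simp, ?_⟩
  have h1 : (2 * n + 1) % 2 = 1 := by lia
  have h2 : (2 * n + 1) / 2 = n := by lia
  simp [h1, h2]

theorem exists_forall_mem {H : ℕ → (ℕ → Perm Y) → Subgroup (Perm Ω)} (hH : ∀ n, forced (H n) = ⊤)
    {L : Set (Perm Ω)} (hL : L.Countable) : ∃ δ, ∀ n, L ⊆ H n δ := by
  have h : ∀ n (d : L), ∃ Ψ : Set (Perm Y × Perm Y), Ψ.Finite ∧
      ∀ δ, (∀ p ∈ Ψ, Realizes δ p) → (d : Perm Ω) ∈ H n δ := fun n d =>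
    (hH n ▸ Subgroup.mem_top _ : (d : Perm Ω) ∈ forced (H n))
  choose Ψ hΨ h using h
  have := hL.to_subtype
  obtain ⟨δ, hδ⟩ := exists_realizes (Set.countable_iUnion fun n => Set.countable_iUnion fun d =>
    (hΨ n d).countable)
  exact ⟨δ, fun n d hd => h n ⟨d, hd⟩ δ fun p hp =>
    hδ p (Set.mem_iUnion.2 ⟨n, Set.mem_iUnion.2 ⟨⟨d, hd⟩, hp⟩⟩)⟩

end Realization

section Frames

variable {G R Y : Type u} [Group G] [MulAction G R] {D : RowSystem G R}

theorem addRight_pow {C : Type*} [AddGroup C] (c : C) (n : ℕ) :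
    (Equiv.addRight c : Perm C) ^ n = Equiv.addRight (n • c) := by
  induction n with
  | zero => ext; simp
  | succ n ih => ext; simp [pow_succ', ih, succ_nsmul, add_assoc]

theorem exists_frame (D : RowSystem G R) (hY : #(Space R Y) ≤ #Y) {s l : ℕ} (hs : 2 ≤ s)
    (hl : 2 ≤ l) {ζ : Perm Y} (hζ : l = 2 → ζ = 1) :
    ∃ F : Frame Y D, F.s = s ∧ F.l = l ∧ F.twist = ζ := by
  have hbig : Big (D.rest Y s l) := by
    refine (big_block hY (D.row 1) .test).mono ?_
    rintro _ ⟨y, rfl⟩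
    exact ⟨⟨fun h => by simpa [RowSystem.coreLabel, block] using h.2, by simp [block]⟩,
      by simp [block], by simp [block]⟩
  have hc : #Y = #(D.rest Y s l) := by
    rw [hbig.mk_eq]
    exact le_antisymm (mk_le_of_injective (block (D.row 1) .test).injective) hY
  obtain ⟨e⟩ := Cardinal.eq.1 hc
  refine ⟨⟨s, l, hs, hl, ζ, hζ, e.toEmbedding.trans (Function.Embedding.subtype _),
    ?_⟩, rfl, rfl, rfl⟩
  ext ω
  exact ⟨by rintro ⟨y, rfl⟩; exact (e y).2, fun h => ⟨e.symm ⟨ω, h⟩, by simp⟩⟩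

namespace Frame

variable (F : Frame Y D) (θ : Y ≃ Chart Y) (η : Perm Y)

theorem baseHom_addRight_pow {C : Type*} [AddGroup C] {c : C} {n : ℕ} (h : n • c = 0) :
    (baseHom (Equiv.addRight c) : Perm (C × Y)) ^ n = 1 := by
  rw [← map_pow, addRight_pow, h]
  ext : 1
  simp

theorem elt_pow_eq_one (hsl : F.s = F.l) (ht : F.twist = 1) : F.elt θ η ^ F.l = 1 := by
  have h1 : F.shiftFst ^ F.l = 1 := baseHom_addRight_pow (by ext <;> simp [← hsl])
  have h2 : F.shiftSnd ^ F.l = 1 := baseHom_addRight_pow (by ext <;> simp [← hsl])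
  have h3 : F.rotor θ ^ F.l = 1 := by
    rw [rotor, ← map_pow, rot, ht, Pi.mulSingle_one, map_one, mul_one,
      baseHom_addRight_pow (by simp), map_one]
  have h4 : F.twistedShift η ^ F.l = 1 := by
    have := conj_pow (i := F.l) (a := (F.corner η)⁻¹) (b := F.shiftFst)
    rw [inv_inv, h1, mul_one, inv_mul_cancel] at this
    exact this
  rw [elt_eq, (((F.commute_stripHom (inv_ne_one.2 D.g_ne).symm _ _).mul_right
    (F.commute_stripHom_rotorAt θ (by rw [one_mul]; exact D.h_ne.symm) _))).mul_pow,
    (F.commute_stripHom_rotorAt θ (by rw [one_mul]; exact D.h_ne_inv.symm) _).mul_pow,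
    ← map_pow, ← map_pow, h4, h2, rotorAt_one, h3, map_one, map_one, one_mul, one_mul]

theorem elt_pow_strip_inv (m : ℕ) (i j : ZMod F.s) (y : Y) :
    (F.elt θ η ^ m) (F.strip D.g⁻¹ ((i, j), y)) = F.strip D.g⁻¹ ((i, j + m), y) := by
  induction m with
  | zero => simp
  | succ m ih =>
    rw [pow_succ', Perm.mul_apply, ih, elt_strip_inv, Nat.cast_succ, add_assoc]

theorem slotAt_one_injective {j j' : ZMod F.l} {y y' : Y}
    (h : F.slotAt θ 1 j y = F.slotAt θ 1 j' y') : j = j' ∧ y = y' := by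
  rw [slotAt_one_eq, slotAt_one_eq] at h
  simpa using (F.slot θ).injective h

theorem elt_pow_slotAt_zero (m : ℕ) (y : Y) :
    (F.elt θ η ^ m) (F.slotAt θ 1 0 y) = F.slotAt θ 1 m ((F.twist ^ (m / F.l)) y) := by
  induction m with
  | zero => simp
  | succ m ih =>
    have h : (m : ZMod F.l) = -1 ↔ F.l ∣ m + 1 := by
      rw [← ZMod.natCast_eq_zero_iff, Nat.cast_succ, eq_neg_iff_add_eq_zero]
    rw [pow_succ', Perm.mul_apply, ih, elt_slotAt, Nat.cast_succ]
    by_cases hm : F.l ∣ m + 1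
    · rw [if_pos (h.2 hm), Nat.succ_div_of_dvd hm, pow_succ', Perm.mul_apply]
    · rw [if_neg (mt h.1 hm), Nat.succ_div_of_not_dvd hm]

end Frame

theorem exists_shift (Y : Type u) [Infinite Y] : ∃ (ζ : Perm Y) (C : Set Y), Big C ∧
    ∀ m : ℕ, m ≠ 0 → ∀ y ∈ C, (ζ ^ m) y ∉ C := by
  obtain ⟨e⟩ := Cardinal.eq.1 (mk_prod_countable (Ω := Y) ℤ)
  refine ⟨e.permCongrHom (baseHom (Equiv.addRight 1)), Set.range fun y => e (0, y),
    big_of_injective le_rfl (fun y => e (0, y)) (fun a b h => by simpa using h)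
      fun y => ⟨y, rfl⟩, ?_⟩
  rintro m hm _ ⟨y, rfl⟩ ⟨y', h⟩
  rw [← map_pow, ← map_pow, Equiv.permCongrHom_coe, Equiv.permCongr_apply, Equiv.symm_apply_apply,
    baseHom_apply, addRight_pow] at h
  have : (0 : ℤ) = m ∧ y' = y := by simpa using e.injective h
  lia

theorem exists_frame_moves [Infinite Y] (D : RowSystem G R) (hY : #(Space R Y) ≤ #Y)
    (θ : Y ≃ Chart Y) (n : ℕ) : ∃ F : Frame Y D, n = 0 ∨ 2 ≤ n →
      (∀ η, F.elt θ η ^ n = 1) ∧ ∀ m, ¬ n ∣ m → ∃ C, Big C ∧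
        ∀ η, ∀ ω ∈ C, (F.elt θ η ^ m) ω ∉ C := by
  rcases lt_or_ge n 2 with hn | hn
  · obtain ⟨ζ, C, hC, h⟩ := exists_shift Y
    obtain ⟨F, -, hl, rfl⟩ := exists_frame D hY le_rfl (by lia : 2 ≤ 3) (ζ := ζ) (by lia)
    refine ⟨F, fun h' => ?_⟩
    obtain rfl : n = 0 := by lia
    refine ⟨fun η => pow_zero _, fun m hm => ⟨F.slotAt θ 1 0 '' C, ?_, ?_⟩⟩
    · obtain ⟨f, hf, hfC⟩ := hC.exists_injective le_rfl
      exact big_of_injective hY (fun y => F.slotAt θ 1 0 (f y))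
        (fun a b h => hf (F.slotAt_one_injective θ h).2) fun y => ⟨_, hfC y, rfl⟩
    · rintro η _ ⟨y, hy, rfl⟩ ⟨y', hy', he⟩
      rw [F.elt_pow_slotAt_zero] at he
      obtain ⟨h0, rfl⟩ := F.slotAt_one_injective θ he
      obtain ⟨k, rfl⟩ := (ZMod.natCast_eq_zero_iff _ _).1 h0.symm
      rw [Nat.mul_div_cancel_left _ (Nat.pos_of_neZero _)] at hy'
      exact h k (by rintro rfl; exact hm (dvd_refl 0)) y hy hy'
  · obtain ⟨F, hs, hl, ht⟩ := exists_frame D hY hn hn (ζ := 1) fun _ => rfl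
    refine ⟨F, fun _ => ⟨fun η => hl ▸ F.elt_pow_eq_one θ η (hs.trans hl.symm) ht, fun m hm =>
      ⟨Set.range fun y => F.strip D.g⁻¹ ((0, 0), y), ?_, ?_⟩⟩⟩
    · exact big_of_injective hY (fun y => F.strip D.g⁻¹ ((0, 0), y)) (fun a b h => by simpa using h)
        fun y => ⟨y, rfl⟩
    · rintro η _ ⟨y, rfl⟩ ⟨y', he⟩
      rw [F.elt_pow_strip_inv] at he
      have := (F.strip D.g⁻¹).injective he
      simp only [Prod.mk.injEq, zero_add, true_and] at this
      rw [eq_comm, ZMod.natCast_eq_zero_iff, hs] at this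
      exact hm this.1

end Frames

section Main

variable {G R Y : Type u} [Group G] [MulAction G R] {D : RowSystem G R}

/-- The group does not depend on the frame, if it contains the untwisted elements. -/
theorem Frame.genGroup_le (F F' : Frame Y D) (θ : Y ≃ Chart Y) (β : FreeIndex × Y ≃ Y)
    {δ : ℕ → Perm Y} (h : F.plain θ ∈ F.genGroup θ β δ) (h' : F'.plain θ ∈ F.genGroup θ β δ) :
    F'.genGroup θ β δ ≤ F.genGroup θ β δ := by
  have hg := F.gen_mem θ β δ
  rw [genGroup, Subgroup.closure_le]
  rintro _ (⟨g, rfl⟩ | rfl)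
  · exact F.rho_mem θ β δ g
  · rw [gen, elt_eq_mul_plain] at hg ⊢
    exact mul_mem ((Subgroup.mul_mem_cancel_right _ h).1 hg) h'

theorem exists_mem_image_subset {Ω : Type u} {C C' : Set Ω} {w : Perm Ω}
    (hC : Big C) (hCc : Big Cᶜ) (hC' : Big C') (hw : ∀ ω ∈ C', w ω ∉ C') :
    ∃ c : Perm Ω, ∀ ω ∈ C, c ω ∈ C' := by
  obtain ⟨c, hc⟩ := exists_image_eq hC hCc hC' ((hC'.image w).mono (by
    rintro _ ⟨ω, hω, rfl⟩
    exact hw ω hω))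
  exact ⟨c, fun ω hω => hc ▸ ⟨ω, hω, rfl⟩⟩

theorem exists_simple_of_rowSystem [Infinite Y] (D : RowSystem G R) (hY : #(Space R Y) ≤ #Y) :
    ∃ (S : Type u) (_ : Group S),
      IsSimpleGroup S ∧
      ∃ φ : G →* S, Function.Injective φ ∧
        ∀ p : ℕ, (p = 0 ∨ 2 ≤ p) →
          ∃ x : S, orderOf x = p ∧ Subgroup.closure (Set.range φ ∪ {x}) = ⊤ := by
  have : Infinite (Space R Y) := Infinite.of_injective _ (block (D.row 1) .test).injective
  obtain ⟨θ⟩ : Nonempty (Y ≃ Chart Y) := by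
    obtain ⟨F, -⟩ := exists_frame D hY le_rfl le_rfl fun _ => rfl
    exact Cardinal.eq.1 (le_antisymm
      (mk_le_of_injective (f := Chart.u) fun a b h => by simpa using h)
      ((mk_le_of_injective F.chart.injective).trans hY))
  have : Nonempty FreeIndex := ⟨⟨-1, by simp, fun n h => by have := dataIndex_pos n; lia⟩⟩
  obtain ⟨β⟩ : Nonempty (FreeIndex × Y ≃ Y) := Cardinal.eq.1 (mk_prod_countable FreeIndex)
  choose F hF using exists_frame_moves D hY θ
  obtain ⟨a, b, C, hC, hab⟩ := exists_commutator_pow_moves (Ω := Y) one_ne_zero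
  rw [pow_one, pow_one] at hab
  set f : Y ↪ Space R Y := block D.free .test
  set k : Perm (Space R Y) := ⁅Perm.viaEmbeddingHom f a, Perm.viaEmbeddingHom f b⁆ with hk
  have hkf : k = Perm.viaEmbeddingHom f ⁅a, b⁆ := (map_commutatorElement _ _ _).symm
  have hfC : Big (f '' C) := by
    obtain ⟨j, hj, hjC⟩ := hC.exists_injective le_rfl
    exact big_of_injective hY (fun y => f (j y)) (f.injective.comp hj) fun y => ⟨_, hjC y, rfl⟩
  have hkC : ∀ ω ∈ f '' C, k ω ∉ f '' C := by
    rintro _ ⟨y, hy, rfl⟩ ⟨y', hy', h⟩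
    rw [hkf, viaEmbeddingHom_apply'] at h
    exact hab y hy (f.injective h ▸ hy')
  have htop : Subgroup.normalClosure {k} = ⊤ :=
    eq_top_of_normal (Subgroup.subset_normalClosure rfl) hfC hkC
  obtain ⟨π, π', hπ⟩ := exists_label_perms (G := G) (R := R) (Y := Y)
  obtain ⟨L, hL, hLπ⟩ := exists_countable_of_mem_normalClosure
    (k := k) (p := labelHom R Y π) (htop ▸ Subgroup.mem_top _)
  obtain ⟨L', hL', hLπ'⟩ := exists_countable_of_mem_normalClosure
    (k := k) (p := labelHom R Y π') (htop ▸ Subgroup.mem_top _)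
  have hc : ∀ n m, ∃ c : Perm (Space R Y), (n = 0 ∨ 2 ≤ n) → ¬ n ∣ m → ∀ η, ∀ ω ∈ Set.range f,
      (c⁻¹ * (F n).elt θ η ^ m * c) ω ∉ Set.range f := by
    intro n m
    by_cases h : (n = 0 ∨ 2 ≤ n) ∧ ¬ n ∣ m
    · obtain ⟨C', hC', h'⟩ := (hF n h.1).2 m h.2
      obtain ⟨c, hc⟩ := exists_mem_image_subset (big_block hY D.free .test)
        ((big_block hY D.free .anchor).mono (by
          rintro _ ⟨y, rfl⟩ ⟨y', he⟩
          simpa [block] using congrArg (fun ω => ω.2.1) he)) hC' (h' 1)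
      refine ⟨c, fun _ _ η ω hω hω' => h' η (c ω) (hc ω hω) ?_⟩
      have := hc _ hω'
      rwa [Perm.mul_apply, Perm.mul_apply, Perm.apply_inv_self'] at this
    · exact ⟨1, fun h1 h2 => (h ⟨h1, h2⟩).elim⟩
  choose c hc using hc
  obtain ⟨δ, hδ⟩ := exists_forall_mem (fun n => (F n).forced_eq_top (θ := θ) (β := β) hY)
    (L := L ∪ L' ∪ {Perm.viaEmbeddingHom f a, Perm.viaEmbeddingHom f b} ∪
      Set.range (fun p : ℕ × ℕ => c p.1 p.2) ∪ Set.range fun n => (F n).plain θ) (by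
    refine ((((hL.union hL').union ?_).union ?_).union ?_)
    exacts [(Set.toFinite _).countable, Set.countable_range _, Set.countable_range _])
  have hpl : ∀ n m, (F m).plain θ ∈ (F n).genGroup θ β δ := fun n m => hδ n (Or.inr ⟨m, rfl⟩)
  set H := (F 0).genGroup θ β δ with hH
  have hHn : ∀ n, (F n).genGroup θ β δ = H := fun n =>
    le_antisymm (Frame.genGroup_le _ _ θ β (hpl 0 0) (hpl 0 n))
      (Frame.genGroup_le _ _ θ β (hpl n n) (hpl n 0))
  have hcH : ∀ n m, c n m ∈ H := fun n m => hδ 0 (Or.inl (Or.inr ⟨(n, m), rfl⟩))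
  let a' : H := ⟨Perm.viaEmbeddingHom f a, hδ 0 (Or.inl (Or.inl (Or.inr (Or.inl rfl))))⟩
  let b' : H := ⟨Perm.viaEmbeddingHom f b, hδ 0 (Or.inl (Or.inl (Or.inr (Or.inr rfl))))⟩
  let x : ℕ → H := fun n => ⟨(F n).gen θ β δ, hHn n ▸ (F n).gen_mem θ β δ⟩
  let φ : G →* H := (rho R Y).codRestrict H ((F 0).rho_mem θ β δ)
  have hsupp : ∀ σ : Perm Y, Perm.viaEmbeddingHom f σ ∈ supportedIn (Set.range f) := fun σ =>
    viaEmbeddingHom_mem f σ fun z => ⟨z, rfl⟩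
  have hmem : ∀ (N : Subgroup H) [N.Normal] (w : H), w ∈ N →
      (∀ ω ∈ Set.range f, (w : Perm (Space R Y)) ω ∉ Set.range f) → ⁅a', b'⁆ ∈ N :=
    fun N _ w hw hwf => commutator_mem_of_moves (hsupp a) (hsupp b) hw hwf
  refine exists_simple_of_normalClosure φ (k := ⁅a', b'⁆) x ?_ ?_ ?_ ?_ ?_ ?_
  · intro g hg
    refine hmem _ (φ g) (Subgroup.subset_normalClosure rfl) ?_
    rintro _ ⟨y, rfl⟩ ⟨y', h⟩
    exact D.smul_free_ne g hg (congrArg Prod.fst h).symm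
  · intro g
    set N := Subgroup.normalClosure {⁅a', b'⁆} with hN
    have hkH : k ∈ H := (⁅a', b'⁆ : H).2
    obtain ⟨p, hp, hpe⟩ := hLπ H hkH fun d hd => hδ 0 (Or.inl (Or.inl (Or.inl (Or.inl hd))))
    obtain ⟨p', hp', hpe'⟩ := hLπ' H hkH fun d hd => hδ 0 (Or.inl (Or.inl (Or.inl (Or.inr hd))))
    have he : φ g * (p * φ g * p⁻¹) = p' * φ g * p'⁻¹ := by
      refine Subtype.ext ?_
      have := hπ g
      rw [← hpe, ← hpe'] at this
      exact this
    have h1 : ∀ q ∈ N, (q : H ⧸ N) = 1 := fun q hq => (QuotientGroup.eq_one_iff q).2 hq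
    have h2 := congrArg (QuotientGroup.mk' N) he
    simp only [map_mul, map_inv, QuotientGroup.mk'_apply, h1 p hp, h1 p' hp', one_mul, inv_one,
      mul_one] at h2
    exact (QuotientGroup.eq_one_iff _).1 (mul_left_cancel (h2.trans (mul_one _).symm))
  · intro h
    obtain ⟨j, -, hj⟩ := hfC.exists_injective le_rfl
    have hk1 : k = 1 := congrArg Subtype.val h
    obtain ⟨ω⟩ := (inferInstance : Nonempty (Space R Y))
    exact hkC _ (hj ω) (by rw [hk1]; exact hj ω)
  · intro n hn
    refine (Subgroup.map_injective H.subtype_injective) ?_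
    rw [MonoidHom.map_closure, Set.image_union, ← Set.range_comp, Set.image_singleton,
      ← MonoidHom.range_eq_map, H.range_subtype]
    exact hHn n
  · intro n hn
    exact Subtype.ext ((hF n hn).1 _)
  · intro n hn m hm
    refine hmem _ (⟨c n m, hcH n m⟩⁻¹ * x n ^ m * ⟨c n m, hcH n m⟩) ?_ (hc n m hn hm _)
    have := Subgroup.normalClosure_normal.conj_mem _
      (Subgroup.subset_normalClosure (Set.mem_singleton (x n ^ m))) (⟨c n m, hcH n m⟩ : H)⁻¹
    rwa [inv_inv] at this

end Main

section Existence

variable {G : Type u} [Group G]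

/-- Adjoining a free orbit to the left translation action on a coset space. -/
abbrev FreeAndCosets (K : Subgroup G) : Type u := G ⊕ G ⧸ K

theorem mk_zpow_eq_iff {g : G} (hg : 3 ∣ orderOf g) (m n : ℤ) :
    ((g ^ m : G) : G ⧸ Subgroup.zpowers (g ^ (3 : ℤ))) = (g ^ n : G) ↔ (m : ZMod 3) = n := by
  rw [QuotientGroup.eq, ← zpow_neg, ← zpow_add, Subgroup.mem_zpowers_iff,
    ZMod.intCast_eq_intCast_iff_dvd_sub]
  constructor
  · rintro ⟨k, hk⟩
    rw [← zpow_mul, ← mul_inv_eq_one, ← zpow_neg, ← zpow_add, ← orderOf_dvd_iff_zpow_eq_one] at hk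
    have := (Int.natCast_dvd_natCast.2 hg).trans hk
    push_cast at this ⊢
    lia
  · rintro ⟨k, hk⟩
    refine ⟨k, ?_⟩
    rw [← zpow_mul]
    congr 1
    push_cast at hk
    lia

theorem nonempty_rowSystem_of_dvd {g : G} (hg : 3 ∣ orderOf g) :
    Nonempty (RowSystem G (FreeAndCosets (Subgroup.zpowers (g ^ (3 : ℤ))))) := by
  let c (t : ULift.{u} (Multiplicative (ZMod 3))) : ZMod 3 := t.down.toAdd
  have hc : Function.Injective c := fun a b h => ULift.down_injective h
  have hcast : ∀ t, (((c t).val : ℤ) : ZMod 3) = c t := fun t => by simp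
  let w : ULift.{u} (Multiplicative (ZMod 3)) := ⟨Multiplicative.ofAdd 1⟩
  refine ⟨{
    Q := ULift.{u} (Multiplicative (ZMod 3))
    row := fun t => Sum.inr ((g ^ ((c t).val : ℤ) : G) : G ⧸ _)
    row_injective := fun t t' h => ?_
    lift := fun t => g ^ ((c t).val : ℤ)
    lift_one := by simp [c]
    lift_smul_row := fun t t' => ?_
    free := Sum.inl 1
    smul_free_ne := fun x hx h => hx (by simpa using h)
    g := w
    h := w
    a := w
    b := w ^ 2
    g_ne := fun h => absurd (congrArg c h) (by decide)
    h_ne := fun h => absurd (congrArg c h) (by decide)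
    h_ne_inv := fun h => absurd (congrArg c h) (by decide)
    a_ne := fun h => absurd (congrArg c h) (by decide)
    b_ne := fun h => absurd (congrArg c h) (by decide)
    a_ne_b := fun h => absurd (congrArg c h) (by decide)
    cases := Or.inl ⟨hc (by decide), rfl⟩ }⟩
  · have := (mk_zpow_eq_iff hg _ _).1 (Sum.inr_injective h)
    rw [hcast, hcast] at this
    exact hc this
  · rw [Sum.smul_inr, MulAction.Quotient.smul_coe, smul_eq_mul, ← zpow_add]
    refine congrArg Sum.inr ((mk_zpow_eq_iff hg _ _).2 ?_)
    rw [Int.cast_add, hcast, hcast, hcast]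
    rfl

theorem nonempty_rowSystem_of_subgroup (Q : Subgroup G) [Finite Q] (g h : Q) (hg : g ≠ 1)
    (hh : h ≠ 1) (hi : h ≠ g⁻¹) (hgh : h ≠ g) (hghi : g * h ≠ g⁻¹) :
    Nonempty (RowSystem G (FreeAndCosets (⊥ : Subgroup G))) :=
  ⟨{Q := Q
    row := fun t => Sum.inr ((t : G) : G ⧸ _)
    row_injective := fun t t' e => Subtype.ext (by
      simpa [QuotientGroup.eq, inv_mul_eq_one] using Sum.inr_injective e)
    lift := fun t => t
    lift_one := rfl
    lift_smul_row := fun t t' => rfl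
    free := Sum.inl 1
    smul_free_ne := fun x hx e => hx (by simpa using e)
    g := g
    h := h
    a := g
    b := h
    g_ne := hg
    h_ne := hh
    h_ne_inv := hi
    a_ne := hg
    b_ne := hh
    a_ne_b := hgh.symm
    cases := Or.inr ⟨hgh, hghi⟩}⟩

open scoped Pointwise in
theorem exists_rowSystem (hG : 3 ≤ #G) :
    ∃ K : Subgroup G, Nonempty (RowSystem G (FreeAndCosets K)) := by
  by_cases h3 : ∃ g : G, 3 ∣ orderOf g
  · obtain ⟨g, hg⟩ := h3
    exact ⟨_, nonempty_rowSystem_of_dvd hg⟩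
  push Not at h3
  refine ⟨⊥, ?_⟩
  by_cases h2 : ∀ g : G, g ^ 2 = 1
  · have hinv : ∀ g : G, g⁻¹ = g := fun g => inv_eq_of_mul_eq_one_left (by rw [← sq, h2])
    have hcomm : ∀ a b : G, a * b = b * a := fun a b => by
      rw [← hinv (a * b), mul_inv_rev, hinv, hinv]
    obtain ⟨a, b, ha, hb, hab⟩ : ∃ a b : G, a ≠ 1 ∧ b ≠ 1 ∧ b ≠ a := by
      obtain ⟨f⟩ : Nonempty (ULift.{u} (Fin 3) ↪ G) := by
        rw [← Cardinal.le_def]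
        simpa using hG
      have hf : ∀ i j : Fin 3, i ≠ j → f ⟨i⟩ ≠ f ⟨j⟩ := fun i j hij e =>
        hij (congrArg ULift.down (f.injective e))
      refine ⟨(f ⟨0⟩)⁻¹ * f ⟨1⟩, (f ⟨0⟩)⁻¹ * f ⟨2⟩, ?_, ?_, ?_⟩
      · rw [Ne, inv_mul_eq_one]
        exact hf _ _ (by decide)
      · rw [Ne, inv_mul_eq_one]
        exact hf _ _ (by decide)
      · rw [Ne, mul_right_inj]
        exact hf _ _ (by decide)
    let Q : Subgroup G := Subgroup.zpowers a ⊔ Subgroup.zpowers b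
    have hQ : (Q : Set G) = Subgroup.zpowers a * Subgroup.zpowers b := by
      let _ : CommGroup G := { (inferInstance : Group G) with mul_comm := hcomm }
      exact Subgroup.mul_normal _ _
    have hfin : ∀ g : G, (Subgroup.zpowers g : Set G).Finite := fun g => by
      have : IsOfFinOrder g := isOfFinOrder_iff_pow_eq_one.2 ⟨2, two_pos, h2 g⟩
      exact finite_zpowers.2 this
    have : Finite Q := by
      change Finite (Q : Set G)
      rw [hQ]
      exact (hfin a).mul (hfin b)
    have haQ : a ∈ Q := (le_sup_left : _ ≤ Q) (Subgroup.mem_zpowers a)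
    have hbQ : b ∈ Q := (le_sup_right : _ ≤ Q) (Subgroup.mem_zpowers b)
    refine nonempty_rowSystem_of_subgroup Q ⟨a, haQ⟩ ⟨b, hbQ⟩ ?_ ?_ ?_ ?_ ?_ <;>
      simp [Subtype.ext_iff, hinv, ha, hb, hab]
  · push Not at h2
    obtain ⟨g, hg⟩ := h2
    have h0 : orderOf g ≠ 0 := fun h => h3 g (by simp [h])
    have : Finite (Subgroup.zpowers g) := finite_zpowers.2 (orderOf_pos_iff.1 (by lia))
    have hn : ¬ orderOf g ∣ 2 := fun h => hg (orderOf_dvd_iff_pow_eq_one.1 h)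
    have h4 : 4 ≤ orderOf g := by
      have := h3 g
      by_contra!
      interval_cases orderOf g <;> simp_all
    have key : ∀ m n : ℤ, g ^ m = g ^ n ↔ (orderOf g : ℤ) ∣ m - n := fun m n => by
      rw [orderOf_dvd_iff_zpow_eq_one, zpow_sub, mul_inv_eq_one]
    have hel : ∀ m : ℤ, g ^ m ∈ Subgroup.zpowers g := fun m => ⟨m, rfl⟩
    have hnd : ∀ m : ℤ, m ≠ 0 → |m| < 4 → ¬ (orderOf g : ℤ) ∣ m := fun m hm hlt hd => by
      have := Int.le_of_dvd (abs_pos.2 hm) ((dvd_abs _ _).2 hd)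
      lia
    by_cases hg4 : orderOf g = 4
    · refine nonempty_rowSystem_of_subgroup (Subgroup.zpowers g) ⟨g ^ (2 : ℤ), hel _⟩
        ⟨g ^ (1 : ℤ), hel _⟩ ?_ ?_ ?_ ?_ ?_ <;>
      simp only [Ne, Subtype.ext_iff, Subgroup.coe_mul, Subgroup.coe_inv, Subgroup.coe_one,
        ← zpow_neg, ← zpow_add, ← zpow_zero g, key, hg4] <;> norm_num
    · refine nonempty_rowSystem_of_subgroup (Subgroup.zpowers g) ⟨g ^ (1 : ℤ), hel _⟩
        ⟨g ^ (2 : ℤ), hel _⟩ ?_ ?_ ?_ ?_ ?_ <;>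
      simp only [Ne, Subtype.ext_iff, Subgroup.coe_mul, Subgroup.coe_inv, Subgroup.coe_one,
        ← zpow_neg, ← zpow_add, ← zpow_zero g, key]
      · exact hnd _ (by decide) (by decide)
      · exact hnd _ (by decide) (by decide)
      · exact hnd _ (by decide) (by decide)
      · exact hnd _ (by decide) (by decide)
      · intro hd
        have := Int.le_of_dvd (by decide) hd
        lia

end Existence

/-- Corollary B: every group `G` with at least 3 elements embeds into a simple group
`S` which, for every `p ∈ {2,3,...} ∪ {∞}`, is generated by the image of `G` together
with a single element of order `p` (order `0` encodes `∞`). -/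
theorem embedding_into_simple_group_generated_by_G_and_element_of_any_order'
    (G : Type u) [Group G] (hG : 3 ≤ Cardinal.mk G) :
    ∃ (S : Type u) (_ : Group S),
      IsSimpleGroup S ∧
      ∃ φ : G →* S, Function.Injective φ ∧
        ∀ p : ℕ, (p = 0 ∨ 2 ≤ p) →
          ∃ x : S, orderOf x = p ∧ Subgroup.closure (Set.range φ ∪ {x}) = ⊤ := by
  obtain ⟨K, ⟨D⟩⟩ := exists_rowSystem hG
  refine exists_simple_of_rowSystem (Y := FreeAndCosets K × ℕ) D ?_
  have : Nonempty Label := ⟨.anchor⟩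
  rw [mk_prod, lift_id, lift_id, mk_prod_countable]
  refine mul_le_of_le (aleph0_le_mk _) (mk_le_of_injective (f := fun r => (r, 0)) ?_) le_rfl
  exact fun r r' h => congrArg Prod.fst h
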